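/- Let B and R be disjoint finite sets of points in the plane such that B is separable from R by a simple polygon P, and let q be a point with q ∉ B ∪ R. Then B ∪ {q} is separable from R by a simple polygon P′ having at most two more vertices than P (and at most |B| + 1 convex vertices). -/

import Mathlib

open scoped RealInnerProductSpace ENNReal Classical

noncomputable section

/-- Points of the Euclidean plane. -/
abbrev Pt : Type := EuclideanSpace ℝ (Fin 2)

/-- The planar determinant `det (u, v)` of two vectors. -/
def det2 (u v : Pt) : ℝ := u 0 * v 1 - u 1 * v 0

/-- No three of the points of `S` are collinear. -/
def NoThreeCollinear (S : Set Pt) : Prop :=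
  ∀ p ∈ S, ∀ q ∈ S, ∀ r ∈ S, p ≠ q → p ≠ r → q ≠ r → det2 (q - p) (r - p) ≠ 0

/-- `S` is in strong general position: no three points are collinear and for any four
distinct points `p₁ p₂ p₃ p₄` the line through `p₁,p₂` is not parallel to the line
through `p₃,p₄`. -/
def StrongGenPos (S : Set Pt) : Prop :=
  NoThreeCollinear S ∧
    ∀ p₁ ∈ S, ∀ p₂ ∈ S, ∀ p₃ ∈ S, ∀ p₄ ∈ S,
      p₁ ≠ p₂ → p₁ ≠ p₃ → p₁ ≠ p₄ → p₂ ≠ p₃ → p₂ ≠ p₄ → p₃ ≠ p₄ →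
        det2 (p₂ - p₁) (p₄ - p₃) ≠ 0

/-- A simple polygon, given by a cyclic sequence of `n ≥ 3` distinct vertices
(encoded as an `n`-periodic function `ℕ → Pt`), such that no point of the plane lies on
more than two closed edges, and the only points lying on exactly two edges are vertices. -/
structure SimplePolygon where
  n : ℕ
  three_le : 3 ≤ n
  vtx : ℕ → Pt
  periodic : ∀ i, vtx (i + n) = vtx i
  inj : ∀ i < n, ∀ j < n, vtx i = vtx j → i = j
  simple : ∀ x : Pt, {i | i < n ∧ x ∈ segment ℝ (vtx i) (vtx (i + 1))}.ncard ≤ 2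
  vtx_of_two : ∀ x : Pt,
    {i | i < n ∧ x ∈ segment ℝ (vtx i) (vtx (i + 1))}.ncard = 2 → ∃ i < n, x = vtx i

namespace SimplePolygon

/-- The boundary of a simple polygon: the union of its closed edges. -/
def boundary (P : SimplePolygon) : Set Pt :=
  ⋃ i ∈ Finset.range P.n, segment ℝ (P.vtx i) (P.vtx (i + 1))

/-- The interior of a simple polygon: the union of the bounded connected components of the
complement of the boundary. -/
def interior (P : SimplePolygon) : Set Pt :=
  {x | x ∉ P.boundary ∧ Bornology.IsBounded (connectedComponentIn P.boundaryᶜ x)}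

/-- A simple polygon, regarded as a point set: boundary together with interior. -/
def region (P : SimplePolygon) : Set Pt := P.boundary ∪ P.interior

/-- The set of vertices of the polygon. -/
def vertexSet (P : SimplePolygon) : Set Pt := {x | ∃ i < P.n, x = P.vtx i}

/-- Twice the shoelace signed area. -/
def shoelace (P : SimplePolygon) : ℝ := ∑ i ∈ Finset.range P.n, det2 (P.vtx i) (P.vtx (i + 1))

/-- The vertices are listed in counterclockwise order (positive shoelace signed area). -/
def CCW (P : SimplePolygon) : Prop := 0 < P.shoelace

/-- The vertex `vtx (i+1)` is a convex vertex:
`det (v_{i+1} − v_i, v_{i+2} − v_{i+1}) > 0` (vertices listed counterclockwise). -/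
def ConvexAt (P : SimplePolygon) (i : ℕ) : Prop :=
  0 < det2 (P.vtx (i + 1) - P.vtx i) (P.vtx (i + 2) - P.vtx (i + 1))

/-- The number of convex vertices of the polygon. -/
def numConvex (P : SimplePolygon) : ℕ := {i | i < P.n ∧ P.ConvexAt i}.ncard

/-- Continuous paths from `s` to `t` staying inside the polygon. -/
def pathsIn (P : SimplePolygon) (s t : Pt) : Set (ℝ → Pt) :=
  {γ | ContinuousOn γ (Set.Icc 0 1) ∧ γ 0 = s ∧ γ 1 = t ∧ γ '' Set.Icc (0 : ℝ) 1 ⊆ P.region}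

/-- The geodesic distance between `s` and `t` inside the polygon: the infimum of the
lengths (total variations) of continuous paths in the polygon from `s` to `t`. -/
def geodDist (P : SimplePolygon) (s t : Pt) : ℝ≥0∞ :=
  ⨅ γ ∈ P.pathsIn s t, eVariationOn γ (Set.Icc 0 1)

end SimplePolygon

/-- Length of a polygonal path through a list of points. -/
def polylineLen : List Pt → ℝ
  | [] => 0
  | [_] => 0
  | a :: b :: l => dist a b + polylineLen (b :: l)

/-- The polygonal path through a list of points, as a point set. -/
def polylineSet : List Pt → Set Pt
  | [] => ∅
  | [a] => {a}
  | a :: b :: l => segment ℝ a b ∪ polylineSet (b :: l)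

/-- `L` is the vertex sequence of the geodesic from `s` to `t` inside the polygon `P`:
a polygonal path inside `P` from `s` to `t`, with consecutive vertices distinct, with no
three consecutive vertices collinear, whose length realizes the geodesic distance. -/
def SimplePolygon.IsGeodesicChain (P : SimplePolygon) (s t : Pt) (L : List Pt) : Prop :=
  L.head? = some s ∧ L.getLast? = some t ∧ List.Chain' (· ≠ ·) L ∧
  (∀ i, i + 2 < L.length →
      det2 (L.getD (i + 1) 0 - L.getD i 0) (L.getD (i + 2) 0 - L.getD i 0) ≠ 0) ∧
  polylineSet L ⊆ P.region ∧
  ENNReal.ofReal (polylineLen L) = P.geodDist s t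

/-- The triple `(p,q,r)` is in geodesic counterclockwise order with respect to `P`:
writing the geodesics `π(p,q) = ⟨p = v₀, …, v_k = q⟩` and `π(p,r) = ⟨p = u₀, …, u_{k'} = r⟩`
and taking the smallest index `i > 0` with `v_i ≠ u_i`, we have
`det (v_i − v_{i−1}, u_i − v_{i−1}) > 0`. -/
def geodesicCCW (P : SimplePolygon) (p q r : Pt) : Prop :=
  ∃ L M : List Pt, P.IsGeodesicChain p q L ∧ P.IsGeodesicChain p r M ∧
    ∃ i : ℕ, 0 < i ∧ (∀ j < i, L[j]? = M[j]?) ∧ L[i]? ≠ M[i]? ∧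
      ∃ a b c : Pt, L[i - 1]? = some a ∧ L[i]? = some b ∧ M[i]? = some c ∧
        0 < det2 (b - a) (c - a)

/-- The triple `(p,q,r)` is in geodesic clockwise order with respect to `P`. -/
def geodesicCW (P : SimplePolygon) (p q r : Pt) : Prop :=
  ∃ L M : List Pt, P.IsGeodesicChain p q L ∧ P.IsGeodesicChain p r M ∧
    ∃ i : ℕ, 0 < i ∧ (∀ j < i, L[j]? = M[j]?) ∧ L[i]? ≠ M[i]? ∧
      ∃ a b c : Pt, L[i - 1]? = some a ∧ L[i]? = some b ∧ M[i]? = some c ∧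
        det2 (b - a) (c - a) < 0

/-- `C ⊆ P` is geodesically convex: for all `p, q ∈ C` the geodesic connecting them
stays inside `C`. -/
def GeodesicallyConvex (P : SimplePolygon) (C : Set Pt) : Prop :=
  C ⊆ P.region ∧ ∀ p ∈ C, ∀ q ∈ C, ∀ L, P.IsGeodesicChain p q L → polylineSet L ⊆ C

/-- The geodesic hull `CH_P(U)`: the intersection of all geodesically convex subsets of `P`
containing `U`. -/
def geodesicHull (P : SimplePolygon) (U : Set Pt) : Set Pt :=
  ⋂₀ {C | GeodesicallyConvex P C ∧ U ⊆ C}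

/-- `E_P(S)`: the set of points of `S` lying on the (topological) boundary of the geodesic
hull of `S` with respect to `P`. -/
def extremeSet (P : SimplePolygon) (S : Set Pt) : Set Pt :=
  {x ∈ S | x ∈ frontier (geodesicHull P S)}

/-- `B` is separable from `R`: there is a simple polygon with at most `|B|` convex vertices
whose interior contains all points of `R` and which contains no point of `B`. -/
def Separable (B R : Finset Pt) : Prop :=
  ∃ P : SimplePolygon, P.CCW ∧ P.numConvex ≤ B.card ∧
    (∀ r ∈ R, r ∈ P.interior) ∧ ∀ b ∈ B, b ∉ P.region

/-! ### Planar vectors -/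

/-- The dot product of two vectors of the plane, in coordinates. -/
def dot2 (u v : Pt) : ℝ := u 0 * v 0 + u 1 * v 1

/-- A vector of the plane as a complex number. -/
def toC (a : Pt) : ℂ := ⟨a 0, a 1⟩

lemma Pt.ext' {a b : Pt} (h0 : a 0 = b 0) (h1 : a 1 = b 1) : a = b := by
  ext i; fin_cases i <;> assumption

lemma toC_eq_zero {a : Pt} : toC a = 0 ↔ a = 0 := by
  constructor
  · intro h
    have h0 := congrArg Complex.re h
    have h1 := congrArg Complex.im h
    exact Pt.ext' (by simpa [toC] using h0) (by simpa [toC] using h1)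
  · rintro rfl; apply Complex.ext <;> simp [toC]

lemma continuous_toC : Continuous toC := by
  have : toC = fun a : Pt => ((a 0 : ℝ) : ℂ) + (a 1 : ℝ) * Complex.I := by
    funext a; apply Complex.ext <;> simp [toC]
  rw [this]; fun_prop

lemma det2_self (u : Pt) : det2 u u = 0 := by simp [det2]; ring
lemma det2_swap (u v : Pt) : det2 u v = - det2 v u := by simp [det2]; ring
lemma det2_add_left (u v w : Pt) : det2 (u + v) w = det2 u w + det2 v w := by
  simp [det2]; ring
lemma det2_add_right (u v w : Pt) : det2 u (v + w) = det2 u v + det2 u w := by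
  simp [det2]; ring
lemma det2_sub_left (u v w : Pt) : det2 (u - v) w = det2 u w - det2 v w := by
  simp [det2]; ring
lemma det2_sub_right (u v w : Pt) : det2 u (v - w) = det2 u v - det2 u w := by
  simp [det2]; ring
lemma det2_smul_left (c : ℝ) (v w : Pt) : det2 (c • v) w = c * det2 v w := by
  simp [det2]; ring
lemma det2_smul_right (c : ℝ) (v w : Pt) : det2 v (c • w) = c * det2 v w := by
  simp [det2]; ring

lemma continuous_det2 : Continuous fun x : Pt × Pt => det2 x.1 x.2 := by
  unfold det2; fun_prop

lemma dot2_self_pos {u : Pt} (h : u ≠ 0) : 0 < dot2 u u := by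
  by_contra hc
  have h0 : u 0 = 0 := by unfold dot2 at hc; nlinarith [sq_nonneg (u 0), sq_nonneg (u 1)]
  have h1 : u 1 = 0 := by unfold dot2 at hc; nlinarith [sq_nonneg (u 0), sq_nonneg (u 1)]
  exact h (Pt.ext' (by simpa using h0) (by simpa using h1))

lemma mem_segment_iff_param {p a b : Pt} :
    p ∈ segment ℝ a b ↔ ∃ t : ℝ, 0 ≤ t ∧ t ≤ 1 ∧ p = a + t • (b - a) := by
  rw [segment_eq_image']
  constructor
  · rintro ⟨t, ⟨h0, h1⟩, rfl⟩; exact ⟨t, h0, h1, rfl⟩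
  · rintro ⟨t, h0, h1, rfl⟩; exact ⟨t, ⟨h0, h1⟩, rfl⟩

lemma mem_segment_of_det2_dot2 {p a b : Pt} (h : det2 (a - p) (b - p) = 0)
    (h' : dot2 (a - p) (b - p) ≤ 0) : p ∈ segment ℝ a b := by
  by_cases hb : b - p = 0
  · rw [sub_eq_zero] at hb; rw [hb]; exact right_mem_segment ℝ a p
  have hy := dot2_self_pos hb
  rw [mem_segment_iff_param]
  set D := dot2 (b - p) (b - p) - dot2 (a - p) (b - p) with hD
  have hDpos : 0 < D := by linarith
  refine ⟨- dot2 (a - p) (b - p) / D, by apply div_nonneg <;> linarith,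
    by rw [div_le_one hDpos]; linarith, ?_⟩
  simp only [det2, dot2, PiLp.sub_apply] at *
  apply Pt.ext'
  · simp only [PiLp.add_apply, PiLp.smul_apply, PiLp.sub_apply, smul_eq_mul]
    field_simp
    rw [hD]
    linear_combination (-(b.ofLp 1 - p.ofLp 1)) * h
  · simp only [PiLp.add_apply, PiLp.smul_apply, PiLp.sub_apply, smul_eq_mul]
    field_simp
    rw [hD]
    linear_combination (b.ofLp 0 - p.ofLp 0) * h

lemma det2_eq_zero_of_mem_segment {p a b : Pt} (h : p ∈ segment ℝ a b) :
    det2 (b - a) (p - a) = 0 := by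
  obtain ⟨t, -, -, rfl⟩ := mem_segment_iff_param.1 h
  simp [det2]; ring

/-! ### Oriented angles and winding numbers -/

/-- The complex number whose argument is the angle from `a` to `b` seen from `p`. -/
def angC (p a b : Pt) : ℂ := (starRingEnd ℂ) (toC (a - p)) * toC (b - p)

/-- The oriented angle under which the segment from `a` to `b` is seen from `p`. -/
def ang (p a b : Pt) : ℝ := (angC p a b).arg

lemma angC_re (p a b : Pt) : (angC p a b).re = dot2 (a - p) (b - p) := by
  simp [angC, toC, dot2]; ring

lemma angC_im (p a b : Pt) : (angC p a b).im = det2 (a - p) (b - p) := by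
  simp [angC, toC, det2]; ring

lemma continuous_angC (a b : Pt) : Continuous fun p => angC p a b := by
  unfold angC
  exact (Complex.continuous_conj.comp (continuous_toC.comp (by fun_prop))).mul
    (continuous_toC.comp (by fun_prop))

lemma angC_mem_slitPlane {p a b : Pt} (h : p ∉ segment ℝ a b) :
    angC p a b ∈ Complex.slitPlane := by
  rw [Complex.mem_slitPlane_iff, angC_re, angC_im]
  by_contra hc
  push Not at hc
  exact h (mem_segment_of_det2_dot2 hc.2 hc.1)

lemma continuousAt_ang {p a b : Pt} (h : p ∉ segment ℝ a b) :
    ContinuousAt (fun p => ang p a b) p :=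
  ContinuousAt.comp (f := fun p => angC p a b) (Complex.continuousAt_arg (angC_mem_slitPlane h))
    (continuous_angC a b).continuousAt

lemma ang_pos {p a b : Pt} (h : 0 < det2 (a - p) (b - p)) : 0 < ang p a b := by
  have h1 : 0 ≤ ang p a b := by
    unfold ang; rw [Complex.arg_nonneg_iff, angC_im]; exact h.le
  refine lt_of_le_of_ne h1 fun h2 => ?_
  have := (Complex.arg_eq_zero_iff.1 h2.symm).2
  rw [angC_im] at this; linarith

lemma ang_lt_pi {p a b : Pt} (h : det2 (a - p) (b - p) ≠ 0) : ang p a b < Real.pi := by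
  unfold ang; rw [Complex.arg_lt_pi_iff, angC_im]; exact Or.inr h

lemma ang_swap {p a b : Pt} (h : p ∉ segment ℝ a b) : ang p b a = - ang p a b := by
  have h1 : angC p b a = (starRingEnd ℂ) (angC p a b) := by
    simp [angC, mul_comm]
  unfold ang
  rw [h1, Complex.arg_conj, if_neg]
  intro h2
  exact (Complex.mem_slitPlane_iff_arg.1 (angC_mem_slitPlane h)).1 h2

lemma ang_coe {p a b : Pt} (ha : p ≠ a) (hb : p ≠ b) :
    ((ang p a b : ℝ) : Real.Angle) = (toC (b - p)).arg - ((toC (a - p)).arg : Real.Angle) := by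
  have h1 : toC (a - p) ≠ 0 := by rw [Ne, toC_eq_zero, sub_eq_zero]; exact fun h => ha h.symm
  have h2 : toC (b - p) ≠ 0 := by rw [Ne, toC_eq_zero, sub_eq_zero]; exact fun h => hb h.symm
  unfold ang angC
  rw [Complex.arg_mul_coe_angle ((map_ne_zero _).2 h1) h2, Complex.arg_conj_coe_angle]
  abel

/-- The winding number around `p` of the closed polygonal curve `v 0, …, v (n - 1), v n = v 0`. -/
def windS (v : ℕ → Pt) (n : ℕ) (p : Pt) : ℝ :=
  (∑ i ∈ Finset.range n, ang p (v i) (v (i + 1))) / (2 * Real.pi)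

lemma windS_int {v : ℕ → Pt} {n : ℕ} {p : Pt} (hv : v n = v 0) (hp : ∀ i ≤ n, p ≠ v i) :
    ∃ k : ℤ, windS v n p = k := by
  have h : ((∑ i ∈ Finset.range n, ang p (v i) (v (i + 1)) : ℝ) : Real.Angle) = (0 : ℝ) := by
    have h1 : ((∑ i ∈ Finset.range n, ang p (v i) (v (i + 1)) : ℝ) : Real.Angle) =
        ∑ i ∈ Finset.range n, ((ang p (v i) (v (i + 1)) : ℝ) : Real.Angle) :=
      map_sum Real.Angle.coeHom _ _
    rw [h1, Finset.sum_congr rfl (fun i hi => ang_coe (hp i (Finset.mem_range.1 hi).le)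
      (hp (i+1) (Finset.mem_range.1 hi)))]
    rw [Finset.sum_range_sub (fun i => (((toC (v i - p)).arg : ℝ) : Real.Angle)), hv]
    simp
  obtain ⟨k, hk⟩ := Real.Angle.angle_eq_iff_two_pi_dvd_sub.1 h
  refine ⟨k, ?_⟩
  unfold windS
  rw [div_eq_iff (by positivity)]
  linarith

lemma subsingleton_of_isPreconnected_int {s : Set ℝ} (hs : IsPreconnected s)
    (h : ∀ x ∈ s, ∃ k : ℤ, x = k) : s.Subsingleton := by
  have key : ∀ x ∈ s, ∀ y ∈ s, ¬ x < y := by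
    intro x hx y hy hxy
    obtain ⟨k, rfl⟩ := h x hx
    obtain ⟨l, rfl⟩ := h y hy
    have hkl : k < l := by exact_mod_cast hxy
    have hkl' : (k : ℝ) + 1 ≤ l := by exact_mod_cast hkl
    have : (k : ℝ) + 1/2 ∈ s := hs.ordConnected.out hx hy ⟨by linarith, by linarith⟩
    obtain ⟨m, hm⟩ := h _ this
    have h1 : (k : ℝ) < m := by linarith
    have h2 : (m : ℝ) < k + 1 := by linarith
    have h1' : k < m := by exact_mod_cast h1
    have h2' : m < k + 1 := by exact_mod_cast h2
    omega
  intro x hx y hy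
  rcases lt_trichotomy x y with h1 | h1 | h1
  · exact absurd h1 (key x hx y hy)
  · exact h1
  · exact absurd h1 (key y hy x hx)

/-- The union of the edges of a polygonal curve. -/
def bdS (v : ℕ → Pt) (n : ℕ) : Set Pt := {p | ∃ i < n, p ∈ segment ℝ (v i) (v (i + 1))}

lemma ne_of_notMem_bdS {v : ℕ → Pt} {n : ℕ} {p : Pt} (hn : 0 < n) (hv : v n = v 0)
    (hp : p ∉ bdS v n) : ∀ i ≤ n, p ≠ v i := by
  rintro i hi rfl
  apply hp
  rcases hi.lt_or_eq with h | rfl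
  · exact ⟨i, h, left_mem_segment ℝ _ _⟩
  · exact ⟨0, hn, by rw [hv]; exact left_mem_segment ℝ _ _⟩

lemma continuousAt_windS {v : ℕ → Pt} {n : ℕ} {p : Pt} (hp : p ∉ bdS v n) :
    ContinuousAt (windS v n) p := by
  unfold windS
  refine ContinuousAt.div_const ?_ _
  refine tendsto_finsetSum _ fun i hi => ?_
  exact continuousAt_ang fun h => hp ⟨i, Finset.mem_range.1 hi, h⟩

lemma windS_eq_of_isPreconnected {v : ℕ → Pt} {n : ℕ} (hn : 0 < n) (hv : v n = v 0)
    {s : Set Pt} (hs : IsPreconnected s) (hd : ∀ p ∈ s, p ∉ bdS v n) {p q : Pt}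
    (hp : p ∈ s) (hq : q ∈ s) : windS v n p = windS v n q := by
  have h1 : IsPreconnected (windS v n '' s) :=
    hs.image _ fun x hx => (continuousAt_windS (hd x hx)).continuousWithinAt
  refine subsingleton_of_isPreconnected_int h1 ?_ ⟨p, hp, rfl⟩ ⟨q, hq, rfl⟩
  rintro _ ⟨x, hx, rfl⟩
  exact windS_int hv (ne_of_notMem_bdS hn hv (hd x hx))

/-- A closed polygonal curve does not wind around a point that some open half-plane separates
from all its vertices. -/
lemma windS_eq_zero_of_dot2_pos {v : ℕ → Pt} {n : ℕ} {p d : Pt} (hv : v n = v 0)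
    (h : ∀ i ≤ n, 0 < dot2 d (v i - p)) : windS v n p = 0 := by
  set u : ℕ → ℂ := fun i => (starRingEnd ℂ) (toC d) * toC (v i - p) with hu
  have hre : ∀ i ≤ n, 0 < (u i).re := by
    intro i hi
    have := h i hi
    simpa [hu, toC, dot2] using this
  have hd : toC d ≠ 0 := by
    intro h0
    rw [toC_eq_zero] at h0
    have := h 0 (Nat.zero_le _)
    rw [h0] at this; simp [dot2] at this
  have hlt : ∀ i ≤ n, |(u i).arg| < Real.pi / 2 := fun i hi =>
    Complex.abs_arg_lt_pi_div_two_iff.2 (Or.inl (hre i hi))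
  have hne : ∀ i ≤ n, u i ≠ 0 := fun i hi h0 => by
    have := hre i hi; rw [h0] at this; simp at this
  have key : ∀ i < n, ang p (v i) (v (i + 1)) = (u (i + 1)).arg - (u i).arg := by
    intro i hi
    have hi' : i + 1 ≤ n := hi
    have e1 : (starRingEnd ℂ) (u i) * u (i + 1) =
        ((Complex.normSq (toC d) : ℝ) : ℂ) * angC p (v i) (v (i + 1)) := by
      simp only [hu, angC, map_mul, Complex.conj_conj, Complex.normSq_eq_conj_mul_self]
      ring
    have e2 : ((starRingEnd ℂ) (u i) * u (i + 1)).arg = ang p (v i) (v (i + 1)) := by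
      rw [e1, Complex.arg_real_mul _ (Complex.normSq_pos.2 hd), ang]
    have a1 := abs_lt.1 (hlt i hi.le)
    have a2 := abs_lt.1 (hlt (i + 1) hi')
    have e3 : ((starRingEnd ℂ) (u i)).arg = - (u i).arg := by
      rw [Complex.arg_conj, if_neg]
      intro h0; linarith [Real.pi_pos]
    rw [← e2, (Complex.arg_mul_eq_add_arg_iff ((map_ne_zero _).2 (hne i hi.le))
      (hne _ hi')).2, e3]
    · ring
    · rw [e3]; constructor <;> linarith
  unfold windS
  rw [Finset.sum_congr rfl fun i hi => key i (Finset.mem_range.1 hi),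
    Finset.sum_range_sub (fun i => (u i).arg)]
  simp [hu, hv]

lemma exists_dot2_of_notMem {s : Set Pt} (hs : Convex ℝ s) (hc : IsClosed s) {p : Pt}
    (hp : p ∉ s) : ∃ d : Pt, d ≠ 0 ∧ ∀ b ∈ s, 0 < dot2 d (b - p) := by
  by_cases hne : s = ∅
  · refine ⟨!₂[1, 0], ?_, by simp [hne]⟩
    intro h
    have := congrArg (fun x : Pt => x 0) h
    simp at this
  obtain ⟨f, u, h1, h2⟩ := geometric_hahn_banach_point_closed hs hc hp
  set d := (InnerProductSpace.toDual ℝ Pt).symm f with hd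
  have hf : ∀ x, f x = dot2 d x := by
    intro x
    have : inner ℝ d x = f x := InnerProductSpace.toDual_symm_apply
    rw [← this, PiLp.inner_apply]
    simp [dot2, Fin.sum_univ_two, mul_comm]
  have h3 : ∀ b ∈ s, 0 < dot2 d (b - p) := by
    intro b hb
    have h4 := h2 b hb
    have h5 : dot2 d (b - p) = dot2 d b - dot2 d p := by simp [dot2]; ring
    rw [h5, ← hf, ← hf]; linarith
  refine ⟨d, ?_, h3⟩
  intro h0
  obtain ⟨b, hb⟩ := Set.nonempty_iff_ne_empty.2 hne
  have := h3 b hb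
  rw [h0] at this; simp [dot2] at this

/-- The triangle `u → w → x → u` winds around `p` this often. -/
def windT (u w x p : Pt) : ℝ := (ang p u w + ang p w x + ang p x u) / (2 * Real.pi)

/-- The cyclic vertex sequence of a triangle. -/
def triSeq (u w x : Pt) : ℕ → Pt := fun i => if i % 3 = 0 then u else if i % 3 = 1 then w else x

lemma windT_eq_windS (u w x p : Pt) : windT u w x p = windS (triSeq u w x) 3 p := by
  simp [windT, windS, triSeq, Finset.sum_range_succ]

lemma windT_eq_zero {u w x p : Pt} (hp : p ∉ convexHull ℝ {u, w, x}) : windT u w x p = 0 := by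
  have hc : IsClosed (convexHull ℝ ({u, w, x} : Set Pt)) :=
    (Set.Finite.isCompact_convexHull ℝ (by simp)).isClosed
  obtain ⟨d, -, hd⟩ := exists_dot2_of_notMem (convex_convexHull ℝ _) hc hp
  rw [windT_eq_windS]
  apply windS_eq_zero_of_dot2_pos (d := d) (by simp [triSeq])
  intro i _
  apply hd
  apply subset_convexHull
  unfold triSeq
  split_ifs <;> simp

lemma windT_eq_one {u w x p : Pt} (h1 : 0 < det2 (u - p) (w - p)) (h2 : 0 < det2 (w - p) (x - p))
    (h3 : 0 < det2 (x - p) (u - p)) : windT u w x p = 1 := by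
  have hne : ∀ i ≤ 3, p ≠ triSeq u w x i := by
    intro i _ h
    unfold triSeq at h
    split_ifs at h
    · rw [h] at h1; simp [det2] at h1
    · rw [h] at h2; simp [det2] at h2
    · rw [h] at h3; simp [det2] at h3
  obtain ⟨k, hk⟩ := windS_int (v := triSeq u w x) (n := 3) (p := p) (by simp [triSeq]) hne
  rw [← windT_eq_windS] at hk
  have a1 := ang_pos h1
  have a2 := ang_pos h2
  have a3 := ang_pos h3
  have b1 := ang_lt_pi h1.ne'
  have b2 := ang_lt_pi h2.ne'
  have b3 := ang_lt_pi h3.ne'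
  have c1 : 0 < windT u w x p := by unfold windT; positivity
  have c2 : windT u w x p < 2 := by
    unfold windT; rw [div_lt_iff₀ (by positivity)]; linarith [Real.pi_pos]
  rw [hk] at c1 c2 ⊢
  have d1 : 0 < k := by exact_mod_cast c1
  have d2 : k < 2 := by exact_mod_cast c2
  have : k = 1 := by omega
  simp [this]

/-! ### Local structure of the complement of two rays -/

/-- The union of the two rays from `p` with directions `d₁` and `d₂`. -/
def rays (p d₁ d₂ : Pt) : Set Pt := {x | ∃ t : ℝ, 0 ≤ t ∧ (x = p + t • d₁ ∨ x = p + t • d₂)}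

lemma rays_comm (p d₁ d₂ : Pt) : rays p d₁ d₂ = rays p d₂ d₁ := by
  ext x; simp only [rays, Set.mem_ofPred_eq, or_comm]

lemma mem_closure_of_small {S U : Set Pt} {x w : Pt} (hU : IsOpen U) (hx : x ∈ U)
    (h : ∀ s : ℝ, 0 < s → x + s • w ∈ U → x + s • w ∈ S) : x ∈ closure S := by
  have ht : Filter.Tendsto (fun s : ℝ => x + s • w) (nhdsWithin 0 (Set.Ioi 0)) (nhds x) := by
    have : Continuous fun s : ℝ => x + s • w := by fun_prop
    have h1 := this.tendsto 0
    simp only [zero_smul, add_zero] at h1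
    exact h1.mono_left nhdsWithin_le_nhds
  refine mem_closure_of_tendsto ht ?_
  filter_upwards [ht (hU.mem_nhds hx), self_mem_nhdsWithin] with s h1 h2
  exact h s h2 h1

lemma convex_det2_pos (p d : Pt) : Convex ℝ {x : Pt | 0 < det2 d (x - p)} := by
  intro x hx y hy a b ha hb hab
  simp only [Set.mem_ofPred_eq] at *
  have : det2 d (a • x + b • y - p) = a * det2 d (x - p) + b * det2 d (y - p) := by
    simp only [det2, PiLp.add_apply, PiLp.smul_apply, PiLp.sub_apply, smul_eq_mul]
    linear_combination (d 0 * p 1 - d 1 * p 0) * hab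
  rw [this]
  rcases ha.eq_or_lt with rfl | h
  · have : b = 1 := by linarith
    subst this; linarith
  · nlinarith [mul_pos h hx, mul_nonneg hb hy.le]

lemma convex_det2_neg (p d : Pt) : Convex ℝ {x : Pt | det2 d (x - p) < 0} := by
  have := convex_det2_pos p (-d)
  convert this using 2
  simp [det2]

lemma exists_sector_of_det2_pos {p d₁ d₂ : Pt} {ε : ℝ} (hε : 0 < ε) (hD : 0 < det2 d₁ d₂)
    {y : Pt} (hy : y ∈ Metric.ball p ε) (hyK : y ∉ rays p d₁ d₂) :
    ∃ S : Set Pt, IsPreconnected S ∧ y ∈ S ∧ S ⊆ Metric.ball p ε ∧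
      (∀ x ∈ S, x ∉ rays p d₁ d₂) ∧ ∀ x ∈ Metric.ball p ε, x ∈ rays p d₁ d₂ → x ∈ closure S := by
  have hb : IsOpen (Metric.ball p ε) := Metric.isOpen_ball
  have hcb : Convex ℝ (Metric.ball p ε) := convex_ball p ε
  have e1 : ∀ t : ℝ, det2 d₁ (p + t • d₁ - p) = 0 := fun t => by simp [det2]; ring
  have e2 : ∀ t : ℝ, det2 d₂ (p + t • d₁ - p) = - (t * det2 d₁ d₂) := fun t => by
    simp [det2]; ring
  have e3 : ∀ t : ℝ, det2 d₁ (p + t • d₂ - p) = t * det2 d₁ d₂ := fun t => by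
    simp [det2]; ring
  have e4 : ∀ t : ℝ, det2 d₂ (p + t • d₂ - p) = 0 := fun t => by simp [det2]; ring
  by_cases hc : 0 < det2 d₁ (y - p) ∧ det2 d₂ (y - p) < 0
  · refine ⟨Metric.ball p ε ∩ {x | 0 < det2 d₁ (x - p)} ∩ {x | det2 d₂ (x - p) < 0},
      ((hcb.inter (convex_det2_pos _ _)).inter (convex_det2_neg _ _)).isPreconnected,
      ⟨⟨hy, hc.1⟩, hc.2⟩, fun x hx => hx.1.1, ?_, ?_⟩
    · rintro x ⟨⟨-, h1⟩, h2⟩ ⟨t, ht, rfl | rfl⟩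
      · simp only [Set.mem_ofPred_eq, e1] at h1; exact lt_irrefl _ h1
      · simp only [Set.mem_ofPred_eq, e4] at h2; exact lt_irrefl _ h2
    · rintro x hx ⟨t, ht, rfl | rfl⟩
      · refine mem_closure_of_small (w := d₁ + d₂) hb hx fun s hs hU => ⟨⟨hU, ?_⟩, ?_⟩
        · have : det2 d₁ (p + t • d₁ + s • (d₁ + d₂) - p) = s * det2 d₁ d₂ := by
            simp [det2]; ring
          simp only [Set.mem_ofPred_eq, this]; positivity
        · have : det2 d₂ (p + t • d₁ + s • (d₁ + d₂) - p) = - ((t + s) * det2 d₁ d₂) := by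
            simp [det2]; ring
          simp only [Set.mem_ofPred_eq, this, neg_lt_zero]; positivity
      · refine mem_closure_of_small (w := d₁ + d₂) hb hx fun s hs hU => ⟨⟨hU, ?_⟩, ?_⟩
        · have : det2 d₁ (p + t • d₂ + s • (d₁ + d₂) - p) = (t + s) * det2 d₁ d₂ := by
            simp [det2]; ring
          simp only [Set.mem_ofPred_eq, this]; positivity
        · have : det2 d₂ (p + t • d₂ + s • (d₁ + d₂) - p) = - (s * det2 d₁ d₂) := by
            simp [det2]; ring
          simp only [Set.mem_ofPred_eq, this, neg_lt_zero]; positivity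
  · set A := Metric.ball p ε ∩ {x | det2 d₁ (x - p) < 0}
    set B := Metric.ball p ε ∩ {x | 0 < det2 d₂ (x - p)}
    have hA : IsPreconnected A := (hcb.inter (convex_det2_neg _ _)).isPreconnected
    have hB : IsPreconnected B := (hcb.inter (convex_det2_pos _ _)).isPreconnected
    obtain ⟨s, hs, hsb⟩ : ∃ s : ℝ, 0 < s ∧ p + s • (-(d₁ + d₂)) ∈ Metric.ball p ε := by
      have hcont : Continuous fun s : ℝ => p + s • (-(d₁ + d₂)) := by fun_prop
      have h1 := hcont.tendsto 0
      simp only [zero_smul, add_zero] at h1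
      have h2 : ∀ᶠ s in nhdsWithin (0 : ℝ) (Set.Ioi 0),
          p + s • (-(d₁ + d₂)) ∈ Metric.ball p ε :=
        (h1.mono_left nhdsWithin_le_nhds) (Metric.ball_mem_nhds p hε)
      obtain ⟨s, h3, h4⟩ := (h2.and (self_mem_nhdsWithin)).exists
      exact ⟨s, h4, h3⟩
    refine ⟨A ∪ B, IsPreconnected.union (p + s • (-(d₁ + d₂))) ⟨hsb, ?_⟩ ⟨hsb, ?_⟩ hA hB,
      ?_, ?_, ?_, ?_⟩
    · have : det2 d₁ (p + s • (-(d₁ + d₂)) - p) = - (s * det2 d₁ d₂) := by simp [det2]; ring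
      simp only [Set.mem_ofPred_eq, this, neg_lt_zero]; positivity
    · have : det2 d₂ (p + s • (-(d₁ + d₂)) - p) = s * det2 d₁ d₂ := by simp [det2]; ring
      simp only [Set.mem_ofPred_eq, this]; positivity
    · by_contra hn
      simp only [A, B, Set.mem_union, Set.mem_inter_iff, hy, true_and, Set.mem_ofPred_eq,
        not_or, not_lt] at hn
      have hrep : y = p + (-det2 d₂ (y - p) / det2 d₁ d₂) • d₁ +
          (det2 d₁ (y - p) / det2 d₁ d₂) • d₂ := by
        have hD' := hD.ne'
        apply Pt.ext' <;>
        · simp only [PiLp.add_apply, PiLp.smul_apply, smul_eq_mul]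
          field_simp
          simp only [det2, PiLp.sub_apply]; ring
      apply hyK
      rcases hn.1.eq_or_lt with h0 | h0
      · refine ⟨-det2 d₂ (y - p) / det2 d₁ d₂, div_nonneg (by linarith) hD.le, Or.inl ?_⟩
        rw [← h0] at hrep; simpa using hrep
      · have h0' : det2 d₂ (y - p) = 0 := by
          by_contra hne
          exact hc ⟨h0, lt_of_le_of_ne hn.2 hne⟩
        refine ⟨det2 d₁ (y - p) / det2 d₁ d₂, div_nonneg hn.1 hD.le, Or.inr ?_⟩
        rw [h0'] at hrep; simpa using hrep
    · exact Set.union_subset Set.inter_subset_left Set.inter_subset_left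
    · rintro x (⟨-, h1⟩ | ⟨-, h1⟩) ⟨t, ht, rfl | rfl⟩
      · simp only [Set.mem_ofPred_eq, e1] at h1; exact lt_irrefl _ h1
      · simp only [Set.mem_ofPred_eq, e3] at h1; nlinarith
      · simp only [Set.mem_ofPred_eq, e2] at h1; nlinarith
      · simp only [Set.mem_ofPred_eq, e4] at h1; exact lt_irrefl _ h1
    · rintro x hx ⟨t, ht, rfl | rfl⟩
      · refine mem_closure_of_small (w := -d₂) hb hx fun s hs hU => Or.inl ⟨hU, ?_⟩
        have : det2 d₁ (p + t • d₁ + s • (-d₂) - p) = - (s * det2 d₁ d₂) := by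
          simp [det2]; ring
        simp only [Set.mem_ofPred_eq, this, neg_lt_zero]; positivity
      · refine mem_closure_of_small (w := -d₁) hb hx fun s hs hU => Or.inr ⟨hU, ?_⟩
        have : det2 d₂ (p + t • d₂ + s • (-d₁) - p) = s * det2 d₁ d₂ := by
          simp [det2]; ring
        simp only [Set.mem_ofPred_eq, this]; positivity

/-- The vector `d` turned by a quarter turn to the left. -/
def perp (d : Pt) : Pt := !₂[-(d 1), d 0]

lemma det2_perp (d : Pt) : det2 d (perp d) = dot2 d d := by simp [det2, dot2, perp]

lemma exists_sector_of_opposite {p d₁ d₂ : Pt} {ε : ℝ} (hD : det2 d₁ d₂ = 0)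
    (hdot : dot2 d₁ d₂ < 0)
    {y : Pt} (hy : y ∈ Metric.ball p ε) (hyK : y ∉ rays p d₁ d₂) :
    ∃ S : Set Pt, IsPreconnected S ∧ y ∈ S ∧ S ⊆ Metric.ball p ε ∧
      (∀ x ∈ S, x ∉ rays p d₁ d₂) ∧ ∀ x ∈ Metric.ball p ε, x ∈ rays p d₁ d₂ → x ∈ closure S := by
  have hb : IsOpen (Metric.ball p ε) := Metric.isOpen_ball
  have hcb : Convex ℝ (Metric.ball p ε) := convex_ball p ε
  have hd1 : d₁ ≠ 0 := by rintro rfl; simp [dot2] at hdot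
  have hdd := dot2_self_pos hd1
  have e1 : ∀ t : ℝ, det2 d₁ (p + t • d₁ - p) = 0 := fun t => by simp [det2]; ring
  have e3 : ∀ t : ℝ, det2 d₁ (p + t • d₂ - p) = 0 := fun t => by
    have : det2 d₁ (p + t • d₂ - p) = t * det2 d₁ d₂ := by simp [det2]; ring
    rw [this, hD, mul_zero]
  have f1 : ∀ t s : ℝ, det2 d₁ (p + t • d₁ + s • perp d₁ - p) = s * dot2 d₁ d₁ := fun t s => by
    rw [← det2_perp]; simp [det2]; ring
  have f2 : ∀ t s : ℝ, det2 d₁ (p + t • d₂ + s • perp d₁ - p) = s * dot2 d₁ d₁ := fun t s => by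
    have : det2 d₁ (p + t • d₂ + s • perp d₁ - p) = t * det2 d₁ d₂ + s * det2 d₁ (perp d₁) := by
      simp [det2]; ring
    rw [this, hD, det2_perp]; ring
  have g1 : ∀ t s : ℝ, det2 d₁ (p + t • d₁ + s • (- perp d₁) - p) = - (s * dot2 d₁ d₁) :=
    fun t s => by
      have := f1 t (-s)
      rw [smul_neg, ← neg_smul, this]; ring
  have g2 : ∀ t s : ℝ, det2 d₁ (p + t • d₂ + s • (- perp d₁) - p) = - (s * dot2 d₁ d₁) :=
    fun t s => by
      have := f2 t (-s)
      rw [smul_neg, ← neg_smul, this]; ring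
  have hne : det2 d₁ (y - p) ≠ 0 := by
    intro h0
    apply hyK
    have hrep : y = p + (dot2 d₁ (y - p) / dot2 d₁ d₁) • d₁ := by
      have hdd' := hdd.ne'
      apply Pt.ext'
      · simp only [PiLp.add_apply, PiLp.smul_apply, smul_eq_mul]
        field_simp
        simp only [det2, dot2, PiLp.sub_apply] at *
        linear_combination (-(d₁ 1)) * h0
      · simp only [PiLp.add_apply, PiLp.smul_apply, smul_eq_mul]
        field_simp
        simp only [det2, dot2, PiLp.sub_apply] at *
        linear_combination (d₁ 0) * h0
    have hrep2 : y = p + (dot2 d₁ (y - p) / dot2 d₁ d₂) • d₂ := by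
      have hdd' := hdot.ne
      have hy0 := congrArg (fun z : Pt => z 0) hrep
      have hy1 := congrArg (fun z : Pt => z 1) hrep
      simp only [PiLp.add_apply, PiLp.smul_apply, smul_eq_mul] at hy0 hy1
      apply Pt.ext'
      · simp only [PiLp.add_apply, PiLp.smul_apply, smul_eq_mul]
        field_simp
        simp only [det2, dot2, PiLp.sub_apply] at *
        linear_combination (-(d₂ 1)) * h0 + (y 1 - p 1) * hD
      · simp only [PiLp.add_apply, PiLp.smul_apply, smul_eq_mul]
        field_simp
        simp only [det2, dot2, PiLp.sub_apply] at *
        linear_combination (d₂ 0) * h0 - (y 0 - p 0) * hD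
    rcases le_total 0 (dot2 d₁ (y - p)) with h | h
    · exact ⟨_, div_nonneg h hdd.le, Or.inl hrep⟩
    · exact ⟨_, div_nonneg_of_nonpos h hdot.le, Or.inr hrep2⟩
  rcases lt_or_gt_of_ne hne with h | h
  · refine ⟨Metric.ball p ε ∩ {x | det2 d₁ (x - p) < 0},
      (hcb.inter (convex_det2_neg _ _)).isPreconnected, ⟨hy, h⟩, fun x hx => hx.1, ?_, ?_⟩
    · rintro x ⟨-, h1⟩ ⟨t, ht, rfl | rfl⟩
      · simp only [Set.mem_ofPred_eq, e1] at h1; exact lt_irrefl _ h1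
      · simp only [Set.mem_ofPred_eq, e3] at h1; exact lt_irrefl _ h1
    · rintro x hx ⟨t, ht, rfl | rfl⟩
      · refine mem_closure_of_small (w := -perp d₁) hb hx fun s hs hU => ⟨hU, ?_⟩
        simp only [Set.mem_ofPred_eq, g1, neg_lt_zero]; positivity
      · refine mem_closure_of_small (w := -perp d₁) hb hx fun s hs hU => ⟨hU, ?_⟩
        simp only [Set.mem_ofPred_eq, g2, neg_lt_zero]; positivity
  · refine ⟨Metric.ball p ε ∩ {x | 0 < det2 d₁ (x - p)},
      (hcb.inter (convex_det2_pos _ _)).isPreconnected, ⟨hy, h⟩, fun x hx => hx.1, ?_, ?_⟩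
    · rintro x ⟨-, h1⟩ ⟨t, ht, rfl | rfl⟩
      · simp only [Set.mem_ofPred_eq, e1] at h1; exact lt_irrefl _ h1
      · simp only [Set.mem_ofPred_eq, e3] at h1; exact lt_irrefl _ h1
    · rintro x hx ⟨t, ht, rfl | rfl⟩
      · refine mem_closure_of_small (w := perp d₁) hb hx fun s hs hU => ⟨hU, ?_⟩
        simp only [Set.mem_ofPred_eq, f1]; positivity
      · refine mem_closure_of_small (w := perp d₁) hb hx fun s hs hU => ⟨hU, ?_⟩
        simp only [Set.mem_ofPred_eq, f2]; positivity

lemma exists_sector {p d₁ d₂ : Pt} {ε : ℝ} (hε : 0 < ε)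
    (h : ¬ (det2 d₁ d₂ = 0 ∧ 0 ≤ dot2 d₁ d₂))
    {y : Pt} (hy : y ∈ Metric.ball p ε) (hyK : y ∉ rays p d₁ d₂) :
    ∃ S : Set Pt, IsPreconnected S ∧ y ∈ S ∧ S ⊆ Metric.ball p ε ∧
      (∀ x ∈ S, x ∉ rays p d₁ d₂) ∧ ∀ x ∈ Metric.ball p ε, x ∈ rays p d₁ d₂ → x ∈ closure S := by
  rcases lt_trichotomy (det2 d₁ d₂) 0 with h1 | h1 | h1
  · rw [rays_comm] at hyK ⊢
    exact exists_sector_of_det2_pos hε (by rw [det2_swap]; linarith) hy hyK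
  · exact exists_sector_of_opposite h1 (not_le.1 fun h2 => h ⟨h1, h2⟩) hy hyK
  · exact exists_sector_of_det2_pos hε h1 hy hyK

/-! ### Combinatorics of the edges of a simple polygon -/

namespace SimplePolygon

/-- The `i`-th closed edge, for an arbitrary index read modulo `n`. -/
def edge (P : SimplePolygon) (i : ℕ) : Set Pt := segment ℝ (P.vtx i) (P.vtx (i + 1))

/-- The winding number of the boundary curve around a point. -/
def wind (P : SimplePolygon) (p : Pt) : ℝ := windS P.vtx P.n p

variable (P : SimplePolygon)

lemma n_pos : 0 < P.n := by have := P.three_le; omega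

lemma vtx_mod (i : ℕ) : P.vtx (i % P.n) = P.vtx i :=
  Function.Periodic.map_mod_nat (f := P.vtx) P.periodic i

lemma vtx_congr {i j : ℕ} (h : i % P.n = j % P.n) : P.vtx i = P.vtx j := by
  rw [← P.vtx_mod i, h, P.vtx_mod]

lemma succ_mod_congr {n i j : ℕ} (h : i % n = j % n) : (i + 1) % n = (j + 1) % n := by
  rw [Nat.add_mod, h, ← Nat.add_mod]

lemma succ_mod_cancel {n i j : ℕ} (h : (i + 1) % n = (j + 1) % n) : i % n = j % n :=
  Nat.ModEq.add_right_cancel' (n := n) 1 h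

lemma edge_congr {i j : ℕ} (h : i % P.n = j % P.n) : P.edge i = P.edge j := by
  unfold edge
  rw [P.vtx_congr h, P.vtx_congr (succ_mod_congr h)]

lemma edge_mod (i : ℕ) : P.edge (i % P.n) = P.edge i := P.edge_congr (Nat.mod_mod _ _)

lemma vtx_eq_iff {i j : ℕ} : P.vtx i = P.vtx j ↔ i % P.n = j % P.n := by
  refine ⟨fun h => ?_, P.vtx_congr⟩
  rw [← P.vtx_mod i, ← P.vtx_mod j] at h
  exact P.inj _ (Nat.mod_lt _ P.n_pos) _ (Nat.mod_lt _ P.n_pos) h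

lemma succ_mod_ne (i : ℕ) : (i + 1) % P.n ≠ i % P.n := by
  intro h
  have h1 : (i + 1) ≡ i + 0 [MOD P.n] := h
  have h2 := Nat.ModEq.add_left_cancel' i h1
  have := P.three_le
  rw [Nat.ModEq, Nat.mod_eq_of_lt (by omega), Nat.zero_mod] at h2
  omega

lemma add_two_mod_ne (i : ℕ) : (i + 2) % P.n ≠ i % P.n := by
  intro h
  have h1 : (i + 2) ≡ i + 0 [MOD P.n] := h
  have h2 := Nat.ModEq.add_left_cancel' i h1
  have := P.three_le
  rw [Nat.ModEq, Nat.mod_eq_of_lt (by omega), Nat.zero_mod] at h2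
  omega

lemma vtx_succ_ne (i : ℕ) : P.vtx (i + 1) ≠ P.vtx i := by
  rw [Ne, P.vtx_eq_iff]; exact P.succ_mod_ne i

lemma vtx_n : P.vtx P.n = P.vtx 0 := by simpa using P.periodic 0

lemma vtx_mem_edge (i : ℕ) : P.vtx i ∈ P.edge i := left_mem_segment ℝ _ _

lemma vtx_succ_mem_edge (i : ℕ) : P.vtx (i + 1) ∈ P.edge i := right_mem_segment ℝ _ _

lemma mem_boundary {p : Pt} : p ∈ P.boundary ↔ ∃ i, p ∈ P.edge i := by
  simp only [boundary, Set.mem_iUnion, Finset.mem_range, exists_prop]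
  constructor
  · rintro ⟨i, -, h⟩; exact ⟨i, h⟩
  · rintro ⟨i, h⟩
    exact ⟨i % P.n, Nat.mod_lt _ P.n_pos, by rw [← P.edge_mod] at h; exact h⟩

lemma boundary_eq : P.boundary = bdS P.vtx P.n := by
  ext p
  simp [boundary, bdS]

lemma isClosed_edge (i : ℕ) : IsClosed (P.edge i) := by
  unfold edge; rw [← convexHull_pair]
  exact (Set.Finite.isCompact_convexHull ℝ (by simp)).isClosed

lemma isCompact_edge (i : ℕ) : IsCompact (P.edge i) := by
  unfold edge; rw [← convexHull_pair]
  exact (Set.Finite.isCompact_convexHull ℝ (by simp))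

lemma isCompact_boundary : IsCompact P.boundary := by
  unfold boundary
  exact (Finset.range P.n).isCompact_biUnion fun i _ => P.isCompact_edge i

lemma isClosed_boundary : IsClosed P.boundary := P.isCompact_boundary.isClosed

lemma edge_subset_boundary (i : ℕ) : P.edge i ⊆ P.boundary := fun _ h => P.mem_boundary.2 ⟨i, h⟩

lemma exists_mod_eq_succ (i : ℕ) : ∃ j, i % P.n = (j + 1) % P.n :=
  ⟨i + (P.n - 1), by
    have := P.three_le
    rw [show i + (P.n - 1) + 1 = i + P.n by omega, Nat.add_mod_right]⟩

/-- Two different edges meet at most in a common end point. -/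
lemma simple_mod {i j : ℕ} (hij : i % P.n ≠ j % P.n) {p : Pt} (hi : p ∈ P.edge i)
    (hj : p ∈ P.edge j) :
    (j % P.n = (i + 1) % P.n ∧ p = P.vtx j) ∨ (i % P.n = (j + 1) % P.n ∧ p = P.vtx i) := by
  set S := {i | i < P.n ∧ p ∈ segment ℝ (P.vtx i) (P.vtx (i + 1))} with hS
  have hmem : ∀ k, p ∈ P.edge k → k % P.n ∈ S := fun k hk =>
    ⟨Nat.mod_lt _ P.n_pos, by rw [← P.edge_mod] at hk; exact hk⟩
  have hfin : S.Finite := (Set.finite_lt_nat P.n).subset fun k hk => hk.1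
  have hsub : ({i % P.n, j % P.n} : Set ℕ) ⊆ S := by
    rintro k (rfl | rfl)
    · exact hmem _ hi
    · exact hmem _ hj
  have h2 : ({i % P.n, j % P.n} : Set ℕ).ncard = 2 := Set.ncard_pair hij
  have hle := P.simple p
  have heq : ({i % P.n, j % P.n} : Set ℕ) = S :=
    Set.eq_of_subset_of_ncard_le hsub (by rw [h2]; exact hle) hfin
  obtain ⟨k, hk, hpk⟩ := P.vtx_of_two p (by rw [← hS, ← heq]; exact h2)
  obtain ⟨l, hl⟩ := P.exists_mod_eq_succ k
  have hkS : k % P.n ∈ S := hmem _ (by rw [hpk]; exact P.vtx_mem_edge k)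
  have hlS : l % P.n ∈ S := hmem _ (by rw [hpk, P.vtx_congr hl]; exact P.vtx_succ_mem_edge l)
  have hkl : k % P.n ≠ l % P.n := by rw [hl]; exact P.succ_mod_ne l
  rw [← heq] at hkS hlS
  rcases hkS with h3 | h3
  · right
    refine ⟨?_, by rw [hpk, P.vtx_congr h3]⟩
    rcases hlS with h4 | h4
    · exact absurd (h3.trans h4.symm) hkl
    · rw [← h3, hl]; exact succ_mod_congr h4
  · left
    simp only [Set.mem_singleton_iff] at h3
    refine ⟨?_, by rw [hpk, P.vtx_congr h3]⟩
    rcases hlS with h4 | h4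
    · rw [← h3, hl]; exact succ_mod_congr h4
    · exact absurd (h3.trans h4.symm) hkl

/-- A polygon from its vertices on one period and a pairwise condition on its edges. -/
def ofPairwise (n : ℕ) (hn : 3 ≤ n) (v : ℕ → Pt) (hper : ∀ i, v (i + n) = v i)
    (hinj : ∀ i < n, ∀ j < n, v i = v j → i = j)
    (h : ∀ i < n, ∀ j < n, i ≠ j → ∀ p ∈ segment ℝ (v i) (v (i + 1)),
      p ∈ segment ℝ (v j) (v (j + 1)) → p = v i ∨ p = v j) : SimplePolygon where
  n := n
  three_le := hn
  vtx := v
  periodic := hper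
  inj := hinj
  simple := by
    intro x
    by_contra hc
    rw [not_le, Set.two_lt_ncard_iff ((Set.finite_lt_nat n).subset fun k hk => hk.1)] at hc
    obtain ⟨a, b, c, ha, hb, hc, hab, hac, hbc⟩ := hc
    have h1 := h a ha.1 b hb.1 hab x ha.2 hb.2
    have h2 := h a ha.1 c hc.1 hac x ha.2 hc.2
    have h3 := h b hb.1 c hc.1 hbc x hb.2 hc.2
    have i1 : x = v a → x = v b → False := fun e f => hab (hinj a ha.1 b hb.1 (e ▸ f))
    have i2 : x = v a → x = v c → False := fun e f => hac (hinj a ha.1 c hc.1 (e ▸ f))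
    have i3 : x = v b → x = v c → False := fun e f => hbc (hinj b hb.1 c hc.1 (e ▸ f))
    tauto
  vtx_of_two := by
    intro x hx
    obtain ⟨a, b, hab, hS⟩ := Set.ncard_eq_two.1 hx
    have ha : a ∈ {i | i < n ∧ x ∈ segment ℝ (v i) (v (i + 1))} := by rw [hS]; simp
    have hb : b ∈ {i | i < n ∧ x ∈ segment ℝ (v i) (v (i + 1))} := by rw [hS]; simp
    rcases h a ha.1 b hb.1 hab x ha.2 hb.2 with h1 | h1
    · exact ⟨a, ha.1, h1⟩
    · exact ⟨b, hb.1, h1⟩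

/-- Close to `p` only the edges through `p` are met. -/
lemma exists_ball_edges (p : Pt) :
    ∃ ε > 0, ∀ y ∈ Metric.ball p ε, ∀ j, y ∈ P.edge j → p ∈ P.edge j := by
  have hC : IsClosed (⋃ i ∈ (Finset.range P.n).filter (fun i => p ∉ P.edge i), P.edge i) :=
    ((Finset.range P.n).filter _).finite_toSet.isClosed_biUnion fun i _ => P.isClosed_edge i
  have hp : p ∉ ⋃ i ∈ (Finset.range P.n).filter (fun i => p ∉ P.edge i), P.edge i := by
    simp only [Set.mem_iUnion, Finset.mem_filter, not_exists]
    intro i hi h; exact hi.2 h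
  obtain ⟨ε, hε, hsub⟩ := Metric.isOpen_iff.1 hC.isOpen_compl p hp
  refine ⟨ε, hε, fun y hy j hj => ?_⟩
  by_contra hpj
  refine hsub hy ?_
  simp only [Set.mem_iUnion, Finset.mem_filter, Finset.mem_range]
  exact ⟨j % P.n, ⟨Nat.mod_lt _ P.n_pos, by rwa [P.edge_mod]⟩, by rwa [P.edge_mod]⟩

end SimplePolygon

/-! ### The Jordan curve theorem for simple polygons -/

lemma segment_subset_rays {p a b c : Pt} (hp : p ∈ segment ℝ a b)
    (hpa : p ≠ a) (hpb : p ≠ b) (hc : c ∈ segment ℝ a b) : c ∈ rays p (b - p) (a - p) := by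
  obtain ⟨t, ht0, ht1, rfl⟩ := mem_segment_iff_param.1 hp
  obtain ⟨s, hs0, hs1, rfl⟩ := mem_segment_iff_param.1 hc
  have ht0' : t ≠ 0 := by rintro rfl; simp at hpa
  have ht1' : 1 - t ≠ 0 := by
    intro h
    have : t = 1 := by linarith
    subst this; simp at hpb
  rcases le_total t s with h | h
  · refine ⟨(s - t) / (1 - t), div_nonneg (by linarith) (by linarith), Or.inl ?_⟩
    apply Pt.ext' <;>
    · simp only [PiLp.add_apply, PiLp.smul_apply, PiLp.sub_apply, smul_eq_mul]
      field_simp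
      ring
  · refine ⟨(t - s) / t, div_nonneg (by linarith) ht0, Or.inr ?_⟩
    apply Pt.ext' <;>
    · simp only [PiLp.add_apply, PiLp.smul_apply, PiLp.sub_apply, smul_eq_mul]
      field_simp
      ring

lemma mem_segment_of_ray {p a : Pt} {t ε : ℝ} (ht : 0 ≤ t) (hε : ε ≤ dist a p)
    (h : p + t • (a - p) ∈ Metric.ball p ε) : p + t • (a - p) ∈ segment ℝ p a := by
  refine mem_segment_iff_param.2 ⟨t, ht, ?_, rfl⟩
  rw [Metric.mem_ball, dist_eq_norm, add_sub_cancel_left, norm_smul, Real.norm_eq_abs,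
    abs_of_nonneg ht] at h
  rw [dist_eq_norm] at hε
  by_contra hc
  push Not at hc
  nlinarith [norm_nonneg (a - p)]

lemma segment_subset_rays_left {p a b c : Pt} (hc : c ∈ segment ℝ p a) : c ∈ rays p (a - p) b := by
  obtain ⟨s, hs0, hs1, rfl⟩ := mem_segment_iff_param.1 hc
  exact ⟨s, hs0, Or.inl rfl⟩

namespace SimplePolygon

variable (P : SimplePolygon)

/-- Near each of its points the boundary is a union of two different rays. -/
lemma exists_local_rays {p : Pt} (hp : p ∈ P.boundary) :
    ∃ d₁ d₂ : Pt, ∃ ε > 0, ¬ (det2 d₁ d₂ = 0 ∧ 0 ≤ dot2 d₁ d₂) ∧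
      ∀ y ∈ Metric.ball p ε, y ∈ P.boundary ↔ y ∈ rays p d₁ d₂ := by
  obtain ⟨ε, hε, hloc⟩ := P.exists_ball_edges p
  obtain ⟨i, hi⟩ := P.mem_boundary.1 hp
  have hcase : (∃ k, p = P.vtx (k + 1)) ∨ (p ≠ P.vtx i ∧ p ≠ P.vtx (i + 1)) := by
    by_cases h1 : p = P.vtx (i + 1)
    · exact Or.inl ⟨i, h1⟩
    by_cases h2 : p = P.vtx i
    · obtain ⟨l, hl⟩ := P.exists_mod_eq_succ i
      exact Or.inl ⟨l, by rw [h2, P.vtx_congr hl]⟩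
    exact Or.inr ⟨h2, h1⟩
  rcases hcase with ⟨k, rfl⟩ | ⟨h1, h2⟩
  · have hn1 : P.vtx (k + 2) ≠ P.vtx (k + 1) := P.vtx_succ_ne (k + 1)
    have hn2 : P.vtx k ≠ P.vtx (k + 1) := (P.vtx_succ_ne k).symm
    refine ⟨P.vtx (k + 2) - P.vtx (k + 1), P.vtx k - P.vtx (k + 1),
      min ε (min (dist (P.vtx (k + 2)) (P.vtx (k + 1))) (dist (P.vtx k) (P.vtx (k + 1)))),
      lt_min hε (lt_min (dist_pos.2 hn1) (dist_pos.2 hn2)), ?_, ?_⟩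
    · rintro ⟨hdet, hdot⟩
      set p := P.vtx (k + 1)
      set a := P.vtx (k + 2) with ha
      set b := P.vtx k with hb
      have haE : a ∈ P.edge (k + 1) := P.vtx_succ_mem_edge (k + 1)
      have hbE : b ∈ P.edge k := P.vtx_mem_edge k
      have hne : (k + 1) % P.n ≠ k % P.n := P.succ_mod_ne k
      have key : b ∈ segment ℝ p a ∨ a ∈ segment ℝ p b := by
        have haa := dot2_self_pos (sub_ne_zero.2 hn1)
        have hbb := dot2_self_pos (sub_ne_zero.2 hn2)
        rcases le_total (dot2 (b - p) (b - p)) (dot2 (a - p) (b - p)) with h | h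
        · left
          apply mem_segment_of_det2_dot2
          · simp only [det2, PiLp.sub_apply] at *; linarith
          · simp only [dot2, PiLp.sub_apply] at *; linarith
        · right
          apply mem_segment_of_det2_dot2
          · simp only [det2, PiLp.sub_apply] at *; linarith
          · by_contra hc
            push Not at hc
            simp only [det2, dot2, PiLp.sub_apply] at *
            nlinarith [mul_pos haa hbb]
      rcases key with h | h
      · rcases P.simple_mod hne (show b ∈ P.edge (k + 1) from h) hbE with ⟨h1, -⟩ | ⟨-, h1⟩
        · exact P.add_two_mod_ne k h1.symm
        · exact hn2 h1
      · have h' : a ∈ P.edge k := by unfold edge; rw [segment_symm]; exact h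
        rcases P.simple_mod hne haE h' with ⟨h1, -⟩ | ⟨-, h1⟩
        · exact P.add_two_mod_ne k h1.symm
        · exact hn1 h1
    · intro y hy
      have hy1 := Metric.ball_subset_ball (min_le_left _ _) hy
      constructor
      · intro hyB
        obtain ⟨j, hj⟩ := P.mem_boundary.1 hyB
        have hpj := hloc y hy1 j hj
        have hj2 : j % P.n = k % P.n ∨ j % P.n = (k + 1) % P.n := by
          by_contra hc
          push Not at hc
          have e1 := P.simple_mod hc.1 hpj (P.vtx_succ_mem_edge k)
          have e2 := P.simple_mod hc.2 hpj (P.vtx_mem_edge (k + 1))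
          rcases e1 with ⟨-, e1⟩ | ⟨e1, -⟩
          · exact P.vtx_succ_ne k e1
          · exact hc.2 e1
        rcases hj2 with h | h
        · rw [P.edge_congr h] at hj
          rw [rays_comm]
          unfold edge at hj
          rw [segment_symm] at hj
          exact segment_subset_rays_left hj
        · rw [P.edge_congr h] at hj
          exact segment_subset_rays_left hj
      · rintro ⟨t, ht, rfl | rfl⟩
        · apply P.edge_subset_boundary (k + 1)
          exact mem_segment_of_ray ht ((min_le_right _ _).trans (min_le_left _ _)) hy
        · apply P.edge_subset_boundary k
          unfold edge
          rw [segment_symm]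
          exact mem_segment_of_ray ht ((min_le_right _ _).trans (min_le_right _ _)) hy
  · refine ⟨P.vtx (i + 1) - p, P.vtx i - p,
      min ε (min (dist (P.vtx (i + 1)) p) (dist (P.vtx i) p)),
      lt_min hε (lt_min (dist_pos.2 h2.symm) (dist_pos.2 h1.symm)), ?_, ?_⟩
    · rintro ⟨-, hdot⟩
      obtain ⟨t, ht0, ht1, rfl⟩ := mem_segment_iff_param.1 hi
      have ht0' : t ≠ 0 := by rintro rfl; simp at h1
      have ht1' : t ≠ 1 := by rintro rfl; simp at h2
      have e : dot2 (P.vtx (i + 1) - (P.vtx i + t • (P.vtx (i + 1) - P.vtx i)))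
          (P.vtx i - (P.vtx i + t • (P.vtx (i + 1) - P.vtx i))) =
          - (t * (1 - t) * dot2 (P.vtx (i + 1) - P.vtx i) (P.vtx (i + 1) - P.vtx i)) := by
        simp [dot2]; ring
      rw [e] at hdot
      have h3 := dot2_self_pos (sub_ne_zero.2 (P.vtx_succ_ne i))
      have h4 : 0 < t := lt_of_le_of_ne ht0 ht0'.symm
      have h5 : 0 < 1 - t := sub_pos.2 (lt_of_le_of_ne ht1 ht1')
      have := mul_pos (mul_pos h4 h5) h3
      linarith
    · intro y hy
      have hy1 := Metric.ball_subset_ball (min_le_left _ _) hy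
      constructor
      · intro hyB
        obtain ⟨j, hj⟩ := P.mem_boundary.1 hyB
        have hpj := hloc y hy1 j hj
        have hji : j % P.n = i % P.n := by
          by_contra hc
          rcases P.simple_mod hc hpj hi with ⟨-, e1⟩ | ⟨e1, e2⟩
          · exact h1 e1
          · exact h2 (e2.trans (P.vtx_congr e1))
        rw [P.edge_congr hji] at hj
        exact segment_subset_rays hi h1 h2 hj
      · rintro ⟨t, ht, rfl | rfl⟩
        · apply P.edge_subset_boundary i
          exact (convex_segment _ _).segment_subset hi (P.vtx_succ_mem_edge i)
            (mem_segment_of_ray ht ((min_le_right _ _).trans (min_le_left _ _)) hy)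
        · apply P.edge_subset_boundary i
          exact (convex_segment _ _).segment_subset hi (P.vtx_mem_edge i)
            (mem_segment_of_ray ht ((min_le_right _ _).trans (min_le_right _ _)) hy)

lemma boundary_nonempty : P.boundary.Nonempty :=
  ⟨_, P.edge_subset_boundary 0 (P.vtx_mem_edge 0)⟩

lemma isPreconnected_boundary : IsPreconnected P.boundary := by
  have : P.boundary = ⋃ i, P.edge i := by
    ext p; simp [P.mem_boundary]
  rw [this]
  exact IsPreconnected.iUnion_of_chain (fun i => (convex_segment _ _).isPreconnected)
    fun i => ⟨P.vtx (i + 1), P.vtx_succ_mem_edge i, P.vtx_mem_edge (i + 1)⟩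

/-- Every component of the complement of the boundary is adherent to the whole boundary. -/
lemma boundary_subset_closure {y : Pt} (hy : y ∉ P.boundary) :
    P.boundary ⊆ closure (connectedComponentIn P.boundaryᶜ y) := by
  set C := connectedComponentIn P.boundaryᶜ y with hC
  have hyC : y ∈ C := mem_connectedComponentIn hy
  have hCsub : C ⊆ P.boundaryᶜ := connectedComponentIn_subset _ _
  have hCpre : IsPreconnected C := isPreconnected_connectedComponentIn
  have hmeet : (P.boundary ∩ closure C).Nonempty := by
    by_contra hne
    rw [Set.not_nonempty_iff_eq_empty] at hne
    have hclosed : closure C ⊆ C := by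
      apply hCpre.closure.subset_connectedComponentIn (subset_closure hyC)
      intro x hx hxb
      exact (Set.mem_empty_iff_false x).1 (hne ▸ ⟨hxb, hx⟩)
    have hclopen : IsClopen C :=
      ⟨isClosed_of_closure_subset hclosed, P.isClosed_boundary.isOpen_compl.connectedComponentIn⟩
    rcases isClopen_iff.1 hclopen with h | h
    · rw [h] at hyC; exact hyC
    · obtain ⟨x, hx⟩ := P.boundary_nonempty
      exact hCsub (by rw [h]; trivial : x ∈ C) hx
  have hlocal : ∀ p ∈ P.boundary, p ∈ closure C →
      ∃ ε > 0, ∀ x ∈ Metric.ball p ε, x ∈ P.boundary → x ∈ closure C := by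
    intro p hp hpC
    obtain ⟨d₁, d₂, ε, hε, hd, hloc⟩ := P.exists_local_rays hp
    obtain ⟨z, hzC, hz⟩ := Metric.mem_closure_iff.1 hpC ε hε
    have hzb : z ∈ Metric.ball p ε := by rw [Metric.mem_ball, dist_comm]; exact hz
    have hzr : z ∉ rays p d₁ d₂ := fun h => hCsub hzC ((hloc z hzb).2 h)
    obtain ⟨S, hS, hzS, hSb, hSr, hScl⟩ := exists_sector hε hd hzb hzr
    have hSC : S ⊆ C := by
      rw [hC, connectedComponentIn_eq hzC]
      exact hS.subset_connectedComponentIn hzS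
        fun x hx hxb => hSr x hx ((hloc x (hSb hx)).1 hxb)
    exact ⟨ε, hε, fun x hx hxb => closure_mono hSC (hScl x hx ((hloc x hx).1 hxb))⟩
  choose! e he hel using hlocal
  set u := ⋃ p ∈ P.boundary ∩ closure C, Metric.ball p (e p) with hu
  have huo : IsOpen u := isOpen_biUnion fun p _ => Metric.isOpen_ball
  have hpre := isPreconnected_iff_subset_of_disjoint.1 P.isPreconnected_boundary u (closure C)ᶜ huo
    isClosed_closure.isOpen_compl
  have hcov : P.boundary ⊆ u ∪ (closure C)ᶜ := by
    intro x hx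
    by_cases h : x ∈ closure C
    · left
      simp only [hu, Set.mem_iUnion]
      exact ⟨x, ⟨hx, h⟩, Metric.mem_ball_self (he x hx h)⟩
    · exact Or.inr h
  have hul : ∀ x ∈ P.boundary, x ∈ u → x ∈ closure C := by
    intro x hx hxu
    simp only [hu, Set.mem_iUnion] at hxu
    obtain ⟨p, hp, hxp⟩ := hxu
    exact hel p hp.1 hp.2 x hxp hx
  rcases hpre hcov (by
    ext x; simp only [Set.mem_inter_iff, Set.mem_compl_iff, Set.mem_empty_iff_false, iff_false]
    rintro ⟨hx, hxu, hxc⟩; exact hxc (hul x hx hxu)) with h | h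
  · exact fun x hx => hul x hx (h hx)
  · obtain ⟨x, hx, hxc⟩ := hmeet
    exact absurd hxc (h hx)

lemma wind_eq_of_isPreconnected {s : Set Pt} (hs : IsPreconnected s)
    (hd : ∀ p ∈ s, p ∉ P.boundary) {p q : Pt} (hp : p ∈ s) (hq : q ∈ s) :
    P.wind p = P.wind q :=
  windS_eq_of_isPreconnected P.n_pos P.vtx_n hs (by rwa [← P.boundary_eq]) hp hq

lemma wind_int {p : Pt} (hp : p ∉ P.boundary) : ∃ k : ℤ, P.wind p = k :=
  windS_int P.vtx_n (ne_of_notMem_bdS P.n_pos P.vtx_n (by rwa [← P.boundary_eq]))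

end SimplePolygon

lemma exists_ball_mem_segment {p a b : Pt} (hp : p ∈ segment ℝ a b) (hpa : p ≠ a) (hpb : p ≠ b) :
    ∃ δ > 0, ∀ y ∈ Metric.ball p δ, det2 (b - a) (y - p) = 0 → y ∈ segment ℝ a b := by
  have hdot : dot2 (a - p) (b - p) < 0 := by
    obtain ⟨t, ht0, ht1, rfl⟩ := mem_segment_iff_param.1 hp
    have ht0' : 0 < t := lt_of_le_of_ne ht0 (by rintro rfl; simp at hpa)
    have ht1' : t < 1 := lt_of_le_of_ne ht1 (by rintro rfl; simp at hpb)
    have hab : b - a ≠ 0 := by intro h; simp [h] at hpa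
    have : dot2 (a - (a + t • (b - a))) (b - (a + t • (b - a))) =
        - (t * (1 - t) * dot2 (b - a) (b - a)) := by
      simp [dot2]; ring
    rw [this]
    have := mul_pos (mul_pos ht0' (sub_pos.2 ht1')) (dot2_self_pos hab)
    linarith
  have hc : Continuous fun y => dot2 (a - y) (b - y) := by unfold dot2; fun_prop
  obtain ⟨δ, hδ, h⟩ := Metric.isOpen_iff.1 (isOpen_lt hc continuous_const) p hdot
  refine ⟨δ, hδ, fun y hy h0 => mem_segment_of_det2_dot2 ?_ (h hy).le⟩
  have h2 := det2_eq_zero_of_mem_segment hp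
  have : det2 (a - y) (b - y) = det2 (b - a) (y - p) + det2 (b - a) (p - a) := by
    simp [det2]; ring
  rw [this, h0, h2, add_zero]

lemma tendsto_ang_left {p a b w : Pt} (hp : p ∈ segment ℝ a b) (hpa : p ≠ a) (hpb : p ≠ b)
    (hw : 0 < det2 (b - a) w) :
    Filter.Tendsto (fun s : ℝ => ang (p + s • w) a b) (nhdsWithin 0 (Set.Ioi 0))
      (nhds Real.pi) := by
  obtain ⟨t, ht0, ht1, rfl⟩ := mem_segment_iff_param.1 hp
  set p := a + t • (b - a) with hpdef
  have ht0' : 0 < t := lt_of_le_of_ne ht0 (by rintro rfl; simp [hpdef] at hpa)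
  have ht1' : t < 1 := lt_of_le_of_ne ht1 (by rintro rfl; simp [hpdef] at hpb)
  have hab : b - a ≠ 0 := by intro h; simp [h, det2] at hw
  have hre : (angC p a b).re < 0 := by
    rw [angC_re]
    have : dot2 (a - p) (b - p) = - (t * (1 - t) * dot2 (b - a) (b - a)) := by
      simp [hpdef, dot2]; ring
    rw [this]
    have := mul_pos (mul_pos ht0' (sub_pos.2 ht1')) (dot2_self_pos hab)
    linarith
  have him : (angC p a b).im = 0 := by
    rw [angC_im]; simp [hpdef, det2]; ring
  have h1 := Complex.continuousWithinAt_arg_of_re_neg_of_im_zero hre him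
  have h2 : (angC p a b).arg = Real.pi := Complex.arg_eq_pi_iff.2 ⟨hre, him⟩
  have h3 : Filter.Tendsto Complex.arg (nhdsWithin (angC p a b) {z : ℂ | 0 ≤ z.im})
      (nhds Real.pi) := by
    have := h1.tendsto; rwa [h2] at this
  refine h3.comp (f := fun s : ℝ => angC (p + s • w) a b) (tendsto_nhdsWithin_iff.2 ⟨?_, ?_⟩)
  · have hc : Continuous fun s : ℝ => angC (p + s • w) a b :=
      (continuous_angC a b).comp (by fun_prop)
    have := hc.tendsto 0
    simp only [zero_smul, add_zero] at this
    exact this.mono_left nhdsWithin_le_nhds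
  · filter_upwards [self_mem_nhdsWithin] with s hs
    have : det2 (a - (p + s • w)) (b - (p + s • w)) = s * det2 (b - a) w := by
      simp [hpdef, det2]; ring
    change 0 ≤ (angC (p + s • w) a b).im
    rw [angC_im, this]
    exact (mul_pos hs hw).le

lemma tendsto_ang_right {p a b w : Pt} (hp : p ∈ segment ℝ a b) (hpa : p ≠ a) (hpb : p ≠ b)
    (hw : det2 (b - a) w < 0) :
    Filter.Tendsto (fun s : ℝ => ang (p + s • w) a b) (nhdsWithin 0 (Set.Ioi 0))
      (nhds (-Real.pi)) := by
  rw [segment_symm] at hp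
  have h := (tendsto_ang_left hp hpb hpa (w := w) (by
    rw [show a - b = (-1 : ℝ) • (b - a) by simp, det2_smul_left]; linarith)).neg
  refine h.congr' ?_
  filter_upwards [self_mem_nhdsWithin] with s hs
  rw [ang_swap (a := a) (b := b), neg_neg]
  intro hmem
  have h1 := det2_eq_zero_of_mem_segment hmem
  rw [segment_symm] at hp
  have h2 := det2_eq_zero_of_mem_segment hp
  have h3 : det2 (b - a) (p + s • w - a) = det2 (b - a) (p - a) + s * det2 (b - a) w := by
    simp [det2]; ring
  rw [h3, h2, zero_add] at h1
  have h4 : s ≠ 0 := ne_of_gt hs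
  rcases mul_eq_zero.1 h1 with h5 | h5
  · exact h4 h5
  · exact hw.ne h5

namespace SimplePolygon

variable (P : SimplePolygon)

/-- Crossing an edge from right to left increases the winding number by one. -/
lemma exists_jump {p : Pt} {i : ℕ} (hp : p ∈ P.edge i) (h1 : p ≠ P.vtx i)
    (h2 : p ≠ P.vtx (i + 1)) :
    ∃ ε > 0, ∃ k : ℤ, (∀ y ∈ Metric.ball p ε, y ∈ P.boundary ↔
        det2 (P.vtx (i + 1) - P.vtx i) (y - p) = 0) ∧
      (∀ y ∈ Metric.ball p ε, 0 < det2 (P.vtx (i + 1) - P.vtx i) (y - p) → P.wind y = k + 1) ∧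
      (∀ y ∈ Metric.ball p ε, det2 (P.vtx (i + 1) - P.vtx i) (y - p) < 0 → P.wind y = k) := by
  wlog hin : i < P.n generalizing i
  · have e1 : P.vtx (i % P.n) = P.vtx i := P.vtx_mod i
    have e2 : P.vtx (i % P.n + 1) = P.vtx (i + 1) := P.vtx_congr (by simp)
    have := this (i := i % P.n) (by rwa [P.edge_mod]) (by rwa [e1]) (by rwa [e2])
      (Nat.mod_lt _ P.n_pos)
    rwa [e1, e2] at this
  obtain ⟨ε, hε, hloc⟩ := P.exists_ball_edges p
  set d := P.vtx (i + 1) - P.vtx i with hd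
  have hd0 : d ≠ 0 := sub_ne_zero.2 (P.vtx_succ_ne i)
  have honly : ∀ j, p ∈ P.edge j → j % P.n = i % P.n := by
    intro j hpj
    by_contra hc
    rcases P.simple_mod hc hpj hp with ⟨-, e1⟩ | ⟨e1, e2⟩
    · exact h1 e1
    · exact h2 (e2.trans (P.vtx_congr e1))
  have hb : ∀ y ∈ Metric.ball p ε, y ∈ P.boundary → det2 d (y - p) = 0 := by
    intro y hy hyb
    obtain ⟨j, hj⟩ := P.mem_boundary.1 hyb
    rw [P.edge_congr (honly j (hloc y hy j hj))] at hj
    have a1 := det2_eq_zero_of_mem_segment hj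
    have a2 := det2_eq_zero_of_mem_segment hp
    rw [show y - p = (y - P.vtx i) - (p - P.vtx i) by abel, det2_sub_right, hd, a1, a2, sub_zero]
  set F : Pt → ℝ := fun y => ∑ j ∈ (Finset.range P.n).erase i, ang y (P.vtx j) (P.vtx (j + 1))
  have hF : ContinuousAt F p := by
    refine tendsto_finsetSum _ fun j hj => continuousAt_ang fun hmem => ?_
    rw [Finset.mem_erase, Finset.mem_range] at hj
    have := honly j hmem
    rw [Nat.mod_eq_of_lt hj.2, Nat.mod_eq_of_lt hin] at this
    exact hj.1 this
  have hW : ∀ y, P.wind y = (F y + ang y (P.vtx i) (P.vtx (i + 1))) / (2 * Real.pi) := by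
    intro y
    unfold wind windS
    rw [← Finset.sum_erase_add _ _ (Finset.mem_range.2 hin)]
  have hline : ∀ w : Pt, Filter.Tendsto (fun s : ℝ => p + s • w) (nhdsWithin 0 (Set.Ioi 0))
      (nhds p) := by
    intro w
    have hc : Continuous fun s : ℝ => p + s • w := by fun_prop
    have := hc.tendsto 0
    simp only [zero_smul, add_zero] at this
    exact this.mono_left nhdsWithin_le_nhds
  have hcb : Convex ℝ (Metric.ball p ε) := convex_ball p ε
  have hlim : ∀ (w : Pt) (θ : ℝ) (H : Set Pt), Convex ℝ H →
      (∀ y ∈ H, y ∈ Metric.ball p ε ∧ det2 d (y - p) ≠ 0) →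
      (∀ᶠ s in nhdsWithin (0 : ℝ) (Set.Ioi 0), p + s • w ∈ H) →
      Filter.Tendsto (fun s : ℝ => ang (p + s • w) (P.vtx i) (P.vtx (i + 1)))
        (nhdsWithin 0 (Set.Ioi 0)) (nhds θ) →
      ∀ y ∈ H, P.wind y = (F p + θ) / (2 * Real.pi) := by
    intro w θ H hH hHb hev hθ y hy
    have ht : Filter.Tendsto (fun s : ℝ => P.wind (p + s • w)) (nhdsWithin 0 (Set.Ioi 0))
        (nhds ((F p + θ) / (2 * Real.pi))) := by
      simp only [hW]
      exact ((hF.tendsto.comp (hline w)).add hθ).div_const _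
    have ht2 : Filter.Tendsto (fun s : ℝ => P.wind (p + s • w)) (nhdsWithin 0 (Set.Ioi 0))
        (nhds (P.wind y)) := by
      refine tendsto_const_nhds.congr' ?_
      filter_upwards [hev] with s hs
      exact P.wind_eq_of_isPreconnected hH.isPreconnected
        (fun x hx hxb => (hHb x hx).2 (hb x (hHb x hx).1 hxb)) hy hs
    exact tendsto_nhds_unique ht2 ht
  have hdd := dot2_self_pos hd0
  have hL := hlim (perp d) Real.pi (Metric.ball p ε ∩ {x | 0 < det2 d (x - p)})
    (hcb.inter (convex_det2_pos _ _)) (fun y hy => ⟨hy.1, ne_of_gt hy.2⟩) (by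
      filter_upwards [(hline (perp d)) (Metric.ball_mem_nhds p hε), self_mem_nhdsWithin] with s hs h0
      refine ⟨hs, ?_⟩
      rw [Set.mem_ofPred_eq, add_sub_cancel_left, det2_smul_right, det2_perp]
      exact mul_pos h0 hdd) (tendsto_ang_left hp h1 h2 (by rw [← hd, det2_perp]; exact hdd))
  have hR := hlim (-perp d) (-Real.pi) (Metric.ball p ε ∩ {x | det2 d (x - p) < 0})
    (hcb.inter (convex_det2_neg _ _)) (fun y hy => ⟨hy.1, ne_of_lt hy.2⟩) (by
      filter_upwards [(hline (-perp d)) (Metric.ball_mem_nhds p hε), self_mem_nhdsWithin]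
        with s hs h0
      refine ⟨hs, ?_⟩
      rw [Set.mem_ofPred_eq, add_sub_cancel_left, det2_smul_right,
        show -perp d = (-1 : ℝ) • perp d by simp, det2_smul_right, det2_perp]
      nlinarith [mul_pos (show 0 < s from h0) hdd]) (tendsto_ang_right hp h1 h2 (by
        rw [← hd, show -perp d = (-1 : ℝ) • perp d by simp, det2_smul_right, det2_perp]; linarith))
  obtain ⟨s, hs, hs0⟩ : ∃ s : ℝ, p + s • (-perp d) ∈ Metric.ball p ε ∧ 0 < s := by
    have h2 : ∀ᶠ s in nhdsWithin (0 : ℝ) (Set.Ioi 0), p + s • (-perp d) ∈ Metric.ball p ε :=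
      (hline (-perp d)) (Metric.ball_mem_nhds p hε)
    exact (h2.and self_mem_nhdsWithin).exists
  have hsneg : det2 d (p + s • (-perp d) - p) < 0 := by
    rw [add_sub_cancel_left, det2_smul_right,
        show -perp d = (-1 : ℝ) • perp d by simp, det2_smul_right, det2_perp]
    nlinarith [mul_pos hs0 hdd]
  obtain ⟨k, hk⟩ := P.wind_int (p := p + s • (-perp d)) fun h => hsneg.ne (hb _ hs h)
  have hkR := hR _ ⟨hs, hsneg⟩
  rw [hk] at hkR
  obtain ⟨δ, hδ, hδm⟩ := exists_ball_mem_segment hp h1 h2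
  refine ⟨min ε δ, lt_min hε hδ, k, fun y hy => ⟨hb y (Metric.ball_subset_ball (min_le_left _ _) hy),
    fun h => P.edge_subset_boundary i (hδm y (Metric.ball_subset_ball (min_le_right _ _) hy) h)⟩,
    fun y hy h => ?_, fun y hy h => ?_⟩ <;>
  replace hy := Metric.ball_subset_ball (min_le_left _ _) hy
  · rw [hL y ⟨hy, h⟩, hkR]
    have := Real.pi_pos
    field_simp
    ring
  · rw [hR y ⟨hy, h⟩, hkR]

lemma exists_radius : ∃ r : ℝ, 0 < r ∧ P.boundary ⊆ Metric.closedBall 0 r := by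
  obtain ⟨r, hr⟩ := P.isCompact_boundary.isBounded.subset_closedBall 0
  exact ⟨max r 1, lt_max_of_lt_right one_pos,
    hr.trans (Metric.closedBall_subset_closedBall (le_max_left _ _))⟩

lemma wind_eq_zero_of_convex {s : Set Pt} (hs : Convex ℝ s) (hc : IsClosed s)
    (hsub : P.boundary ⊆ s) {y : Pt} (hy : y ∉ s) : P.wind y = 0 := by
  obtain ⟨d, -, hd⟩ := exists_dot2_of_notMem hs hc hy
  exact windS_eq_zero_of_dot2_pos P.vtx_n fun i _ =>
    hd _ (hsub (P.edge_subset_boundary i (P.vtx_mem_edge i)))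

lemma midpoint_vtx (i : ℕ) : midpoint ℝ (P.vtx i) (P.vtx (i + 1)) ∈ P.edge i ∧
    midpoint ℝ (P.vtx i) (P.vtx (i + 1)) ≠ P.vtx i ∧
    midpoint ℝ (P.vtx i) (P.vtx (i + 1)) ≠ P.vtx (i + 1) := by
  refine ⟨midpoint_mem_segment _ _, ?_, ?_⟩
  · rw [Ne, midpoint_eq_left_iff]; exact (P.vtx_succ_ne i).symm
  · rw [Ne, midpoint_eq_right_iff]; exact (P.vtx_succ_ne i).symm

/-- The winding number takes at most two consecutive values and separates components. -/
lemma exists_wind_values : ∃ k : ℤ, (∀ y ∉ P.boundary, P.wind y = k ∨ P.wind y = k + 1) ∧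
    ∀ y ∉ P.boundary, ∀ z ∉ P.boundary, P.wind y = P.wind z →
      connectedComponentIn P.boundaryᶜ y = connectedComponentIn P.boundaryᶜ z := by
  obtain ⟨hm, h1, h2⟩ := P.midpoint_vtx 0
  set p := midpoint ℝ (P.vtx 0) (P.vtx (0 + 1)) with hp
  obtain ⟨ε, hε, k, hb, hL, hR⟩ := P.exists_jump hm h1 h2
  set d := P.vtx (0 + 1) - P.vtx 0
  have key : ∀ y ∉ P.boundary, ∃ z ∈ connectedComponentIn P.boundaryᶜ y,
      z ∈ Metric.ball p ε ∧ z ∉ P.boundary ∧ P.wind y = P.wind z := by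
    intro y hy
    have := P.boundary_subset_closure hy (P.edge_subset_boundary 0 hm)
    obtain ⟨z, hz, hzd⟩ := Metric.mem_closure_iff.1 this ε hε
    refine ⟨z, hz, by rwa [Metric.mem_ball, dist_comm], connectedComponentIn_subset _ _ hz, ?_⟩
    exact P.wind_eq_of_isPreconnected isPreconnected_connectedComponentIn
      (fun x hx => connectedComponentIn_subset _ _ hx) (mem_connectedComponentIn hy) hz
  have hcb : Convex ℝ (Metric.ball p ε) := convex_ball p ε
  have same : ∀ H : Set Pt, Convex ℝ H →
      (∀ y ∈ H, y ∈ Metric.ball p ε ∧ det2 d (y - p) ≠ 0) →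
      ∀ z ∈ H, ∀ z' ∈ H,
        connectedComponentIn P.boundaryᶜ z = connectedComponentIn P.boundaryᶜ z' := by
    intro H hH hHb z hz z' hz'
    refine connectedComponentIn_eq (hH.isPreconnected.subset_connectedComponentIn hz ?_ hz')
    exact fun x hx hxb => (hHb x hx).2 ((hb x (hHb x hx).1).1 hxb)
  refine ⟨k, fun y hy => ?_, fun y hy y' hy' hyy => ?_⟩
  · obtain ⟨z, -, hz, hzb, hw⟩ := key y hy
    rw [hw]
    rcases lt_or_gt_of_ne (fun h => hzb ((hb z hz).2 h)) with h | h
    · exact Or.inl (hR z hz h)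
    · exact Or.inr (hL z hz h)
  · obtain ⟨z, hzC, hz, hzb, hw⟩ := key y hy
    obtain ⟨z', hzC', hz', hzb', hw'⟩ := key y' hy'
    rw [connectedComponentIn_eq hzC, connectedComponentIn_eq hzC']
    rcases lt_or_gt_of_ne (fun h => hzb ((hb z hz).2 h)) with h | h <;>
    rcases lt_or_gt_of_ne (fun h => hzb' ((hb z' hz').2 h)) with h' | h'
    · exact same (Metric.ball p ε ∩ {x | det2 d (x - p) < 0}) (hcb.inter (convex_det2_neg _ _))
        (fun y hy => ⟨hy.1, ne_of_lt hy.2⟩) z ⟨hz, h⟩ z' ⟨hz', h'⟩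
    · have a1 := hR z hz h
      have a2 := hL z' hz' h'
      rw [← hw, hyy, hw', a2] at a1
      linarith
    · have a1 := hL z hz h
      have a2 := hR z' hz' h'
      rw [← hw, hyy, hw', a2] at a1
      linarith
    · exact same (Metric.ball p ε ∩ {x | 0 < det2 d (x - p)}) (hcb.inter (convex_det2_pos _ _))
        (fun y hy => ⟨hy.1, ne_of_gt hy.2⟩) z ⟨hz, h⟩ z' ⟨hz', h'⟩

lemma exists_far : ∃ z ∉ P.boundary, P.wind z = 0 ∧
    ¬ Bornology.IsBounded (connectedComponentIn P.boundaryᶜ z) := by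
  obtain ⟨r, hr, hsub⟩ := P.exists_radius
  have hout : ∀ x : Pt, r < x 0 → x ∉ Metric.closedBall (0 : Pt) r := by
    intro x hx hxr
    rw [mem_closedBall_zero_iff] at hxr
    have := PiLp.norm_apply_le x 0
    rw [Real.norm_eq_abs] at this
    linarith [le_abs_self (x 0)]
  have hconv : Convex ℝ {x : Pt | r < x 0} := by
    have := convex_halfSpace_gt (𝕜 := ℝ) (f := fun x : Pt => x 0)
      ⟨fun _ _ => rfl, fun _ _ => rfl⟩ r
    exact this
  have hz : (!₂[r + 1, 0] : Pt) ∈ {x : Pt | r < x 0} := by simp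
  refine ⟨!₂[r + 1, 0], fun h => hout _ hz (hsub h), ?_, ?_⟩
  · exact P.wind_eq_zero_of_convex (convex_closedBall 0 r) Metric.isClosed_closedBall hsub
      (hout _ hz)
  · intro hbd
    have hs : {x : Pt | r < x 0} ⊆ connectedComponentIn P.boundaryᶜ !₂[r + 1, 0] :=
      hconv.isPreconnected.subset_connectedComponentIn hz fun x hx hxb => hout x hx (hsub hxb)
    obtain ⟨M, hM⟩ := (hbd.subset hs).exists_norm_le
    have h1 := hM !₂[r + 1 + |M|, 0] (by
      change r < r + 1 + |M|
      have := abs_nonneg M; linarith)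
    have h2 := PiLp.norm_apply_le (!₂[r + 1 + |M|, 0] : Pt) 0
    rw [Real.norm_eq_abs] at h2
    have h3 : abs (r + 1 + |M|) ≤ M := h2.trans h1
    have h4 := le_abs_self (r + 1 + |M|)
    have := le_abs_self M
    linarith

/-- A point off the boundary is interior iff the boundary winds around it. -/
lemma mem_interior_iff {y : Pt} (hy : y ∉ P.boundary) : y ∈ P.interior ↔ P.wind y ≠ 0 := by
  obtain ⟨z, hz, hz0, hzu⟩ := P.exists_far
  obtain ⟨k, -, hk⟩ := P.exists_wind_values
  constructor
  · rintro ⟨-, hbd⟩ h0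
    rw [hk y hy z hz (h0.trans hz0.symm)] at hbd
    exact hzu hbd
  · intro h0
    refine ⟨hy, ?_⟩
    obtain ⟨r, hr, hsub⟩ := P.exists_radius
    refine (Metric.isBounded_closedBall (x := (0 : Pt)) (r := r)).subset fun x hx => ?_
    by_contra hxr
    apply h0
    rw [← P.wind_eq_zero_of_convex (convex_closedBall 0 r) Metric.isClosed_closedBall hsub hxr]
    exact P.wind_eq_of_isPreconnected isPreconnected_connectedComponentIn
      (fun x hx => connectedComponentIn_subset _ _ hx) (mem_connectedComponentIn hy) hx

lemma notMem_region_iff {y : Pt} : y ∉ P.region ↔ y ∉ P.boundary ∧ P.wind y = 0 := by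
  unfold region
  rw [Set.mem_union, not_or]
  refine and_congr_right fun h => ?_
  rw [P.mem_interior_iff h, not_not]

lemma wind_dichotomy : (∀ y ∉ P.boundary, P.wind y = 0 ∨ P.wind y = 1) ∨
    ∀ y ∉ P.boundary, P.wind y = 0 ∨ P.wind y = -1 := by
  obtain ⟨k, hk, -⟩ := P.exists_wind_values
  obtain ⟨z, hz, hz0, -⟩ := P.exists_far
  rcases hk z hz with h | h
  · rw [hz0] at h
    left
    intro y hy
    rcases hk y hy with h' | h' <;> rw [← h] at h' <;> simp [h']
  · rw [hz0] at h
    right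
    intro y hy
    have : (k : ℝ) = -1 := by linarith
    rcases hk y hy with h' | h' <;> rw [this] at h' <;> simp [h']

end SimplePolygon

/-! ### The shoelace area as an integral of the winding number -/

lemma volume_line {d : Pt} (hd : d ≠ 0) (p : Pt) :
    MeasureTheory.volume {x : Pt | det2 d (x - p) = 0} = 0 := by
  let f : Pt →ₗ[ℝ] ℝ :=
    { toFun := fun x => det2 d x
      map_add' := fun x y => det2_add_right _ _ _
      map_smul' := fun c x => by simp [det2_smul_right] }
  have h : {x : Pt | det2 d (x - p) = 0} = (AffineSubspace.mk' p (LinearMap.ker f) : Set Pt) := by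
    ext x
    simp only [Set.mem_ofPred_eq, SetLike.mem_coe, AffineSubspace.mem_mk', LinearMap.mem_ker,
      vsub_eq_sub]
    rfl
  rw [h]
  apply MeasureTheory.Measure.addHaar_affineSubspace
  intro htop
  have : p + perp d ∈ AffineSubspace.mk' p (LinearMap.ker f) := by rw [htop]; trivial
  rw [AffineSubspace.mem_mk', LinearMap.mem_ker, vsub_eq_sub, add_sub_cancel_left] at this
  have h2 : det2 d (perp d) = 0 := this
  rw [det2_perp] at h2
  exact (dot2_self_pos hd).ne' h2

lemma exists_ne_zero_line (a b : Pt) : ∃ d : Pt, d ≠ 0 ∧ det2 d (b - a) = 0 ∧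
    ∀ x ∈ segment ℝ a b, det2 d (x - a) = 0 := by
  obtain ⟨d, hd, h⟩ : ∃ d : Pt, d ≠ 0 ∧ det2 d (b - a) = 0 := by
    by_cases h : b - a = 0
    · refine ⟨!₂[1, 0], fun h0 => ?_, by simp [h, det2]⟩
      have := congrArg (fun x : Pt => x 0) h0
      simp at this
    · exact ⟨b - a, h, det2_self _⟩
  refine ⟨d, hd, h, fun x hx => ?_⟩
  obtain ⟨t, -, -, rfl⟩ := mem_segment_iff_param.1 hx
  rw [add_sub_cancel_left, det2_smul_right, h, mul_zero]

lemma ae_notMem_segment (a b : Pt) : ∀ᵐ p : Pt, p ∉ segment ℝ a b := by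
  obtain ⟨d, hd, -, h⟩ := exists_ne_zero_line a b
  exact MeasureTheory.measure_mono_null (fun x hx => h x (not_not.1 hx)) (volume_line hd a)

/-- The linear map taking the standard basis to `a`, `b`. -/
def basisMap (a b : Pt) : Pt →ₗ[ℝ] Pt where
  toFun x := x 0 • a + x 1 • b
  map_add' x y := by simp [add_smul]; abel
  map_smul' c x := by simp [smul_smul]

lemma basisMap_apply (a b x : Pt) : basisMap a b x = x 0 • a + x 1 • b := rfl

lemma det_basisMap (a b : Pt) : LinearMap.det (basisMap a b) = det2 a b := by
  rw [← LinearMap.det_toMatrix (EuclideanSpace.basisFun (Fin 2) ℝ).toBasis, Matrix.det_fin_two]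
  simp [LinearMap.toMatrix_apply, basisMap_apply, det2]
  ring

/-- The open standard triangle. -/
def stdTriangle : Set Pt := {x | 0 < x 0 ∧ 0 < x 1 ∧ x 0 + x 1 < 1}

lemma isOpen_stdTriangle : IsOpen stdTriangle :=
  (isOpen_lt (f := fun _ => (0 : ℝ)) (g := fun x : Pt => x 0) (by fun_prop) (by fun_prop)).inter
    ((isOpen_lt (f := fun _ => (0 : ℝ)) (g := fun x : Pt => x 1) (by fun_prop) (by fun_prop)).inter
      (isOpen_lt (f := fun x : Pt => x 0 + x 1) (g := fun _ => (1 : ℝ)) (by fun_prop)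
        (by fun_prop)))

lemma volume_stdTriangle_pos : 0 < MeasureTheory.volume stdTriangle := by
  refine isOpen_stdTriangle.measure_pos _ ⟨!₂[1/4, 1/4], ?_⟩
  simp only [stdTriangle, Set.mem_ofPred_eq]
  norm_num

lemma volume_stdTriangle_lt_top : MeasureTheory.volume stdTriangle < ⊤ := by
  have : Bornology.IsBounded stdTriangle := by
    refine (Metric.isBounded_closedBall (x := (0 : Pt)) (r := 2)).subset ?_
    rintro x ⟨h0, h1, h2⟩
    rw [mem_closedBall_zero_iff, EuclideanSpace.norm_eq, Real.sqrt_le_left (by norm_num)]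
    simp [Fin.sum_univ_two]
    nlinarith
  exact this.measure_lt_top

/-- The open triangle with vertices `0`, `a`, `b`. -/
def openTriangle (a b : Pt) : Set Pt :=
  {p | 0 < det2 a p ∧ 0 < det2 p b ∧ det2 a p + det2 p b < det2 a b}

lemma isOpen_openTriangle (a b : Pt) : IsOpen (openTriangle a b) := by
  have h1 : Continuous fun p => det2 a p := by unfold det2; fun_prop
  have h2 : Continuous fun p => det2 p b := by unfold det2; fun_prop
  exact (isOpen_lt continuous_const h1).inter
    ((isOpen_lt continuous_const h2).inter (isOpen_lt (h1.add h2) continuous_const))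

lemma openTriangle_eq_image {a b : Pt} (h : 0 < det2 a b) :
    openTriangle a b = basisMap a b '' stdTriangle := by
  have hne := h.ne'
  ext p
  constructor
  · rintro ⟨h1, h2, h3⟩
    refine ⟨!₂[det2 p b / det2 a b, det2 a p / det2 a b], ⟨?_, ?_, ?_⟩, ?_⟩
    · change 0 < det2 p b / det2 a b; positivity
    · change 0 < det2 a p / det2 a b; positivity
    · change det2 p b / det2 a b + det2 a p / det2 a b < 1
      rw [← add_div, div_lt_one h]; linarith
    · change (det2 p b / det2 a b) • a + (det2 a p / det2 a b) • b = p
      apply Pt.ext' <;>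
      · simp only [PiLp.add_apply, PiLp.smul_apply, smul_eq_mul]
        field_simp
        simp only [det2]; ring
  · rintro ⟨x, ⟨h1, h2, h3⟩, rfl⟩
    change 0 < det2 a (x 0 • a + x 1 • b) ∧ 0 < det2 (x 0 • a + x 1 • b) b ∧
      det2 a (x 0 • a + x 1 • b) + det2 (x 0 • a + x 1 • b) b < det2 a b
    have e1 : det2 a (x 0 • a + x 1 • b) = x 1 * det2 a b := by
      rw [det2_add_right, det2_smul_right, det2_smul_right, det2_self]; ring
    have e2 : det2 (x 0 • a + x 1 • b) b = x 0 * det2 a b := by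
      rw [det2_add_left, det2_smul_left, det2_smul_left, det2_self]; ring
    rw [e1, e2]
    refine ⟨by positivity, by positivity, ?_⟩
    nlinarith

lemma volume_openTriangle {a b : Pt} (h : 0 < det2 a b) :
    (MeasureTheory.volume (openTriangle a b)).toReal =
      det2 a b * (MeasureTheory.volume stdTriangle).toReal := by
  rw [openTriangle_eq_image h, MeasureTheory.Measure.addHaar_image_linearMap, det_basisMap,
    ENNReal.toReal_mul, abs_of_pos h, ENNReal.toReal_ofReal h.le]

lemma volume_openTriangle_lt_top {a b : Pt} (h : 0 < det2 a b) :
    MeasureTheory.volume (openTriangle a b) < ⊤ := by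
  rw [openTriangle_eq_image h, MeasureTheory.Measure.addHaar_image_linearMap]
  exact ENNReal.mul_lt_top ENNReal.ofReal_lt_top volume_stdTriangle_lt_top

lemma windT_ae_eq_indicator {a b : Pt} (h : 0 < det2 a b) :
    (fun p => windT 0 a b p) =ᵐ[MeasureTheory.volume] (openTriangle a b).indicator fun _ => 1 := by
  have ha : a ≠ 0 := by rintro rfl; simp [det2] at h
  have hb : b ≠ 0 := by rintro rfl; simp [det2] at h
  have hab : b - a ≠ 0 := by
    intro h0; rw [sub_eq_zero] at h0; rw [h0, det2_self] at h; exact lt_irrefl _ h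
  have l1 : ∀ᵐ p : Pt, ¬ det2 a (p - 0) = 0 :=
    MeasureTheory.measure_mono_null (fun x hx => not_not.1 hx) (volume_line ha 0)
  have l2 : ∀ᵐ p : Pt, ¬ det2 b (p - 0) = 0 :=
    MeasureTheory.measure_mono_null (fun x hx => not_not.1 hx) (volume_line hb 0)
  have l3 : ∀ᵐ p : Pt, ¬ det2 (b - a) (p - a) = 0 :=
    MeasureTheory.measure_mono_null (fun x hx => not_not.1 hx) (volume_line hab a)
  filter_upwards [l1, l2, l3] with p h1 h2 h3
  rw [sub_zero] at h1 h2
  have e3 : det2 (b - a) (p - a) = det2 a b - det2 a p - det2 p b := by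
    simp [det2]; ring
  by_cases hp : p ∈ openTriangle a b
  · rw [Set.indicator_of_mem hp]
    obtain ⟨p1, p2, p3⟩ := hp
    refine windT_eq_one ?_ ?_ ?_
    · rw [show det2 (0 - p) (a - p) = det2 a p by simp [det2]; ring]; exact p1
    · rw [show det2 (a - p) (b - p) = det2 a b - det2 a p - det2 p b by simp [det2]; ring]
      linarith
    · rw [show det2 (b - p) (0 - p) = det2 p b by simp [det2]; ring]; exact p2
  · rw [Set.indicator_of_notMem hp]
    refine windT_eq_zero fun hp2 => hp ?_
    have hconv : Convex ℝ {x : Pt | 0 ≤ det2 a x ∧ 0 ≤ det2 x b ∧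
        det2 a x + det2 x b ≤ det2 a b} := by
      intro x hx y hy s t hs ht hst
      have e1 : det2 a (s • x + t • y) = s * det2 a x + t * det2 a y := by
        rw [det2_add_right, det2_smul_right, det2_smul_right]
      have e2 : det2 (s • x + t • y) b = s * det2 x b + t * det2 y b := by
        rw [det2_add_left, det2_smul_left, det2_smul_left]
      simp only [Set.mem_ofPred_eq] at *
      rw [e1, e2]
      refine ⟨by nlinarith, by nlinarith, ?_⟩
      have : det2 a b = s * det2 a b + t * det2 a b := by rw [← add_mul, hst, one_mul]
      rw [this]
      nlinarith
    have hsub : ({0, a, b} : Set Pt) ⊆ {x : Pt | 0 ≤ det2 a x ∧ 0 ≤ det2 x b ∧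
        det2 a x + det2 x b ≤ det2 a b} := by
      rintro x (rfl | rfl | rfl)
      · simp only [Set.mem_ofPred_eq]; simp [det2] at h ⊢; linarith
      · simp only [Set.mem_ofPred_eq, det2_self]; simp [h.le]
      · simp only [Set.mem_ofPred_eq, det2_self]; simp [h.le]
    obtain ⟨q1, q2, q3⟩ := convexHull_min hsub hconv hp2
    refine ⟨lt_of_le_of_ne q1 (Ne.symm h1), lt_of_le_of_ne q2 fun h0 => h2 ?_, ?_⟩
    · rw [det2_swap, ← h0, neg_zero]
    · refine lt_of_le_of_ne q3 fun h0 => h3 ?_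
      rw [e3]; linarith

lemma integral_windT (a b : Pt) :
    MeasureTheory.Integrable (fun p => windT 0 a b p) ∧
      ∫ p, windT 0 a b p = det2 a b * (MeasureTheory.volume stdTriangle).toReal := by
  have pos : ∀ a b : Pt, 0 < det2 a b → MeasureTheory.Integrable (fun p => windT 0 a b p) ∧
      ∫ p, windT 0 a b p = det2 a b * (MeasureTheory.volume stdTriangle).toReal := by
    intro a b h
    have hae := windT_ae_eq_indicator h
    have hm := (isOpen_openTriangle a b).measurableSet
    constructor
    · refine MeasureTheory.Integrable.congr ?_ hae.symm
      exact (MeasureTheory.integrable_indicator_iff hm).2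
        (MeasureTheory.integrableOn_const (volume_openTriangle_lt_top h).ne)
    · rw [MeasureTheory.integral_congr_ae hae, MeasureTheory.integral_indicator_const _ hm,
        MeasureTheory.measureReal_def, volume_openTriangle h]
      simp
  rcases lt_trichotomy (det2 a b) 0 with h | h | h
  · obtain ⟨h1, h2⟩ := pos b a (by rw [det2_swap]; linarith)
    have hae : (fun p => windT 0 a b p) =ᵐ[MeasureTheory.volume] fun p => - windT 0 b a p := by
      filter_upwards [ae_notMem_segment 0 a, ae_notMem_segment a b, ae_notMem_segment b 0]
        with p p1 p2 p3
      unfold windT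
      rw [← neg_div, ang_swap (by rwa [segment_symm] : p ∉ segment ℝ 0 b),
        ang_swap (by rwa [segment_symm] : p ∉ segment ℝ b a),
        ang_swap (by rwa [segment_symm] : p ∉ segment ℝ a 0)]
      ring
    refine ⟨h1.neg.congr hae.symm, ?_⟩
    rw [MeasureTheory.integral_congr_ae hae, MeasureTheory.integral_neg, h2, det2_swap a b]
    ring
  · have hae : (fun p => windT 0 a b p) =ᵐ[MeasureTheory.volume] fun _ => 0 := by
      obtain ⟨d, hd, hda, hdb⟩ : ∃ d : Pt, d ≠ 0 ∧ det2 d a = 0 ∧ det2 d b = 0 := by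
        by_cases ha : a = 0
        · obtain ⟨d, hd, h1, -⟩ := exists_ne_zero_line 0 b
          exact ⟨d, hd, by simp [ha, det2], by simpa using h1⟩
        · exact ⟨a, ha, det2_self a, h⟩
      have l1 : ∀ᵐ p : Pt, ¬ det2 d (p - 0) = 0 :=
        MeasureTheory.measure_mono_null (fun x hx => not_not.1 hx) (volume_line hd 0)
      filter_upwards [l1] with p hp
      refine windT_eq_zero fun hp2 => hp ?_
      rw [sub_zero]
      have hconv : Convex ℝ {x : Pt | det2 d x = 0} := by
        intro x hx y hy s t _ _ _
        simp only [Set.mem_ofPred_eq] at *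
        rw [det2_add_right, det2_smul_right, det2_smul_right, hx, hy]; ring
      refine convexHull_min ?_ hconv hp2
      rintro x (rfl | rfl | rfl)
      · simp [det2]
      · exact hda
      · exact hdb
    refine ⟨(MeasureTheory.integrable_zero _ _ _).congr hae.symm, ?_⟩
    rw [MeasureTheory.integral_congr_ae hae, h]
    simp
  · exact pos a b h

namespace SimplePolygon

variable (P : SimplePolygon)

lemma wind_ae_eq : P.wind =ᵐ[MeasureTheory.volume]
    fun p => ∑ i ∈ Finset.range P.n, windT 0 (P.vtx i) (P.vtx (i + 1)) p := by
  have h : ∀ᵐ p : Pt, ∀ i, p ∉ segment ℝ 0 (P.vtx i) :=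
    MeasureTheory.ae_all_iff.2 fun i => ae_notMem_segment _ _
  filter_upwards [h] with p hp
  unfold wind windS windT
  rw [← Finset.sum_div]
  congr 1
  have e : ∀ i, ang p 0 (P.vtx i) + ang p (P.vtx i) (P.vtx (i + 1)) + ang p (P.vtx (i + 1)) 0 =
      ang p (P.vtx i) (P.vtx (i + 1)) - (ang p 0 (P.vtx (i + 1)) - ang p 0 (P.vtx i)) := by
    intro i
    rw [ang_swap (hp (i + 1))]; ring
  simp only [e]
  rw [Finset.sum_sub_distrib, Finset.sum_range_sub (fun i => ang p 0 (P.vtx i)), P.vtx_n]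
  ring

lemma integral_wind : ∫ p, P.wind p = P.shoelace * (MeasureTheory.volume stdTriangle).toReal := by
  rw [MeasureTheory.integral_congr_ae P.wind_ae_eq,
    MeasureTheory.integral_finsetSum _ fun i _ => (integral_windT _ _).1]
  unfold shoelace
  rw [Finset.sum_mul]
  exact Finset.sum_congr rfl fun i _ => (integral_windT _ _).2

/-- A counterclockwise polygon winds once around its interior points. -/
lemma wind_of_ccw (h : P.CCW) {y : Pt} (hy : y ∉ P.boundary) : P.wind y = 0 ∨ P.wind y = 1 := by
  rcases P.wind_dichotomy with hd | hd
  · exact hd y hy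
  · exfalso
    have hae : ∀ᵐ p : Pt, P.wind p ≤ 0 := by
      have : ∀ᵐ p : Pt, ∀ i, p ∉ P.edge i :=
        MeasureTheory.ae_all_iff.2 fun i => ae_notMem_segment _ _
      filter_upwards [this] with p hp
      have hpb : p ∉ P.boundary := fun hb => by
        obtain ⟨i, hi⟩ := P.mem_boundary.1 hb
        exact hp i hi
      rcases hd p hpb with h0 | h0 <;> simp [h0]
    have h1 := MeasureTheory.integral_nonpos_of_ae hae
    rw [P.integral_wind] at h1
    have h2 : 0 < (MeasureTheory.volume stdTriangle).toReal :=
      ENNReal.toReal_pos volume_stdTriangle_pos.ne' volume_stdTriangle_lt_top.ne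
    unfold CCW at h
    nlinarith [mul_pos h h2]

lemma mem_interior_iff_of_ccw (h : P.CCW) {y : Pt} :
    y ∈ P.interior ↔ y ∉ P.boundary ∧ P.wind y = 1 := by
  constructor
  · intro hy
    refine ⟨hy.1, ?_⟩
    rcases P.wind_of_ccw h hy.1 with h0 | h0
    · exact absurd h0 ((P.mem_interior_iff hy.1).1 hy)
    · exact h0
  · rintro ⟨h1, h2⟩
    rw [P.mem_interior_iff h1, h2]; exact one_ne_zero

end SimplePolygon

/-! ### Translating a polygon and inserting two vertices -/

lemma sum_range_shift {M : Type*} [AddCommMonoid M] {f : ℕ → M} {n : ℕ} (hf : ∀ i, f (i + n) = f i)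
    (k : ℕ) : ∑ j ∈ Finset.range n, f (k + j) = ∑ j ∈ Finset.range n, f j := by
  induction k with
  | zero => simp
  | succ k ih =>
    rw [← ih]
    have h1 := Finset.sum_range_succ (fun j => f (k + j)) n
    rw [Finset.sum_range_succ'] at h1
    simp only [add_zero, hf k] at h1
    cases n with
    | zero => simp
    | succ m =>
      rw [Finset.sum_range_succ' (fun j => f (k + j)), Finset.sum_range_succ]
      congr 1
      · exact Finset.sum_congr rfl fun j _ => by congr 1; omega
      · rw [show k + 1 + m = k + (m + 1) by omega, hf, add_zero]

lemma mem_segment_add_iff (x a b τ : Pt) :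
    x ∈ segment ℝ (a + τ) (b + τ) ↔ x - τ ∈ segment ℝ a b := by
  have h := mem_segment_translate ℝ τ (x := x - τ) (b := a) (c := b)
  rwa [add_comm τ a, add_comm τ b, add_sub_cancel] at h

/-- The turn at `b` on the way from `a` to `c` is a left turn. -/
def leftTurn (a b c : Pt) : ℕ := if 0 < det2 (b - a) (c - b) then 1 else 0

namespace SimplePolygon

variable (P : SimplePolygon)

lemma numConvex_eq : P.numConvex =
    ∑ i ∈ Finset.range P.n, leftTurn (P.vtx i) (P.vtx (i + 1)) (P.vtx (i + 2)) := by
  unfold numConvex leftTurn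
  rw [Finset.sum_ite, Finset.sum_const_zero, add_zero, Finset.sum_const, smul_eq_mul, mul_one,
    ← Set.ncard_coe_finset]
  congr 1
  ext i
  simp [ConvexAt]

/-- The translate of a polygon. -/
def translate (τ : Pt) : SimplePolygon where
  n := P.n
  three_le := P.three_le
  vtx i := P.vtx i + τ
  periodic i := by rw [P.periodic]
  inj i hi j hj h := P.inj i hi j hj (add_right_cancel h)
  simple x := by
    have := P.simple (x - τ)
    simpa only [mem_segment_add_iff] using this
  vtx_of_two x hx := by
    obtain ⟨i, hi, h⟩ := P.vtx_of_two (x - τ) (by simpa only [mem_segment_add_iff] using hx)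
    exact ⟨i, hi, by rw [← h]; abel⟩

lemma translate_n (τ : Pt) : (P.translate τ).n = P.n := rfl

lemma translate_vtx (τ : Pt) (i : ℕ) : (P.translate τ).vtx i = P.vtx i + τ := rfl

lemma mem_boundary_translate {τ x : Pt} : x ∈ (P.translate τ).boundary ↔ x - τ ∈ P.boundary := by
  simp only [mem_boundary, edge, translate_vtx, mem_segment_add_iff]

lemma wind_translate (τ x : Pt) : (P.translate τ).wind x = P.wind (x - τ) := by
  have e : ∀ a : Pt, a + τ - x = a - (x - τ) := by intro a; abel
  unfold wind windS ang angC
  simp only [translate_n, translate_vtx, e]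

lemma numConvex_translate (τ : Pt) : (P.translate τ).numConvex = P.numConvex := by
  simp only [numConvex_eq, translate_n, translate_vtx, leftTurn, add_sub_add_right_eq_sub]

lemma shoelace_translate (τ : Pt) : (P.translate τ).shoelace = P.shoelace := by
  unfold shoelace
  simp only [translate_n, translate_vtx]
  have e : ∀ i, det2 (P.vtx i + τ) (P.vtx (i + 1) + τ) = det2 (P.vtx i) (P.vtx (i + 1)) +
      (det2 τ (P.vtx (i + 1)) - det2 τ (P.vtx i)) := by
    intro i; simp [det2]; ring
  simp only [e]
  rw [Finset.sum_add_distrib, Finset.sum_range_sub (fun i => det2 τ (P.vtx i)), P.vtx_n]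
  ring

/-- The vertex sequence obtained by inserting `x`, `y` into the edge from vertex `k` to vertex
`k + 1`, started at vertex `k + 1`. -/
def insVtx (k : ℕ) (x y : Pt) (j : ℕ) : Pt :=
  if j % (P.n + 2) < P.n then P.vtx (k + 1 + j % (P.n + 2))
  else if j % (P.n + 2) = P.n then x else y

section insVtx

variable (k : ℕ) (x y : Pt)

lemma insVtx_of_lt {j : ℕ} (hj : j < P.n) : P.insVtx k x y j = P.vtx (k + 1 + j) := by
  unfold insVtx
  rw [Nat.mod_eq_of_lt (by omega), if_pos hj]

lemma insVtx_n : P.insVtx k x y P.n = x := by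
  unfold insVtx
  rw [Nat.mod_eq_of_lt (by omega), if_neg (lt_irrefl _), if_pos rfl]

lemma insVtx_n_add_one : P.insVtx k x y (P.n + 1) = y := by
  unfold insVtx
  rw [Nat.mod_eq_of_lt (by omega), if_neg (by omega), if_neg (by omega)]

lemma insVtx_periodic (j : ℕ) : P.insVtx k x y (j + (P.n + 2)) = P.insVtx k x y j := by
  unfold insVtx
  rw [Nat.add_mod_right]

lemma insVtx_n_add_two : P.insVtx k x y (P.n + 2) = P.vtx (k + 1) := by
  have := P.insVtx_periodic k x y 0
  rw [zero_add, P.insVtx_of_lt k x y P.n_pos] at this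
  exact this

lemma insVtx_n_add_three : P.insVtx k x y (P.n + 3) = P.vtx (k + 2) := by
  have := P.insVtx_periodic k x y 1
  rw [P.insVtx_of_lt k x y (j := 1) (by have := P.three_le; omega)] at this
  rw [show P.n + 3 = 1 + (P.n + 2) by omega, this]

lemma insVtx_n_sub_one : P.insVtx k x y (P.n - 1) = P.vtx k := by
  rw [P.insVtx_of_lt k x y (by have := P.n_pos; omega)]
  apply P.vtx_congr
  rw [show k + 1 + (P.n - 1) = k + P.n by have := P.n_pos; omega, Nat.add_mod_right]

end insVtx

/-- The conditions under which the edge from vertex `k` to vertex `k + 1` may be replaced by the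
path through `x` and `y`. -/
structure Insertable (k : ℕ) (x y : Pt) : Prop where
  first : ∀ j, j % P.n ≠ k % P.n → ∀ p ∈ segment ℝ (P.vtx k) x, p ∈ P.edge j → p = P.vtx k
  second : ∀ j, j % P.n ≠ k % P.n → ∀ p ∈ segment ℝ x y, p ∉ P.edge j
  third : ∀ j, j % P.n ≠ k % P.n → ∀ p ∈ segment ℝ y (P.vtx (k + 1)), p ∈ P.edge j →
    p = P.vtx (k + 1)
  first_second : ∀ p ∈ segment ℝ (P.vtx k) x, p ∈ segment ℝ x y → p = x
  second_third : ∀ p ∈ segment ℝ x y, p ∈ segment ℝ y (P.vtx (k + 1)) → p = y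
  first_third : ∀ p ∈ segment ℝ (P.vtx k) x, p ∉ segment ℝ y (P.vtx (k + 1))

lemma insVtx_edge (k : ℕ) (x y : Pt) {j : ℕ} (hj : j < P.n + 2) :
    (j < P.n - 1 ∧ segment ℝ (P.insVtx k x y j) (P.insVtx k x y (j + 1)) = P.edge (k + 1 + j) ∧
      (k + 1 + j) % P.n ≠ k % P.n) ∨
    (j = P.n - 1 ∧ P.insVtx k x y j = P.vtx k ∧ P.insVtx k x y (j + 1) = x) ∨
    (j = P.n ∧ P.insVtx k x y j = x ∧ P.insVtx k x y (j + 1) = y) ∨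
    (j = P.n + 1 ∧ P.insVtx k x y j = y ∧ P.insVtx k x y (j + 1) = P.vtx (k + 1)) := by
  have hn := P.three_le
  rcases (by omega : j < P.n - 1 ∨ j = P.n - 1 ∨ j = P.n ∨ j = P.n + 1) with h | h | h | h
  · left
    refine ⟨h, ?_, ?_⟩
    · rw [P.insVtx_of_lt k x y (by omega), P.insVtx_of_lt k x y (by omega)]; rfl
    · intro he
      have h1 : k + (1 + j) ≡ k + 0 [MOD P.n] := by rw [← add_assoc]; exact he
      have h2 := Nat.ModEq.add_left_cancel' k h1
      rw [Nat.ModEq, Nat.mod_eq_of_lt (by omega), Nat.zero_mod] at h2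
      omega
  · right; left
    subst h
    exact ⟨rfl, P.insVtx_n_sub_one k x y, by
      rw [show P.n - 1 + 1 = P.n by omega]; exact P.insVtx_n k x y⟩
  · right; right; left
    subst h
    exact ⟨rfl, P.insVtx_n k x y, P.insVtx_n_add_one k x y⟩
  · right; right; right
    subst h
    exact ⟨rfl, P.insVtx_n_add_one k x y, P.insVtx_n_add_two k x y⟩

/-- The polygon with two more vertices `x`, `y` on the way from vertex `k` to vertex `k + 1`. -/
def insert {P : SimplePolygon} {k : ℕ} {x y : Pt} (h : P.Insertable k x y) : SimplePolygon :=
  ofPairwise (P.n + 2) (by have := P.three_le; omega) (P.insVtx k x y) (P.insVtx_periodic k x y)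
    (by
      have hxe : ∀ j, x ≠ P.vtx j := by
        rintro j rfl
        by_cases hj : j % P.n = k % P.n
        · obtain ⟨l, hl⟩ := P.exists_mod_eq_succ j
          refine h.second l ?_ _ (left_mem_segment ℝ _ _)
            (by rw [P.vtx_congr hl]; exact P.vtx_succ_mem_edge l)
          rw [← hj, hl]; exact (P.succ_mod_ne l).symm
        · exact h.second j hj _ (left_mem_segment ℝ _ _) (P.vtx_mem_edge j)
      have hye : ∀ j, y ≠ P.vtx j := by
        rintro j rfl
        by_cases hj : j % P.n = k % P.n
        · obtain ⟨l, hl⟩ := P.exists_mod_eq_succ j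
          refine h.second l ?_ _ (right_mem_segment ℝ _ _)
            (by rw [P.vtx_congr hl]; exact P.vtx_succ_mem_edge l)
          rw [← hj, hl]; exact (P.succ_mod_ne l).symm
        · exact h.second j hj _ (right_mem_segment ℝ _ _) (P.vtx_mem_edge j)
      have hxy : x ≠ y := by
        rintro rfl
        exact h.first_third x (right_mem_segment ℝ _ _) (left_mem_segment ℝ _ _)
      have hv : ∀ i < P.n, ∀ j < P.n, P.vtx (k + 1 + i) = P.vtx (k + 1 + j) → i = j := by
        intro i hi j hj hij
        have h2 := Nat.ModEq.add_left_cancel' (k + 1) (P.vtx_eq_iff.1 hij)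
        rwa [Nat.ModEq, Nat.mod_eq_of_lt hi, Nat.mod_eq_of_lt hj] at h2
      have hcase : ∀ i < P.n + 2, (i < P.n ∧ P.insVtx k x y i = P.vtx (k + 1 + i)) ∨
          (i = P.n ∧ P.insVtx k x y i = x) ∨ (i = P.n + 1 ∧ P.insVtx k x y i = y) := by
        intro i hi
        rcases (by omega : i < P.n ∨ i = P.n ∨ i = P.n + 1) with h | rfl | rfl
        · exact Or.inl ⟨h, P.insVtx_of_lt k x y h⟩
        · exact Or.inr (Or.inl ⟨rfl, P.insVtx_n k x y⟩)
        · exact Or.inr (Or.inr ⟨rfl, P.insVtx_n_add_one k x y⟩)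
      intro i hi j hj hij
      rcases hcase i hi with ⟨h1, e1⟩ | ⟨h1, e1⟩ | ⟨h1, e1⟩ <;>
      rcases hcase j hj with ⟨h2, e2⟩ | ⟨h2, e2⟩ | ⟨h2, e2⟩ <;>
      rw [e1, e2] at hij
      · exact hv i h1 j h2 hij
      · exact absurd hij.symm (hxe _)
      · exact absurd hij.symm (hye _)
      · exact absurd hij (hxe _)
      · omega
      · exact absurd hij hxy
      · exact absurd hij (hye _)
      · exact absurd hij.symm hxy
      · omega)
    (by
      have hn := P.three_le
      have key : ∀ i < P.n + 2, ∀ j < P.n + 2, i < j →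
          ∀ p ∈ segment ℝ (P.insVtx k x y i) (P.insVtx k x y (i + 1)),
          p ∈ segment ℝ (P.insVtx k x y j) (P.insVtx k x y (j + 1)) →
          p = P.insVtx k x y i ∨ p = P.insVtx k x y j := by
        intro i hi j hj hij p hpi hpj
        rcases P.insVtx_edge k x y hi with ⟨h1, e1, m1⟩ | ⟨h1, e1, f1⟩ | ⟨h1, e1, f1⟩ | ⟨h1, e1, f1⟩ <;>
        rcases P.insVtx_edge k x y hj with ⟨h2, e2, m2⟩ | ⟨h2, e2, f2⟩ | ⟨h2, e2, f2⟩ | ⟨h2, e2, f2⟩ <;>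
        first
        | omega
        | skip
        · rw [e1] at hpi
          rw [e2] at hpj
          have hm : (k + 1 + i) % P.n ≠ (k + 1 + j) % P.n := by
            intro hm
            have h2 := Nat.ModEq.add_left_cancel' (k + 1) hm
            rw [Nat.ModEq, Nat.mod_eq_of_lt (by omega), Nat.mod_eq_of_lt (by omega)] at h2
            omega
          rw [P.insVtx_of_lt k x y (by omega), P.insVtx_of_lt k x y (by omega)]
          rcases P.simple_mod hm hpi hpj with ⟨-, h⟩ | ⟨-, h⟩
          · exact Or.inr h
          · exact Or.inl h
        · rw [e1] at hpi
          rw [e2, f2] at hpj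
          right; rw [e2]
          exact h.first _ m1 p hpj hpi
        · rw [e1] at hpi
          rw [e2, f2] at hpj
          exact absurd hpi (h.second _ m1 p hpj)
        · rw [e1] at hpi
          rw [e2, f2] at hpj
          have hp := h.third _ m1 p hpj hpi
          left
          rw [P.insVtx_of_lt k x y (by omega)]
          rcases Nat.eq_zero_or_pos i with rfl | h0
          · exact hp
          · exfalso
            rw [hp] at hpi
            have hm : (k + 1) % P.n ≠ (k + 1 + i) % P.n := by
              intro hm
              have h2 := Nat.ModEq.add_left_cancel' (k + 1) (show k + 1 + 0 ≡ k + 1 + i [MOD P.n] from hm)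
              rw [Nat.ModEq, Nat.mod_eq_of_lt (by omega), Nat.mod_eq_of_lt (by omega)] at h2
              omega
            rcases P.simple_mod hm (P.vtx_mem_edge (k + 1)) hpi with ⟨-, h⟩ | ⟨h, -⟩
            · exact hm (P.vtx_eq_iff.1 h)
            · exact m1 (succ_mod_cancel h).symm
        · rw [e1, f1] at hpi
          rw [e2, f2] at hpj
          right; rw [e2]
          exact h.first_second p hpi hpj
        · rw [e1, f1] at hpi
          rw [e2, f2] at hpj
          exact absurd hpj (h.first_third p hpi)
        · rw [e1, f1] at hpi
          rw [e2, f2] at hpj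
          right; rw [e2]
          exact h.second_third p hpi hpj
      intro i hi j hj hij p hpi hpj
      rcases lt_or_gt_of_ne hij with h' | h'
      · exact key i hi j hj h' p hpi hpj
      · exact (key j hj i hi h' p hpj hpi).symm)

section insert

variable {P} {k : ℕ} {x y : Pt} (h : P.Insertable k x y)

lemma insert_n : (insert h).n = P.n + 2 := rfl

lemma insert_vtx (j : ℕ) : (insert h).vtx j = P.insVtx k x y j := rfl

lemma sum_edges_insert (f : Pt → Pt → ℝ) :
    ∑ j ∈ Finset.range (insert h).n, f ((insert h).vtx j) ((insert h).vtx (j + 1)) =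
      ∑ j ∈ Finset.range P.n, f (P.vtx j) (P.vtx (j + 1)) +
        (f (P.vtx k) x + f x y + f y (P.vtx (k + 1)) - f (P.vtx k) (P.vtx (k + 1))) := by
  have hn := P.three_le
  obtain ⟨m, hm⟩ : ∃ m, P.n = m + 1 := ⟨P.n - 1, by omega⟩
  have hper : ∀ i, f (P.vtx (i + P.n)) (P.vtx (i + P.n + 1)) = f (P.vtx i) (P.vtx (i + 1)) := by
    intro i
    rw [P.periodic, show i + P.n + 1 = (i + 1) + P.n by omega, P.periodic]
  have hs := sum_range_shift (f := fun i => f (P.vtx i) (P.vtx (i + 1))) hper (k + 1)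
  rw [← hs, insert_n]
  simp only [insert_vtx]
  rw [Finset.sum_range_succ, Finset.sum_range_succ, P.insVtx_n, P.insVtx_n_add_one,
    P.insVtx_n_add_two]
  have h1 : ∑ j ∈ Finset.range P.n, f (P.insVtx k x y j) (P.insVtx k x y (j + 1)) =
      ∑ j ∈ Finset.range m, f (P.vtx (k + 1 + j)) (P.vtx (k + 1 + j + 1)) + f (P.vtx k) x := by
    rw [hm, Finset.sum_range_succ]
    congr 1
    · refine Finset.sum_congr rfl fun j hj => ?_
      rw [Finset.mem_range] at hj
      rw [P.insVtx_of_lt k x y (by omega), P.insVtx_of_lt k x y (by omega), add_assoc (k + 1)]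
    · rw [show m = P.n - 1 by omega, P.insVtx_n_sub_one, show P.n - 1 + 1 = P.n by omega,
        P.insVtx_n]
  have h2 : ∑ j ∈ Finset.range P.n, f (P.vtx (k + 1 + j)) (P.vtx (k + 1 + j + 1)) =
      ∑ j ∈ Finset.range m, f (P.vtx (k + 1 + j)) (P.vtx (k + 1 + j + 1)) +
        f (P.vtx k) (P.vtx (k + 1)) := by
    rw [hm, Finset.sum_range_succ, show k + 1 + m = k + P.n by omega, hper]
  rw [h1, h2]
  ring

lemma wind_insert (p : Pt) : (insert h).wind p = P.wind p +
    (ang p (P.vtx k) x + ang p x y + ang p y (P.vtx (k + 1)) - ang p (P.vtx k) (P.vtx (k + 1))) /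
      (2 * Real.pi) := by
  unfold wind windS
  rw [sum_edges_insert h (ang p), add_div]

lemma shoelace_insert : (insert h).shoelace = P.shoelace +
    (det2 (P.vtx k) x + det2 x y + det2 y (P.vtx (k + 1)) - det2 (P.vtx k) (P.vtx (k + 1))) :=
  sum_edges_insert h det2

lemma numConvex_insert (l : ℕ) (hl : (l + 1) % P.n = k % P.n) :
    (insert h).numConvex + (leftTurn (P.vtx l) (P.vtx k) (P.vtx (k + 1)) +
        leftTurn (P.vtx k) (P.vtx (k + 1)) (P.vtx (k + 2))) =
      P.numConvex + (leftTurn (P.vtx l) (P.vtx k) x + leftTurn (P.vtx k) x y +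
        leftTurn x y (P.vtx (k + 1)) + leftTurn y (P.vtx (k + 1)) (P.vtx (k + 2))) := by
  have hn := P.three_le
  obtain ⟨m, hm⟩ : ∃ m, P.n = m + 2 := ⟨P.n - 2, by omega⟩
  have hper : ∀ i, leftTurn (P.vtx (i + P.n)) (P.vtx (i + P.n + 1)) (P.vtx (i + P.n + 2)) =
      leftTurn (P.vtx i) (P.vtx (i + 1)) (P.vtx (i + 2)) := by
    intro i
    rw [P.periodic, show i + P.n + 1 = (i + 1) + P.n by omega, P.periodic,
      show i + P.n + 2 = (i + 2) + P.n by omega, P.periodic]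
  have hs := sum_range_shift (f := fun i => leftTurn (P.vtx i) (P.vtx (i + 1)) (P.vtx (i + 2)))
    hper (k + 1)
  have e0 : P.vtx (k + 1 + m) = P.vtx l := by
    apply P.vtx_congr
    apply succ_mod_cancel
    rw [hl, show k + 1 + m + 1 = k + P.n by omega, Nat.add_mod_right]
  have e1 : P.vtx (k + 1 + m + 1) = P.vtx k := by
    rw [show k + 1 + m + 1 = k + P.n by omega, P.periodic]
  have e2 : P.vtx (k + 1 + m + 2) = P.vtx (k + 1) := by
    rw [show k + 1 + m + 2 = k + 1 + P.n by omega, P.periodic]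
  have i0 : P.insVtx k x y m = P.vtx l := by rw [P.insVtx_of_lt k x y (by omega), e0]
  have i1 : P.insVtx k x y (m + 1) = P.vtx k := by
    rw [P.insVtx_of_lt k x y (by omega), ← add_assoc, e1]
  have i2 : P.insVtx k x y (m + 2) = x := by rw [← hm, P.insVtx_n]
  have i3 : P.insVtx k x y (m + 3) = y := by
    rw [show m + 3 = P.n + 1 by omega, P.insVtx_n_add_one]
  have i4 : P.insVtx k x y (m + 4) = P.vtx (k + 1) := by
    rw [show m + 4 = P.n + 2 by omega, P.insVtx_n_add_two]
  have i5 : P.insVtx k x y (m + 5) = P.vtx (k + 2) := by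
    rw [show m + 5 = P.n + 3 by omega, P.insVtx_n_add_three]
  rw [numConvex_eq, numConvex_eq, ← hs, insert_n, hm]
  simp only [insert_vtx]
  rw [Finset.sum_range_succ _ (m + 1), Finset.sum_range_succ _ m, e0, e1, e2,
    show k + 1 + (m + 1) = k + P.n by omega, hper, Finset.sum_range_succ _ (m + 3),
    Finset.sum_range_succ _ (m + 2), Finset.sum_range_succ _ (m + 1), Finset.sum_range_succ _ m]
  simp only [add_assoc, Nat.reduceAdd]
  rw [i0, i1, i2, i3, i4, i5]
  have hsum : ∑ j ∈ Finset.range m, leftTurn (P.insVtx k x y j) (P.insVtx k x y (j + 1))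
      (P.insVtx k x y (j + 2)) = ∑ j ∈ Finset.range m, leftTurn (P.vtx (k + (1 + j)))
        (P.vtx (k + (1 + (j + 1)))) (P.vtx (k + (1 + (j + 2)))) := by
    refine Finset.sum_congr rfl fun j hj => ?_
    rw [Finset.mem_range] at hj
    rw [P.insVtx_of_lt k x y (by omega), P.insVtx_of_lt k x y (by omega),
      P.insVtx_of_lt k x y (by omega)]
    simp only [add_assoc]
  rw [hsum]
  ring

lemma mem_boundary_insert {p : Pt} (hp : p ∈ (insert h).boundary) :
    p ∈ P.boundary ∨ p ∈ segment ℝ (P.vtx k) x ∨ p ∈ segment ℝ x y ∨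
      p ∈ segment ℝ y (P.vtx (k + 1)) := by
  rw [boundary_eq] at hp
  obtain ⟨j, hj, hpj⟩ := hp
  simp only [insert_vtx] at hpj
  rcases P.insVtx_edge k x y hj with ⟨-, e1, -⟩ | ⟨-, e1, f1⟩ | ⟨-, e1, f1⟩ | ⟨-, e1, f1⟩
  · rw [e1] at hpj
    exact Or.inl (P.edge_subset_boundary _ hpj)
  all_goals rw [e1, f1] at hpj; tauto

end insert

end SimplePolygon

/-! ### Visible vertices -/

lemma det2_zero_left (v : Pt) : det2 0 v = 0 := by simp [det2]

lemma det2_zero_right (v : Pt) : det2 v 0 = 0 := by simp [det2]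

/-- A point is in the closed triangle spanned by the origin, `x` and `w`. -/
lemma eq_smul_add_smul {x w : Pt} (h : det2 x w ≠ 0) (y : Pt) :
    y = (det2 y w / det2 x w) • x + (det2 x y / det2 x w) • w := by
  have h' : x 0 * w 1 - x 1 * w 0 ≠ 0 := h
  apply Pt.ext'
  · simp only [det2, PiLp.add_apply, PiLp.smul_apply, smul_eq_mul]
    rw [div_mul_eq_mul_div, div_mul_eq_mul_div, ← add_div, eq_div_iff h']
    ring
  · simp only [det2, PiLp.add_apply, PiLp.smul_apply, smul_eq_mul]
    rw [div_mul_eq_mul_div, div_mul_eq_mul_div, ← add_div, eq_div_iff h']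
    ring

namespace SimplePolygon

variable (P : SimplePolygon)

/-- The segment from the origin to `x` avoids the boundary, except possibly at `x`. -/
def FreeTo (x : Pt) : Prop := ∀ t : ℝ, 0 ≤ t → t < 1 → t • x ∉ P.boundary

/-- No two vertices are on a common line through the origin. -/
def Generic : Prop := ∀ i j, i % P.n ≠ j % P.n → det2 (P.vtx i) (P.vtx j) ≠ 0

variable {P}

lemma FreeTo.wind_eq {x : Pt} (h : P.FreeTo x) {t : ℝ} (h0 : 0 ≤ t) (h1 : t < 1) :
    P.wind (t • x) = P.wind 0 := by
  have hs : IsPreconnected ((fun t : ℝ => t • x) '' Set.Ico 0 1) :=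
    isPreconnected_Ico.image _ (by fun_prop)
  refine P.wind_eq_of_isPreconnected hs ?_ ⟨t, ⟨h0, h1⟩, rfl⟩ ⟨0, ⟨le_rfl, one_pos⟩, by simp⟩
  rintro _ ⟨s, ⟨hs0, hs1⟩, rfl⟩
  exact h s hs0 hs1

lemma FreeTo.det2_pos (hccw : P.CCW) (hw : P.wind 0 = 1) {x : Pt} (h : P.FreeTo x) {j : ℕ}
    (hx : x ∈ P.edge j) (h1 : x ≠ P.vtx j) (h2 : x ≠ P.vtx (j + 1)) :
    0 < det2 (P.vtx j) (P.vtx (j + 1)) := by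
  obtain ⟨ε, hε, k, hb, hp, hn⟩ := P.exists_jump hx h1 h2
  have hx0 : x ≠ 0 := by
    rintro rfl
    exact h 0 le_rfl one_pos (by simpa using P.edge_subset_boundary j hx)
  have hxn : 0 < ‖x‖ := norm_pos_iff.2 hx0
  obtain ⟨δ, hδ, hδ1, hδ2⟩ : ∃ δ : ℝ, 0 < δ ∧ δ < 1 ∧ δ * ‖x‖ < ε := by
    refine ⟨min (1 / 2) (ε / 2 / ‖x‖), by positivity, lt_of_le_of_lt (min_le_left _ _) (by norm_num),
      ?_⟩
    calc _ ≤ ε / 2 / ‖x‖ * ‖x‖ := by gcongr; exact min_le_right _ _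
      _ = ε / 2 := by field_simp
      _ < ε := by linarith
  have hm1 : (1 - δ) • x ∈ Metric.ball x ε := by
    rw [mem_ball_iff_norm, show (1 - δ) • x - x = (-δ) • x by module, norm_smul, norm_neg,
      Real.norm_eq_abs, abs_of_pos hδ]
    exact hδ2
  have hm2 : (1 + δ) • x ∈ Metric.ball x ε := by
    rw [mem_ball_iff_norm, show (1 + δ) • x - x = δ • x by module, norm_smul,
      Real.norm_eq_abs, abs_of_pos hδ]
    exact hδ2
  have e1 : det2 (P.vtx (j + 1) - P.vtx j) ((1 - δ) • x - x) =
      δ * det2 x (P.vtx (j + 1) - P.vtx j) := by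
    rw [show (1 - δ) • x - x = (-δ) • x by module, det2_smul_right, det2_swap]; ring
  have e2 : det2 (P.vtx (j + 1) - P.vtx j) ((1 + δ) • x - x) =
      - (δ * det2 x (P.vtx (j + 1) - P.vtx j)) := by
    rw [show (1 + δ) • x - x = δ • x by module, det2_smul_right, det2_swap]; ring
  have hxe : det2 x (P.vtx (j + 1) - P.vtx j) = det2 (P.vtx j) (P.vtx (j + 1)) := by
    have := det2_eq_zero_of_mem_segment hx
    simp only [det2, PiLp.sub_apply] at this ⊢
    linear_combination -this
  have hf := h (1 - δ) (by linarith) (by linarith)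
  rw [hb _ hm1, e1] at hf
  have hw1 : P.wind ((1 - δ) • x) = 1 := by rw [h.wind_eq (by linarith) (by linarith), hw]
  rcases lt_trichotomy (det2 x (P.vtx (j + 1) - P.vtx j)) 0 with hl | hl | hl
  · exfalso
    have hk := hn _ hm1 (by rw [e1]; exact mul_neg_of_pos_of_neg hδ hl)
    have hpos : 0 < det2 (P.vtx (j + 1) - P.vtx j) ((1 + δ) • x - x) := by
      rw [e2]; have := mul_neg_of_pos_of_neg hδ hl; linarith
    have hk2 := hp _ hm2 hpos
    have hnb : (1 + δ) • x ∉ P.boundary := by rw [hb _ hm2]; exact hpos.ne'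
    rcases P.wind_of_ccw hccw hnb with h3 | h3 <;> linarith
  · rw [hl, mul_zero] at hf; exact absurd rfl hf
  · rwa [hxe] at hl

lemma Generic.ne_zero (hg : P.Generic) (i : ℕ) : P.vtx i ≠ 0 := by
  intro h
  exact hg i (i + 1) (P.succ_mod_ne i).symm (by rw [h, det2_zero_left])

lemma Generic.eq_of_mem_edge (hg : P.Generic) {k j : ℕ} {p y : Pt} (hp : p ∈ P.edge j)
    (hy : y ∈ P.edge j) (hpk : det2 p (P.vtx k) = 0) (hyk : det2 y (P.vtx k) = 0) : p = y := by
  obtain ⟨s, -, -, rfl⟩ := mem_segment_iff_param.1 hp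
  obtain ⟨t, -, -, rfl⟩ := mem_segment_iff_param.1 hy
  rw [det2_add_left, det2_smul_left] at hpk hyk
  by_contra hne
  have hst : s - t ≠ 0 := fun h => hne (by rw [sub_eq_zero.1 h])
  have h1 : (s - t) * det2 (P.vtx (j + 1) - P.vtx j) (P.vtx k) = 0 := by linarith
  have h2 := (mul_eq_zero.1 h1).resolve_left hst
  rw [h2, mul_zero, add_zero] at hpk
  rw [det2_sub_left, hpk, sub_zero] at h2
  have e1 : j % P.n = k % P.n := by by_contra h; exact hg _ _ h hpk
  have e2 : (j + 1) % P.n = k % P.n := by by_contra h; exact hg _ _ h h2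
  exact P.succ_mod_ne j (e2.trans e1.symm)

lemma exists_freeTo (hg : P.Generic) (h0 : (0 : Pt) ∉ P.boundary) :
    ∃ i x, x ∈ P.edge i ∧ (∀ j, x ≠ P.vtx j) ∧ P.FreeTo x := by
  -- a direction that misses all vertices
  have hfin : Set.Finite (⋃ j ∈ Finset.range P.n,
      {t : ℝ | det2 (P.vtx 0 + t • (P.vtx 1 - P.vtx 0)) (P.vtx j) = 0}) := by
    refine Set.Finite.biUnion (Finset.finite_toSet _) fun j _ => Set.Subsingleton.finite ?_
    intro s hs t ht
    rw [Set.mem_ofPred_eq, det2_add_left, det2_smul_left] at hs ht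
    by_contra hne
    have hst : s - t ≠ 0 := sub_ne_zero.2 hne
    have h1 : (s - t) * det2 (P.vtx 1 - P.vtx 0) (P.vtx j) = 0 := by linarith
    have h2 := (mul_eq_zero.1 h1).resolve_left hst
    rw [h2, mul_zero, add_zero] at hs
    rw [det2_sub_left, hs, sub_zero] at h2
    have e1 : 0 % P.n = j % P.n := by by_contra h; exact hg _ _ h hs
    have e2 : (0 + 1) % P.n = j % P.n := by by_contra h; exact hg _ _ h h2
    exact P.succ_mod_ne 0 (e2.trans e1.symm)
  obtain ⟨t, ⟨ht0, ht1⟩, ht⟩ := ((Set.Icc_infinite (zero_lt_one (α := ℝ))).sdiff hfin).nonempty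
  set z := P.vtx 0 + t • (P.vtx 1 - P.vtx 0) with hz
  have hzv : ∀ j, det2 z (P.vtx j) ≠ 0 := by
    intro j hj
    apply ht
    simp only [Set.mem_iUnion, Finset.mem_range]
    refine ⟨j % P.n, Nat.mod_lt _ P.n_pos, ?_⟩
    rw [Set.mem_ofPred_eq, P.vtx_mod]; exact hj
  have hzb : z ∈ P.boundary :=
    P.edge_subset_boundary 0 (mem_segment_iff_param.2 ⟨t, ht0, ht1, rfl⟩)
  have hc : IsCompact {s : ℝ | s ∈ Set.Icc (0 : ℝ) 1 ∧ s • z ∈ P.boundary} := by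
    refine isCompact_Icc.inter_right (t := (fun s : ℝ => s • z) ⁻¹' P.boundary) ?_
    exact P.isClosed_boundary.preimage (by fun_prop)
  obtain ⟨s, ⟨⟨hs0, hs1⟩, hsb⟩, hmin⟩ := hc.exists_isLeast ⟨1, ⟨zero_le_one, le_rfl⟩, by simpa⟩
  obtain ⟨i, hi⟩ := P.mem_boundary.1 hsb
  have hs : s ≠ 0 := by rintro rfl; exact h0 (by simpa using hsb)
  refine ⟨i, s • z, hi, ?_, ?_⟩
  · intro j hj
    apply hzv j
    have : det2 (s • z) (P.vtx j) = 0 := by rw [hj, det2_self]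
    rw [det2_smul_left] at this
    exact (mul_eq_zero.1 this).resolve_left hs
  · intro r hr0 hr1 hrb
    rw [smul_smul] at hrb
    have hle := hmin (⟨⟨by positivity, by nlinarith⟩, hrb⟩ :
      r * s ∈ {s : ℝ | s ∈ Set.Icc (0 : ℝ) 1 ∧ s • z ∈ P.boundary})
    have : 0 < s := lt_of_le_of_ne hs0 hs.symm
    nlinarith

end SimplePolygon

namespace SimplePolygon

variable {P : SimplePolygon}

lemma det2_line_left (p y v : Pt) (s : ℝ) :
    det2 (p + s • (y - p)) v = (1 - s) * det2 p v + s * det2 y v := by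
  rw [det2_add_left, det2_smul_left, det2_sub_left]; ring

lemma det2_line_right (p y v : Pt) (s : ℝ) :
    det2 v (p + s • (y - p)) = (1 - s) * det2 v p + s * det2 v y := by
  rw [det2_add_right, det2_smul_right, det2_sub_right]; ring

/-- Sweeping the triangle spanned by the origin, `x` and the end of the edge containing `x`, one
meets a visible vertex. -/
lemma exists_freeTo_vtx (hg : P.Generic) {i : ℕ} {x : Pt} (hx : x ∈ P.edge i) (hfree : P.FreeTo x)
    (hD : 0 < det2 x (P.vtx (i + 1)))
    (h2 : ∀ j, j % P.n ≠ i % P.n → x ∈ P.edge j → ∀ y ∈ P.edge j,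
      det2 x y ≤ 0 ∧ (det2 x y = 0 → y = x)) :
    ∃ k, P.FreeTo (P.vtx k) ∧ (k % P.n = (i + 1) % P.n ∨
      ∀ j, (j % P.n = (k + 1) % P.n ∨ k % P.n = (j + 1) % P.n) →
        0 < det2 (P.vtx k) (P.vtx j)) := by
  set w := P.vtx (i + 1) with hw
  have h0 : (0 : Pt) ∉ P.boundary := by simpa using hfree 0 le_rfl one_pos
  -- the sweep ends at the vertex of smallest direction
  obtain ⟨k, hk, hmin⟩ := Finset.exists_min_image
    ((Finset.range P.n).filter fun j => 0 ≤ det2 (P.vtx j) w ∧ 0 < det2 x (P.vtx j) ∧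
      det2 (P.vtx j) w + det2 x (P.vtx j) ≤ det2 x w)
    (fun j => det2 x (P.vtx j) / (det2 (P.vtx j) w + det2 x (P.vtx j)))
    ⟨(i + 1) % P.n, by
      rw [Finset.mem_filter, Finset.mem_range, P.vtx_mod, ← hw, det2_self, zero_add]
      exact ⟨Nat.mod_lt _ P.n_pos, le_rfl, hD, le_rfl⟩⟩
  obtain ⟨-, hkA, hkB, hkD⟩ := Finset.mem_filter.1 hk
  set v := P.vtx k with hv
  have plucker : ∀ y, det2 y v * det2 x w = det2 y w * det2 x v - det2 x y * det2 v w := by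
    intro y; simp only [det2]; ring
  have hmin' : ∀ j, 0 ≤ det2 (P.vtx j) w → 0 < det2 x (P.vtx j) →
      det2 (P.vtx j) w + det2 x (P.vtx j) ≤ det2 x w → det2 (P.vtx j) v ≤ 0 := by
    intro j h1 h3 h4
    have h := hmin (j % P.n) (by
      rw [Finset.mem_filter, Finset.mem_range, P.vtx_mod]
      exact ⟨Nat.mod_lt _ P.n_pos, h1, h3, h4⟩)
    simp only [P.vtx_mod] at h
    rw [div_le_div_iff₀ (by linarith) (by linarith)] at h
    have := plucker (P.vtx j)
    by_contra hc
    have := mul_pos (not_le.1 hc) hD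
    nlinarith
  have hα : ∀ y, 0 ≤ det2 x y → 0 ≤ det2 y v → 0 ≤ det2 y w := by
    intro y h1 h3
    have h4 : 0 ≤ det2 y w * det2 x v := by
      have := plucker y
      have h5 := mul_nonneg h3 hD.le
      have h6 := mul_nonneg h1 hkA
      linarith
    exact nonneg_of_mul_nonneg_left h4 hkB
  have hx0 : ∀ y ∈ P.boundary, det2 x y = 0 → 0 ≤ det2 y w → det2 y w ≤ det2 x w → y = x := by
    intro y hy h1 h3 h4
    have e := eq_smul_add_smul hD.ne' y
    rw [h1, zero_div, zero_smul, add_zero] at e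
    have h5 : det2 y w / det2 x w ≤ 1 := by rw [div_le_one hD]; exact h4
    rcases h5.lt_or_eq with h6 | h6
    · rw [e] at hy
      exact absurd hy (hfree _ (by positivity) h6)
    · rw [e, h6, one_smul]
  have hxj : ∀ j, j % P.n ≠ i % P.n → x ∈ P.edge j → ∀ p ∈ P.edge j, 0 ≤ det2 x p → p = x := by
    intro j hj hxj p hp h
    obtain ⟨h3, h4⟩ := h2 j hj hxj p hp
    exact h4 (le_antisymm h3 h)
  have hi : 0 ≤ det2 x (P.vtx i) → x = P.vtx i := by
    intro h
    obtain ⟨t, ht0, ht1, hxt⟩ := mem_segment_iff_param.1 hx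
    rw [← hw] at hxt
    have e1 : det2 x w = (1 - t) * det2 (P.vtx i) w := by
      rw [hxt, det2_line_left, det2_self]; ring
    have e2 : det2 x (P.vtx i) = - (t * det2 (P.vtx i) w) := by
      rw [hxt, det2_line_left, det2_self, det2_swap w]; ring
    have h3 : 0 < det2 (P.vtx i) w := by
      rw [e1] at hD
      by_contra hc
      have := mul_nonneg (sub_nonneg.2 ht1) (neg_nonneg.2 (not_lt.1 hc))
      linarith
    have h4 : t = 0 := by
      rw [e2] at h
      by_contra hne
      have := mul_pos (lt_of_le_of_ne ht0 (Ne.symm hne)) h3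
      linarith
    rw [hxt, h4, zero_smul, add_zero]
  have hseg : ∀ y, 0 ≤ det2 x y → 0 ≤ det2 y w → det2 y w + det2 x y = det2 x w →
      y ∈ P.edge i := by
    intro y h1 h3 h4
    refine (convex_segment _ _).segment_subset hx (P.vtx_succ_mem_edge i) ?_
    refine ⟨det2 y w / det2 x w, det2 x y / det2 x w, by positivity, by positivity, ?_,
      (eq_smul_add_smul hD.ne' y).symm⟩
    rw [← add_div, h4, div_self hD.ne']
  have hline : ∀ p ∈ P.edge i, det2 p w + det2 x p = det2 x w := by
    intro p hp
    obtain ⟨t, -, -, rfl⟩ := mem_segment_iff_param.1 hp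
    obtain ⟨s, -, -, hxs⟩ := mem_segment_iff_param.1 hx
    rw [← hw] at hxs ⊢
    rw [hxs]
    simp only [det2, PiLp.add_apply, PiLp.smul_apply, PiLp.sub_apply, smul_eq_mul]
    ring
  have key : ∀ j, j % P.n ≠ i % P.n → ∀ p ∈ P.edge j, 0 ≤ det2 x p →
      det2 p w + det2 x p ≤ det2 x w → 0 ≤ det2 p v → p = v ∨ p = x := by
    intro j hj p hp hpB hpD hpv
    obtain ⟨l, hl, hlv⟩ : ∃ l, P.vtx l ∈ P.edge j ∧ det2 p v ≤ det2 (P.vtx l) v := by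
      obtain ⟨t, ht0, ht1, hpt⟩ := mem_segment_iff_param.1 hp
      have e := det2_line_left (P.vtx j) (P.vtx (j + 1)) v t
      rw [← hpt] at e
      rcases le_total (det2 (P.vtx j) v) (det2 (P.vtx (j + 1)) v) with h | h
      · exact ⟨j + 1, P.vtx_succ_mem_edge j, by rw [e]; nlinarith⟩
      · exact ⟨j, P.vtx_mem_edge j, by rw [e]; nlinarith⟩
    have hpv' : ∀ y ∈ P.edge j, y = v → det2 p v ≤ 0 → p = v := by
      rintro y hy rfl h
      exact hg.eq_of_mem_edge hp hy (le_antisymm h hpv) (det2_self _)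
    by_cases hT : 0 ≤ det2 x (P.vtx l) ∧ det2 (P.vtx l) w + det2 x (P.vtx l) ≤ det2 x w
    · obtain ⟨hT1, hT2⟩ := hT
      have hlA := hα _ hT1 (hpv.trans hlv)
      rcases hT1.eq_or_lt with hT0 | hT0
      · right
        have := hx0 _ (P.edge_subset_boundary _ hl) hT0.symm hlA (by linarith)
        exact hxj j hj (this ▸ hl) p hp hpB
      · left
        have h3 := hmin' l hlA hT0 hT2
        have h4 : l % P.n = k % P.n := by
          by_contra h; exact hg _ _ h (le_antisymm h3 (hpv.trans hlv))
        exact hpv' _ hl (P.vtx_congr h4) (hlv.trans h3)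
    · obtain ⟨s, ⟨hs0, hs1⟩, hs⟩ : (0 : ℝ) ∈ (fun s : ℝ =>
          min ((1 - s) * det2 x p + s * det2 x (P.vtx l))
            (det2 x w - ((1 - s) * (det2 p w + det2 x p) +
              s * (det2 (P.vtx l) w + det2 x (P.vtx l))))) '' Set.Icc 0 1 := by
        refine intermediate_value_Icc' zero_le_one (by fun_prop) ⟨?_, ?_⟩
        · simp only [sub_self, zero_mul, one_mul, zero_add]
          by_contra hc
          rw [not_le, lt_min_iff] at hc
          exact hT ⟨hc.1.le, by linarith [hc.2]⟩
        · simp only [sub_zero, zero_mul, one_mul, add_zero]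
          exact le_min hpB (by linarith)
      set y := p + s • (P.vtx l - p) with hy
      have hyj : y ∈ P.edge j := (convex_segment _ _).segment_subset hp hl
        (mem_segment_iff_param.2 ⟨s, hs0, hs1, rfl⟩)
      have hpy : det2 p v ≤ det2 y v := by rw [hy, det2_line_left]; nlinarith
      have hyv := hpv.trans hpy
      have e1 : (1 - s) * det2 x p + s * det2 x (P.vtx l) = det2 x y := by
        rw [hy, det2_line_right]
      have e2 : (1 - s) * (det2 p w + det2 x p) +
              s * (det2 (P.vtx l) w + det2 x (P.vtx l)) = det2 y w + det2 x y := by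
        rw [hy, det2_line_right, det2_line_left]; ring
      simp only [e1, e2] at hs
      rcases min_choice (det2 x y) (det2 x w - (det2 y w + det2 x y)) with hc | hc
      · right
        have h3 : det2 x y = 0 := by rw [← hc, hs]
        have h4 : 0 ≤ det2 x w - (det2 y w + det2 x y) := by rw [← hs]; exact min_le_right _ _
        have := hx0 y (P.edge_subset_boundary _ hyj) h3 (hα _ h3.ge hyv) (by linarith)
        exact hxj j hj (this ▸ hyj) p hp hpB
      · have h3 : det2 y w + det2 x y = det2 x w := by rw [hs] at hc; linarith
        have h4 : 0 ≤ det2 x y := by rw [← hs]; exact min_le_left _ _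
        have hyA := hα _ h4 hyv
        rcases P.simple_mod (Ne.symm hj) (hseg y h4 hyA h3) hyj with ⟨h5, h6⟩ | ⟨-, h6⟩
        · left
          have hyw : y = w := h6.trans (P.vtx_congr h5)
          have h7 := hmin' (i + 1) (by rw [← hw, det2_self]) hD (by rw [← hw, det2_self, zero_add])
          rw [← hw, ← hyw] at h7
          have h8 : (i + 1) % P.n = k % P.n := by
            by_contra h; exact hg _ _ h (by rw [← hw, ← hyw]; exact le_antisymm h7 hyv)
          exact hpv' y hyj (hyw.trans (P.vtx_congr h8)) (hpy.trans h7)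
        · right
          have h7 := hi (by rw [← h6]; exact h4)
          exact hxj j hj (by rw [h7, ← h6]; exact hyj) p hp hpB
  have hv0 : v ≠ 0 := hg.ne_zero k
  have hki : k % P.n ≠ i % P.n := by
    intro h
    have h3 := P.vtx_congr h
    have h4 := hi (by rw [← h3]; exact hkB.le)
    rw [hv, h3, ← h4, det2_self] at hkB
    exact lt_irrefl _ hkB
  refine ⟨k, ?_, or_iff_not_imp_left.2 fun hki1 => ?_⟩
  · intro t ht0 ht1 htb
    rw [← hv] at htb
    obtain ⟨j, hj⟩ := P.mem_boundary.1 htb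
    have eB : det2 x (t • v) = t * det2 x v := det2_smul_right _ _ _
    have eA : det2 (t • v) w = t * det2 v w := det2_smul_left _ _ _
    by_cases hji : j % P.n = i % P.n
    · rw [P.edge_congr hji] at hj
      have := hline _ hj
      rw [eA, eB] at this
      nlinarith
    · rcases key j hji _ hj (by rw [eB]; positivity) (by rw [eA, eB]; nlinarith)
        (by rw [det2_smul_left, det2_self, mul_zero]) with h | h
      · have : (1 - t) • v = 0 := by rw [sub_smul, one_smul, h, sub_self]
        rcases smul_eq_zero.1 this with h3 | h3
        · linarith
        · exact hv0 h3
      · rw [h, det2_self] at eB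
        have ht : t = 0 := by
          rcases mul_eq_zero.1 eB.symm with h3 | h3
          · exact h3
          · exact absurd h3 hkB.ne'
        rw [ht, zero_smul] at htb
        exact h0 htb
  · intro j hj
    obtain ⟨e, he, hve, hje, hjk⟩ : ∃ e, e % P.n ≠ i % P.n ∧ v ∈ P.edge e ∧ P.vtx j ∈ P.edge e ∧
        k % P.n ≠ j % P.n := by
      rcases hj with h | h
      · exact ⟨k, hki, P.vtx_mem_edge k, by rw [P.vtx_congr h]; exact P.vtx_succ_mem_edge k,
          by rw [h]; exact (P.succ_mod_ne k).symm⟩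
      · refine ⟨j, fun hji => hki1 (h.trans (succ_mod_congr hji)), ?_, P.vtx_mem_edge j,
          by rw [h]; exact P.succ_mod_ne j⟩
        rw [hv, P.vtx_congr h]; exact P.vtx_succ_mem_edge j
    by_contra hneg
    have hneg' : 0 < det2 (P.vtx j) v := by
      rw [det2_swap]
      have := lt_of_le_of_ne (not_lt.1 hneg) (hg _ _ hjk)
      rw [← hv] at this; linarith
    have hkD' : det2 v w + det2 x v < det2 x w := by
      refine lt_of_le_of_ne hkD fun h => ?_
      rcases P.simple_mod (Ne.symm he) (hseg v hkB.le hkA h) hve with ⟨h3, h4⟩ | ⟨-, h4⟩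
      · exact hki1 ((P.vtx_eq_iff.1 h4).trans h3)
      · exact hki (P.vtx_eq_iff.1 h4)
    have hc1 : ∀ᶠ s in nhdsWithin (0 : ℝ) (Set.Ioi 0),
        0 < (1 - s) * det2 x v + s * det2 x (P.vtx j) := by
      have : ContinuousAt (fun s : ℝ => (1 - s) * det2 x v + s * det2 x (P.vtx j)) 0 := by fun_prop
      exact (this.eventually_const_lt (by simpa using hkB)).filter_mono nhdsWithin_le_nhds
    have hc2 : ∀ᶠ s in nhdsWithin (0 : ℝ) (Set.Ioi 0),
        (1 - s) * (det2 v w + det2 x v) + s * (det2 (P.vtx j) w + det2 x (P.vtx j)) <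
          det2 x w := by
      have : ContinuousAt (fun s : ℝ => (1 - s) * (det2 v w + det2 x v) +
        s * (det2 (P.vtx j) w + det2 x (P.vtx j))) 0 := by fun_prop
      exact (this.eventually_lt_const (by simpa using hkD')).filter_mono nhdsWithin_le_nhds
    obtain ⟨s, ⟨hs1, hs2⟩, hs0, hs3⟩ :=
      ((hc1.and hc2).and (Ioo_mem_nhdsGT (zero_lt_one (α := ℝ)))).exists
    have e1 := det2_line_right v (P.vtx j) x s
    have e2 : det2 (v + s • (P.vtx j - v)) v = s * det2 (P.vtx j) v := by
      rw [det2_line_left, det2_self]; ring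
    have h3 := mul_pos hs0 hneg'
    rcases key e he (v + s • (P.vtx j - v))
      ((convex_segment _ _).segment_subset hve hje
        (mem_segment_iff_param.2 ⟨s, hs0.le, hs3.le, rfl⟩))
      (by rw [e1]; exact hs1.le) (by rw [e1, det2_line_left]; linarith)
      (by rw [e2]; exact h3.le) with h | h
    · rw [h, det2_self] at e2; linarith
    · rw [h, det2_self] at e1; linarith

end SimplePolygon

lemma dot2_lt_of_norm_le {u a : Pt} (h : ‖a‖ ≤ ‖u‖) (hd : det2 u a ≠ 0) :
    dot2 u a < dot2 u u := by
  have h1 : dot2 a a ≤ dot2 u u := by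
    have := mul_self_le_mul_self (norm_nonneg a) h
    rw [← sq, ← sq, EuclideanSpace.norm_sq_eq, EuclideanSpace.norm_sq_eq] at this
    simpa [Fin.sum_univ_two, dot2, sq] using this
  have h2 : 0 < dot2 (u - a) (u - a) := dot2_self_pos (by
    intro h
    rw [sub_eq_zero.1 h, det2_self] at hd
    exact hd rfl)
  simp only [dot2, PiLp.sub_apply] at *
  nlinarith

lemma det2_pos_of_norm_le {a u b : Pt} (ha : ‖a‖ ≤ ‖u‖) (hb : ‖b‖ ≤ ‖u‖) (hau : 0 < det2 a u)
    (hub : 0 < det2 u b) : 0 < det2 (u - a) (b - u) := by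
  have hu : u ≠ 0 := by rintro rfl; rw [det2_zero_left] at hub; exact lt_irrefl _ hub
  have h1 := dot2_lt_of_norm_le ha (by rw [det2_swap]; linarith)
  have h2 := dot2_lt_of_norm_le hb hub.ne'
  have h3 := dot2_self_pos hu
  have e : dot2 u u * det2 (u - a) (b - u) =
      (dot2 u u - dot2 u a) * det2 u b + det2 a u * (dot2 u u - dot2 u b) := by
    simp only [det2, dot2, PiLp.sub_apply]; ring
  have h4 := mul_pos (sub_pos.2 h1) hub
  have h5 := mul_pos hau (sub_pos.2 h2)
  exact pos_of_mul_pos_right (e ▸ add_pos h4 h5) h3.le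

namespace SimplePolygon

variable {P : SimplePolygon}

/-- A polygon that winds around the origin has a visible vertex at which the boundary turns
suitably. -/
lemma exists_good_vtx (hccw : P.CCW) (hg : P.Generic) (h0 : (0 : Pt) ∉ P.boundary)
    (hw : P.wind 0 = 1) :
    ∃ k, P.FreeTo (P.vtx (k + 1)) ∧
      ((0 < det2 (P.vtx (k + 1)) (P.vtx (k + 2)) ∧
        (det2 (P.vtx k) (P.vtx (k + 1)) < 0 ∨ 0 < det2 (P.vtx k) (P.vtx (k + 1)) ∧
          0 < det2 (P.vtx (k + 1) - P.vtx k) (P.vtx (k + 2) - P.vtx (k + 1)))) ∨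
      (0 < det2 (P.vtx k) (P.vtx (k + 1)) ∧ det2 (P.vtx (k + 1)) (P.vtx (k + 2)) < 0)) := by
  by_contra hno
  have hB : ∀ k, P.FreeTo (P.vtx k) → ¬ ∀ j, (j % P.n = (k + 1) % P.n ∨ k % P.n = (j + 1) % P.n) →
        0 < det2 (P.vtx k) (P.vtx j) := by
    intro k hf hj
    obtain ⟨l, hl⟩ := P.exists_mod_eq_succ k
    have e := P.vtx_congr hl
    refine hno ⟨l, e ▸ hf, Or.inl ⟨?_, Or.inl ?_⟩⟩
    · rw [← e]
      exact hj (l + 2) (Or.inl (succ_mod_congr hl.symm))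
    · have := hj l (Or.inr hl)
      rw [det2_swap, ← e]; linarith
  have hstep : ∀ m, P.FreeTo (P.vtx (m + 1)) → 0 < det2 (P.vtx m) (P.vtx (m + 1)) →
      P.FreeTo (P.vtx (m + 2)) ∧ 0 < det2 (P.vtx (m + 1)) (P.vtx (m + 2)) := by
    intro m hf hd
    have hd' : 0 < det2 (P.vtx (m + 1)) (P.vtx (m + 2)) := by
      refine lt_of_le_of_ne (not_lt.1 fun h => hno ⟨m, hf, Or.inr ⟨hd, h⟩⟩) (Ne.symm ?_)
      exact hg _ _ (P.succ_mod_ne (m + 1)).symm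
    refine ⟨?_, hd'⟩
    obtain ⟨k, hk, h | h⟩ := exists_freeTo_vtx hg (P.vtx_mem_edge (m + 1)) hf hd' (by
      intro j hj hxj y hy
      rcases P.simple_mod hj hxj (P.vtx_mem_edge (m + 1)) with ⟨h, -⟩ | ⟨-, h⟩
      · rw [P.edge_congr (succ_mod_cancel h).symm] at hy
        obtain ⟨t, ht0, ht1, rfl⟩ := mem_segment_iff_param.1 hy
        have e : det2 (P.vtx (m + 1)) (P.vtx m + t • (P.vtx (m + 1) - P.vtx m)) =
            - ((1 - t) * det2 (P.vtx m) (P.vtx (m + 1))) := by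
          rw [det2_line_right, det2_self, det2_swap (P.vtx (m + 1))]; ring
        rw [e]
        refine ⟨neg_nonpos.2 (mul_nonneg (by linarith) hd.le), fun h => ?_⟩
        have ht : t = 1 := by
          rcases mul_eq_zero.1 (neg_eq_zero.1 h) with h | h
          · linarith
          · exact absurd h hd.ne'
        rw [ht, one_smul]; abel
      · exact absurd (P.vtx_eq_iff.1 h).symm hj)
    · exact P.vtx_congr h ▸ hk
    · exact absurd h (hB k hk)
  obtain ⟨i, x, hx, hxv, hxf⟩ := exists_freeTo hg h0
  have hi := hxf.det2_pos hccw hw hx (hxv _) (hxv _)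
  have hxi : 0 < det2 x (P.vtx (i + 1)) := by
    obtain ⟨t, ht0, ht1, hxt⟩ := mem_segment_iff_param.1 hx
    have e := det2_line_left (P.vtx i) (P.vtx (i + 1)) (P.vtx (i + 1)) t
    rw [← hxt, det2_self, mul_zero, add_zero] at e
    have : t ≠ 1 := by
      rintro rfl
      refine hxv (i + 1) ?_
      rw [hxt, one_smul]; abel
    rw [e]
    exact mul_pos (sub_pos.2 (lt_of_le_of_ne ht1 this)) hi
  have hfi : P.FreeTo (P.vtx (i + 1)) := by
    obtain ⟨k, hk, h | h⟩ := exists_freeTo_vtx hg hx hxf hxi (by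
      intro j hj hxj y hy
      rcases P.simple_mod hj hxj hx with ⟨-, h⟩ | ⟨-, h⟩
      · exact absurd h (hxv _)
      · exact absurd h (hxv _))
    · exact P.vtx_congr h ▸ hk
    · exact absurd h (hB k hk)
  have hall : ∀ m, P.FreeTo (P.vtx (i + m + 1)) ∧ 0 < det2 (P.vtx (i + m)) (P.vtx (i + m + 1)) := by
    intro m
    induction m with
    | zero => exact ⟨hfi, hi⟩
    | succ m ih => exact hstep _ ih.1 ih.2
  obtain ⟨k, -, hk⟩ := Finset.exists_max_image (Finset.range P.n) (fun j => ‖P.vtx j‖)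
    ⟨0, Finset.mem_range.2 P.n_pos⟩
  have hk' : ∀ j, ‖P.vtx j‖ ≤ ‖P.vtx k‖ := by
    intro j
    rw [← P.vtx_mod j]
    exact hk _ (Finset.mem_range.2 (Nat.mod_lt _ P.n_pos))
  obtain ⟨l, hl⟩ := P.exists_mod_eq_succ k
  obtain ⟨m, hm⟩ : ∃ m, l + i * P.n = i + m := by
    refine Nat.exists_eq_add_of_le ?_
    have := Nat.mul_le_mul_left i P.n_pos
    omega
  have e : P.vtx (i + m + 1) = P.vtx k := by
    apply P.vtx_congr
    rw [← hm, hl, show l + i * P.n + 1 = l + 1 + i * P.n by ring, Nat.add_mul_mod_self_right]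
  obtain ⟨h1, h2⟩ := hall m
  have h3 := (hall (m + 1)).2
  refine hno ⟨i + m, h1, Or.inl ⟨h3, Or.inr ⟨h2, ?_⟩⟩⟩
  exact det2_pos_of_norm_le (by rw [e]; exact hk' _) (by rw [e]; exact hk' _) h2 h3

end SimplePolygon

/-! ### Cutting a notch -/

lemma exists_convex_nhds_segment (u : Pt) {K : Set Pt} (hK : IsClosed K)
    (h : Disjoint (segment ℝ 0 u) K) :
    ∃ U : Set Pt, IsOpen U ∧ Convex ℝ U ∧ segment ℝ 0 u ⊆ U ∧ Disjoint U K := by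
  have hc : IsCompact (segment ℝ 0 u) := by
    rw [← convexHull_pair]
    exact Set.Finite.isCompact_convexHull ℝ (by simp)
  obtain ⟨δ, hδ, hd⟩ := h.exists_thickenings hc hK
  exact ⟨Metric.thickening δ (segment ℝ 0 u), Metric.isOpen_thickening,
    (convex_segment _ _).thickening δ, Metric.self_subset_thickening hδ _,
    hd.mono_right (Metric.self_subset_thickening hδ _)⟩

/-- A point close to `u` in direction `f`. -/
def notchBase (u f : Pt) (ε : ℝ) : Pt := u + ε • f

/-- A point just beyond the origin as seen from `u` and `notchBase u f ε`. -/
def notchTip (u f : Pt) (ε : ℝ) : Pt := -(ε • (u + notchBase u f ε))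

lemma continuous_notchBase (u f : Pt) : Continuous (notchBase u f) := by
  unfold notchBase; fun_prop

lemma continuous_notchTip (u f : Pt) : Continuous (notchTip u f) := by
  unfold notchTip notchBase; fun_prop

lemma notchBase_zero (u f : Pt) : notchBase u f 0 = u := by simp [notchBase]

lemma notchTip_zero (u f : Pt) : notchTip u f 0 = 0 := by simp [notchTip]

lemma det2_notchBase (u f : Pt) (ε : ℝ) : det2 u (notchBase u f ε) = ε * det2 u f := by
  rw [notchBase, det2_add_right, det2_self, det2_smul_right, zero_add]

lemma det2_notchTip (u f : Pt) (ε : ℝ) : det2 (notchTip u f ε) u = ε ^ 2 * det2 u f := by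
  simp only [notchTip, notchBase, det2, PiLp.neg_apply, PiLp.smul_apply, PiLp.add_apply,
    smul_eq_mul]
  ring

lemma det2_notchBase_notchTip (u f : Pt) (ε : ℝ) :
    det2 (notchBase u f ε) (notchTip u f ε) = ε ^ 2 * det2 u f := by
  simp only [notchTip, notchBase, det2, PiLp.neg_apply, PiLp.smul_apply, PiLp.add_apply,
    smul_eq_mul]
  ring

lemma det2_notchTip_sub (u f : Pt) (ε : ℝ) :
    det2 f (notchTip u f ε - u) = (1 + 2 * ε) * det2 u f := by
  simp only [notchTip, notchBase, det2, PiLp.neg_apply, PiLp.smul_apply, PiLp.add_apply,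
    PiLp.sub_apply, smul_eq_mul]
  ring

lemma notchBase_mem_segment (u v : Pt) {ε : ℝ} (h0 : 0 ≤ ε) (h1 : ε ≤ 1) :
    notchBase u (v - u) ε ∈ segment ℝ u v := mem_segment_iff_param.2 ⟨ε, h0, h1, rfl⟩

lemma mem_cone_of_mem_triangle {u f w p : Pt} {ε : ℝ} (hε : 0 ≤ ε)
    (hp : p ∈ convexHull ℝ {u, notchBase u f ε, w}) :
    ∃ a c : ℝ, 0 ≤ a ∧ 0 ≤ c ∧ p - u = a • f + c • (w - u) := by
  rw [convexHull_insert (by simp), convexHull_pair, mem_convexJoin] at hp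
  obtain ⟨x, hx, y, hy, hp⟩ := hp
  rw [Set.mem_singleton_iff] at hx
  subst hx
  obtain ⟨s, hs0, hs1, rfl⟩ := mem_segment_iff_param.1 hy
  obtain ⟨t, ht0, ht1, rfl⟩ := mem_segment_iff_param.1 hp
  refine ⟨t * (1 - s) * ε, t * s,
    mul_nonneg (mul_nonneg ht0 (by linarith)) hε, mul_nonneg ht0 hs0, ?_⟩
  unfold notchBase
  module

lemma eq_zero_of_cone {σ : ℝ} {f g d : Pt} (hfg : 0 < σ * det2 f g)
    (h : σ * det2 f d < 0 ∨ 0 < σ * det2 g d) {a c s : ℝ} (ha : 0 ≤ a) (hc : 0 ≤ c) (hs : 0 ≤ s)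
    (e : a • f + c • g = s • d) : s • d = 0 := by
  have hs0 : s = 0 := by
    rcases h with h | h
    · have e1 : c * (σ * det2 f g) = s * (σ * det2 f d) := by
        have := congrArg (det2 f) e
        rw [det2_add_right, det2_smul_right, det2_smul_right, det2_smul_right, det2_self] at this
        linear_combination σ * this
      have := mul_nonneg hc hfg.le
      by_contra hne
      have := mul_neg_of_pos_of_neg (lt_of_le_of_ne hs (Ne.symm hne)) h
      linarith
    · have e1 : -(a * (σ * det2 f g)) = s * (σ * det2 g d) := by
        have := congrArg (det2 g) e
        rw [det2_add_right, det2_smul_right, det2_smul_right, det2_smul_right, det2_self,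
          det2_swap g f] at this
        linear_combination σ * this
      have := mul_nonneg ha hfg.le
      by_contra hne
      have := mul_pos (lt_of_le_of_ne hs (Ne.symm hne)) h
      linarith
  rw [hs0, zero_smul]

lemma eventually_notch {σ : ℝ} {u f d : Pt} {K : Set Pt} (hK : IsClosed K)
    (hd : Disjoint (segment ℝ 0 u) K) (hf : 0 < σ * det2 u f)
    (h : σ * det2 f d < 0 ∨ 0 < σ * det2 d u) :
    ∀ᶠ ε in nhdsWithin (0 : ℝ) (Set.Ioi 0),
      Disjoint (convexHull ℝ {u, notchBase u f ε, notchTip u f ε}) K ∧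
      ∀ p ∈ convexHull ℝ {u, notchBase u f ε, notchTip u f ε}, p ∈ segment ℝ u (u + d) →
        p = u := by
  obtain ⟨U, hU, hUc, hsU, hUK⟩ := exists_convex_nhds_segment u hK hd
  have hu : u ∈ U := hsU (right_mem_segment ℝ _ _)
  have h1 : ∀ᶠ ε in nhdsWithin (0 : ℝ) (Set.Ioi 0), notchBase u f ε ∈ U :=
    ((continuous_notchBase u f).continuousAt.eventually
      (hU.mem_nhds (by rwa [notchBase_zero]))).filter_mono nhdsWithin_le_nhds
  have h2 : ∀ᶠ ε in nhdsWithin (0 : ℝ) (Set.Ioi 0), notchTip u f ε ∈ U :=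
    ((continuous_notchTip u f).continuousAt.eventually
      (hU.mem_nhds (by rw [notchTip_zero]; exact hsU (left_mem_segment ℝ _ _)))).filter_mono
      nhdsWithin_le_nhds
  have h3 : ∀ᶠ ε in nhdsWithin (0 : ℝ) (Set.Ioi 0),
      σ * det2 f d < 0 ∨ 0 < σ * det2 (notchTip u f ε - u) d := by
    rcases h with h | h
    · exact Filter.Eventually.of_forall fun _ => Or.inl h
    · have hc : Continuous fun ε : ℝ => σ * det2 (notchTip u f ε - u) d :=
        continuous_const.mul (continuous_det2.comp
          (((continuous_notchTip u f).sub continuous_const).prodMk continuous_const))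
      have h0 : 0 < σ * det2 (notchTip u f 0 - u) d := by
        rw [notchTip_zero, det2_sub_left, det2_zero_left, zero_sub, ← det2_swap]; exact h
      exact ((hc.continuousAt.eventually_const_lt h0).filter_mono nhdsWithin_le_nhds).mono
        fun _ => Or.inr
  filter_upwards [h1, h2, h3, self_mem_nhdsWithin] with ε h1 h2 h3 hε
  rw [Set.mem_Ioi] at hε
  have hsub : convexHull ℝ {u, notchBase u f ε, notchTip u f ε} ⊆ U := by
    refine convexHull_min ?_ hUc
    rintro x (rfl | rfl | rfl) <;> assumption
  refine ⟨hUK.mono_left hsub, fun p hp hpd => ?_⟩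
  obtain ⟨a, c, ha, hc, e⟩ := mem_cone_of_mem_triangle hε.le hp
  obtain ⟨s, hs, -, rfl⟩ := mem_segment_iff_param.1 hpd
  rw [add_sub_cancel_left, add_sub_cancel_left] at e
  rw [add_sub_cancel_left, eq_zero_of_cone (σ := σ) ?_ h3 ha hc hs e.symm, add_zero]
  rw [det2_notchTip_sub]
  have : 0 < (1 + 2 * ε) * (σ * det2 u f) := mul_pos (by linarith) hf
  linarith

lemma eq_left_of_det2 {a b p z : Pt} (hp : p ∈ segment ℝ a b) (h : det2 z (p - a) = 0)
    (hz : det2 z (b - a) ≠ 0) : p = a := by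
  obtain ⟨t, -, -, rfl⟩ := mem_segment_iff_param.1 hp
  rw [add_sub_cancel_left, det2_smul_right] at h
  rw [(mul_eq_zero.1 h).resolve_right hz, zero_smul, add_zero]

section Tip

variable {u v w p : Pt} {ε : ℝ}

lemma notch_first_second (hε : 0 < ε) (hw : det2 (v - u) (w - u) ≠ 0)
    (hp : p ∈ segment ℝ u w)
    (hp' : p ∈ segment ℝ w (notchBase u (v - u) ε)) : p = w := by
  have h := det2_eq_zero_of_mem_segment hp
  refine eq_left_of_det2 (z := w - u) hp' ?_ ?_
  · rw [show p - w = (p - u) - (w - u) by abel, det2_sub_right, h, det2_self, sub_zero]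
  · rw [show notchBase u (v - u) ε - w = ε • (v - u) - (w - u) by unfold notchBase; abel,
      det2_sub_right, det2_smul_right, det2_self, sub_zero, det2_swap]
    exact mul_ne_zero hε.ne' (neg_ne_zero.2 hw)

lemma notch_vertex_notMem (hε : 0 < ε) (hw : det2 (v - u) (w - u) ≠ 0) :
    u ∉ segment ℝ w (notchBase u (v - u) ε) := by
  intro h
  have := notch_first_second hε hw (left_mem_segment ℝ u w) h
  rw [← this, sub_self, det2_zero_right] at hw
  exact hw rfl

lemma notch_base_side (hε : 0 < ε) (hw : det2 (v - u) (w - u) ≠ 0)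
    (hε1 : ε < 1) (hp : p ∈ segment ℝ (notchBase u (v - u) ε) v) :
    p ≠ u ∧ det2 (v - u) (p - u) = 0 := by
  obtain ⟨t, ht0, ht1, rfl⟩ := mem_segment_iff_param.1 hp
  have e : notchBase u (v - u) ε + t • (v - notchBase u (v - u) ε) - u =
      (ε + t * (1 - ε)) • (v - u) := by unfold notchBase; module
  refine ⟨fun h => ?_, by rw [e, det2_smul_right, det2_self, mul_zero]⟩
  rw [← sub_eq_zero, e, smul_eq_zero] at h
  rcases h with h | h
  · have := mul_nonneg ht0 (sub_nonneg.2 hε1.le)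
    linarith
  · rw [h, det2_zero_left] at hw; exact hw rfl

lemma notch_first_third (hε : 0 < ε) (hw : det2 (v - u) (w - u) ≠ 0)
    (hε1 : ε < 1) (hp : p ∈ segment ℝ u w) :
    p ∉ segment ℝ (notchBase u (v - u) ε) v := by
  intro h
  obtain ⟨h1, h2⟩ := notch_base_side hε hw hε1 h
  exact h1 (eq_left_of_det2 hp h2 hw)

lemma notch_second_third (hε : 0 < ε) (hw : det2 (v - u) (w - u) ≠ 0)
    (hε1 : ε < 1) (hp : p ∈ segment ℝ w (notchBase u (v - u) ε))
    (hp' : p ∈ segment ℝ (notchBase u (v - u) ε) v) : p = notchBase u (v - u) ε := by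
  obtain ⟨-, h⟩ := notch_base_side hε hw hε1 hp'
  rw [segment_symm] at hp
  refine eq_left_of_det2 (z := v - u) hp ?_ ?_
  · rw [show p - notchBase u (v - u) ε = (p - u) - ε • (v - u) by unfold notchBase; abel,
      det2_sub_right, h, det2_smul_right, det2_self, mul_zero, sub_zero]
  · rw [show w - notchBase u (v - u) ε = (w - u) - ε • (v - u) by unfold notchBase; abel,
      det2_sub_right, det2_smul_right, det2_self, mul_zero, sub_zero]
    exact hw

end Tip

lemma ang_add {p u v b : Pt} (hb : b ∈ segment ℝ u v) (hp : p ∉ segment ℝ u v) :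
    ang p u b + ang p b v = ang p u v := by
  have hsub : convexHull ℝ {u, b, v} ⊆ segment ℝ u v := by
    refine convexHull_min ?_ (convex_segment _ _)
    rintro x (rfl | rfl | rfl)
    · exact left_mem_segment ℝ _ _
    · exact hb
    · exact right_mem_segment ℝ _ _
  have h := windT_eq_zero fun h => hp (hsub h)
  unfold windT at h
  rw [div_eq_zero_iff, or_iff_left (by positivity), ang_swap hp] at h
  linarith

lemma ang_notch {p u v b w : Pt} (hb : b ∈ segment ℝ u v) (hp : p ∉ segment ℝ u v)
    (h1 : p ∉ segment ℝ u w) (h2 : p ∉ segment ℝ w b) :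
    (ang p u w + ang p w b + ang p b v - ang p u v) / (2 * Real.pi) = - windT u b w p := by
  have e1 := ang_swap h1
  have e2 := ang_swap h2
  rw [← ang_add hb hp, windT, e1, e2]
  ring

lemma ang_notch' {p u v b w : Pt} (hb : b ∈ segment ℝ u v) (hp : p ∉ segment ℝ u v)
    (h1 : p ∉ segment ℝ u w) (h2 : p ∉ segment ℝ w b) :
    (ang p v b + ang p b w + ang p w u - ang p v u) / (2 * Real.pi) = - windT b u w p := by
  have e1 := ang_swap h1
  rw [segment_symm] at h2 hb hp
  have e2 := ang_swap h2
  rw [← ang_add hb hp, windT, e1, e2]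
  ring

namespace SimplePolygon

variable {P : SimplePolygon}

variable (P) in
/-- The union of the edges that do not contain `u`. -/
def far (u : Pt) : Set Pt := ⋃ j ∈ (Finset.range P.n).filter fun j => u ∉ P.edge j, P.edge j

lemma isClosed_far (u : Pt) : IsClosed (P.far u) := by
  unfold far
  exact (Finset.finite_toSet _).isClosed_biUnion fun j _ => P.isClosed_edge j

lemma mem_far {u p : Pt} {j : ℕ} (hu : u ∉ P.edge j) (hp : p ∈ P.edge j) : p ∈ P.far u := by
  simp only [far, Set.mem_iUnion, Finset.mem_filter, Finset.mem_range]
  exact ⟨j % P.n, ⟨Nat.mod_lt _ P.n_pos, by rwa [P.edge_mod]⟩, by rwa [P.edge_mod]⟩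

lemma exists_of_mem_far {u p : Pt} (hp : p ∈ P.far u) : ∃ j, u ∉ P.edge j ∧ p ∈ P.edge j := by
  simp only [far, Set.mem_iUnion, Finset.mem_filter] at hp
  obtain ⟨j, ⟨-, h1⟩, h2⟩ := hp
  exact ⟨j, h1, h2⟩

lemma mem_far_or {k j : ℕ} {p : Pt} (hp : p ∈ P.edge j) :
    p ∈ P.far (P.vtx (k + 1)) ∨ j % P.n = k % P.n ∨ j % P.n = (k + 1) % P.n := by
  by_cases hu : P.vtx (k + 1) ∈ P.edge j
  · right
    by_contra! hne
    rcases P.simple_mod hne.2 hu (P.vtx_mem_edge (k + 1)) with ⟨h, -⟩ | ⟨-, h⟩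
    · exact hne.1 (succ_mod_cancel h).symm
    · exact hne.2 (P.vtx_eq_iff.1 h).symm
  · exact Or.inl (mem_far hu hp)

lemma FreeTo.disjoint_far {u : Pt} (h : P.FreeTo u) : Disjoint (segment ℝ 0 u) (P.far u) := by
  rw [Set.disjoint_left]
  intro p hp hpf
  obtain ⟨j, hu, hpj⟩ := exists_of_mem_far hpf
  obtain ⟨t, ht0, ht1, rfl⟩ := mem_segment_iff_param.1 hp
  simp only [sub_zero, zero_add] at hpj
  rcases ht1.lt_or_eq with h1 | h1
  · exact h t ht0 h1 (P.edge_subset_boundary j hpj)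
  · rw [h1, one_smul] at hpj; exact hu hpj

lemma FreeTo.exists_near {σ : ℝ} {u d f : Pt} (h : P.FreeTo u)
    (hb : ∀ p ∈ P.boundary, p ∈ P.far u ∨ p ∈ segment ℝ u (u + d) ∨ p ∈ segment ℝ u (u + f))
    (hd : 0 < σ * det2 u d) (hf : 0 ≤ σ * det2 f d) :
    ∃ s : ℝ, 0 < s ∧ s < 1 ∧ P.FreeTo (u + s • d) := by
  obtain ⟨U, hU, hUc, hsU, hUK⟩ := exists_convex_nhds_segment u (isClosed_far u) h.disjoint_far
  have h1 : ∀ᶠ s in nhdsWithin (0 : ℝ) (Set.Ioi 0), u + s • d ∈ U :=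
    ((show Continuous fun s : ℝ => u + s • d by fun_prop).continuousAt.eventually
      (hU.mem_nhds (by simpa using hsU (right_mem_segment ℝ _ _)))).filter_mono nhdsWithin_le_nhds
  obtain ⟨s, hsu, hs0, hs1⟩ := (h1.and (Ioo_mem_nhdsGT (zero_lt_one (α := ℝ)))).exists
  refine ⟨s, hs0, hs1, fun t ht0 ht1 htb => ?_⟩
  have hneg : (t - 1) * (σ * det2 u d) < 0 := mul_neg_of_neg_of_pos (by linarith) hd
  rcases hb _ htb with hp | hp | hp
  · refine Set.disjoint_left.1 hUK ?_ hp
    refine hUc.segment_subset (hsU (left_mem_segment ℝ _ _)) hsu ?_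
    exact mem_segment_iff_param.2 ⟨t, ht0, ht1.le, by simp⟩
  · obtain ⟨r, -, -, e⟩ := mem_segment_iff_param.1 hp
    rw [add_sub_cancel_left] at e
    have e' := congrArg (fun y => det2 y d) e
    simp only [smul_add, det2_add_left, det2_smul_left, det2_self, mul_zero, add_zero] at e'
    have : (t - 1) * (σ * det2 u d) = 0 := by linear_combination σ * e'
    linarith
  · obtain ⟨r, hr, -, e⟩ := mem_segment_iff_param.1 hp
    rw [add_sub_cancel_left] at e
    have e' := congrArg (fun y => det2 y d) e
    simp only [smul_add, det2_add_left, det2_smul_left, det2_self, mul_zero, add_zero] at e'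
    have : (t - 1) * (σ * det2 u d) = r * (σ * det2 f d) := by linear_combination σ * e'
    have := mul_nonneg hr hf
    linarith

lemma mem_far_or_segment (k : ℕ) {p : Pt} (hp : p ∈ P.boundary) :
    p ∈ P.far (P.vtx (k + 1)) ∨ p ∈ segment ℝ (P.vtx (k + 1)) (P.vtx k) ∨
      p ∈ segment ℝ (P.vtx (k + 1)) (P.vtx (k + 2)) := by
  obtain ⟨j, hj⟩ := P.mem_boundary.1 hp
  rcases mem_far_or (k := k) hj with h | h | h
  · exact Or.inl h
  · rw [P.edge_congr h, edge, segment_symm] at hj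
    exact Or.inr (Or.inl hj)
  · rw [P.edge_congr h] at hj
    exact Or.inr (Or.inr hj)

/-- At a visible vertex whose incident edges are on the same side, the edge facing the origin
the wrong way is hidden by the other one. -/
lemma FreeTo.det2_neg (hccw : P.CCW) (hw : P.wind 0 = 1) {k : ℕ} (h : P.FreeTo (P.vtx (k + 1)))
    (hD : (det2 (P.vtx k) (P.vtx (k + 1)) < 0 ∧ 0 < det2 (P.vtx (k + 1)) (P.vtx (k + 2))) ∨
      (0 < det2 (P.vtx k) (P.vtx (k + 1)) ∧ det2 (P.vtx (k + 1)) (P.vtx (k + 2)) < 0)) :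
    det2 (P.vtx (k + 2) - P.vtx (k + 1)) (P.vtx k - P.vtx (k + 1)) < 0 := by
  by_contra hneg
  rw [not_lt] at hneg
  have hinc : ∀ {a b : Pt} {s : ℝ}, a ≠ b → 0 < s → s < 1 → a + s • (b - a) ≠ a ∧
      a + s • (b - a) ≠ b := by
    intro a b s hab hs0 hs1
    constructor
    · intro h
      rw [add_eq_left, smul_eq_zero, sub_eq_zero] at h
      rcases h with h | h
      · exact hs0.ne' h
      · exact hab h.symm
    · intro h
      have : (1 - s) • (b - a) = 0 := by
        rw [sub_smul, one_smul, sub_eq_zero, ← sub_eq_iff_eq_add'.2 h.symm]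
      rw [smul_eq_zero, sub_eq_zero (a := b)] at this
      rcases this with h | h
      · linarith
      · exact hab h.symm
  rcases hD with ⟨h1, h2⟩ | ⟨h1, h2⟩
  · obtain ⟨s, hs0, hs1, hs⟩ := h.exists_near (σ := 1) (d := P.vtx k - P.vtx (k + 1))
      (f := P.vtx (k + 2) - P.vtx (k + 1))
      (fun p hp => by simpa using mem_far_or_segment k hp)
      (by rw [one_mul, det2_sub_right, det2_self, det2_swap]; linarith) (by rwa [one_mul])
    obtain ⟨h3, h4⟩ := hinc (P.vtx_succ_ne k) hs0 hs1
    have h5 : P.vtx (k + 1) + s • (P.vtx k - P.vtx (k + 1)) ∈ P.edge k := by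
      rw [edge, segment_symm]
      exact mem_segment_iff_param.2 ⟨s, hs0.le, hs1.le, rfl⟩
    have := hs.det2_pos hccw hw h5 h4 h3
    linarith
  · obtain ⟨s, hs0, hs1, hs⟩ := h.exists_near (σ := -1) (d := P.vtx (k + 2) - P.vtx (k + 1))
      (f := P.vtx k - P.vtx (k + 1))
      (fun p hp => by
        have := mem_far_or_segment k hp
        simp only [add_sub_cancel]
        tauto)
      (by rw [det2_sub_right, det2_self]; linarith) (by rw [det2_swap]; linarith)
    obtain ⟨h3, h4⟩ := hinc (P.vtx_succ_ne (k + 1)).symm hs0 hs1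
    have h5 : P.vtx (k + 1) + s • (P.vtx (k + 2) - P.vtx (k + 1)) ∈ P.edge (k + 1) :=
      mem_segment_iff_param.2 ⟨s, hs0.le, hs1.le, rfl⟩
    have := hs.det2_pos hccw hw h5 h3 h4
    change 0 < det2 (P.vtx (k + 1)) (P.vtx (k + 2)) at this
    linarith

end SimplePolygon

lemma zero_notMem_segment {a b : Pt} (h : det2 a b ≠ 0) : (0 : Pt) ∉ segment ℝ a b := by
  intro h0
  have := det2_eq_zero_of_mem_segment h0
  rw [det2_sub_left, det2_sub_right, det2_sub_right, det2_self, det2_zero_right, det2_zero_right,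
    det2_swap b a] at this
  apply h
  linarith

lemma leftTurn_le_one (a b c : Pt) : leftTurn a b c ≤ 1 := by
  unfold leftTurn; split_ifs <;> simp

lemma leftTurn_eq_one {a b c : Pt} (h : 0 < det2 (b - a) (c - b)) : leftTurn a b c = 1 := if_pos h

lemma leftTurn_eq_zero {a b c : Pt} (h : det2 (b - a) (c - b) ≤ 0) : leftTurn a b c = 0 :=
  if_neg h.not_gt

lemma leftTurn_smul_left {a a' b c : Pt} {t : ℝ} (ht : 0 < t) (h : b - a' = t • (b - a)) :
    leftTurn a' b c = leftTurn a b c := by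
  unfold leftTurn
  rw [h, det2_smul_left]
  simp only [mul_pos_iff_of_pos_left ht]

lemma leftTurn_smul_right {a b c c' : Pt} {t : ℝ} (ht : 0 < t) (h : c' - b = t • (c - b)) :
    leftTurn a b c' = leftTurn a b c := by
  unfold leftTurn
  rw [h, det2_smul_right]
  simp only [mul_pos_iff_of_pos_left ht]

lemma eventually_pos_nhdsGT {g : ℝ → ℝ} (hg : Continuous g) (h0 : 0 < g 0) :
    ∀ᶠ ε in nhdsWithin (0 : ℝ) (Set.Ioi 0), 0 < g ε :=
  (hg.continuousAt.eventually_const_lt h0).filter_mono nhdsWithin_le_nhds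

lemma continuous_det2_comp {f g : ℝ → Pt} (hf : Continuous f) (hg : Continuous g) :
    Continuous fun ε => det2 (f ε) (g ε) :=
  continuous_det2.comp (hf.prodMk hg)

lemma segment_subset_hull (u b w : Pt) :
    segment ℝ u w ⊆ convexHull ℝ {u, b, w} ∧ segment ℝ w b ⊆ convexHull ℝ {u, b, w} := by
  constructor <;> rw [← convexHull_pair] <;> apply convexHull_mono
  · rintro x (rfl | rfl) <;> simp
  · rintro x (rfl | rfl) <;> simp

lemma disjoint_segment_of_det2 {u : Pt} {S : Finset Pt} (h : ∀ s ∈ S, det2 s u ≠ 0) :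
    Disjoint (segment ℝ 0 u) (S : Set Pt) := by
  rw [Set.disjoint_left]
  intro p hp hpS
  obtain ⟨t, -, -, rfl⟩ := mem_segment_iff_param.1 hp
  apply h _ hpS
  rw [zero_add, sub_zero, det2_smul_left, det2_self, mul_zero]

namespace SimplePolygon

variable {P : SimplePolygon}

lemma Insertable.wind_of_triangle {j : ℕ} {x y u b w : Pt} (h : P.Insertable j x y)
    (hseg : ∀ p ∈ (insert h).boundary, p ∈ P.boundary ∨ p ∈ segment ℝ u w ∨ p ∈ segment ℝ w b)
    (hwind : ∀ p, p ∉ P.edge j → p ∉ segment ℝ u w → p ∉ segment ℝ w b →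
      (insert h).wind p = P.wind p - windT u b w p)
    {S : Finset Pt} (hS : ∀ s ∈ S, s ∉ P.boundary)
    (hTS : Disjoint (convexHull ℝ {u, b, w}) (S : Set Pt))
    (h0 : (0 : Pt) ∉ P.boundary) (hw : P.wind 0 = 1)
    (d1 : 0 < det2 u b) (d2 : 0 < det2 b w) (d3 : 0 < det2 w u) :
    (0 : Pt) ∉ (insert h).boundary ∧ (insert h).wind 0 = 0 ∧
      ∀ s ∈ S, s ∉ (insert h).boundary ∧ (insert h).wind s = P.wind s := by
  have z1 : (0 : Pt) ∉ segment ℝ u w := by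
    rw [segment_symm]; exact zero_notMem_segment d3.ne'
  have z2 : (0 : Pt) ∉ segment ℝ w b := by
    rw [segment_symm]; exact zero_notMem_segment d2.ne'
  refine ⟨fun hb => ?_, ?_, fun s hs => ?_⟩
  · rcases hseg _ hb with h | h | h
    exacts [h0 h, z1 h, z2 h]
  · rw [hwind _ (fun h => h0 (P.edge_subset_boundary j h)) z1 z2, hw,
      windT_eq_one (by simpa using d1) (by simpa using d2) (by simpa using d3), sub_self]
  · have hsT : s ∉ convexHull ℝ {u, b, w} := fun h => Set.disjoint_left.1 hTS h hs
    have s1 : s ∉ segment ℝ u w := fun h => hsT ((segment_subset_hull u b w).1 h)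
    have s2 : s ∉ segment ℝ w b := fun h => hsT ((segment_subset_hull u b w).2 h)
    refine ⟨fun hb => ?_, ?_⟩
    · rcases hseg _ hb with h | h | h
      exacts [hS s hs h, s1 h, s2 h]
    · rw [hwind _ (fun h => hS s hs (P.edge_subset_boundary j h)) s1 s2, windT_eq_zero hsT,
        sub_zero]

lemma edge_meets_eq_left {j k : ℕ} (hjk : j % P.n ≠ k % P.n) {p : Pt} (hj : p ∈ P.edge j)
    (hk : p ∈ P.edge k) (hp : p ≠ P.vtx (k + 1)) : p = P.vtx k := by
  rcases P.simple_mod hjk hj hk with ⟨-, h⟩ | ⟨h, h'⟩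
  · exact h
  · exact absurd (h'.trans (P.vtx_eq_iff.2 h)) hp

lemma edge_meets_eq_right {j k : ℕ} (hjk : j % P.n ≠ k % P.n) {p : Pt} (hj : p ∈ P.edge j)
    (hk : p ∈ P.edge k) (hp : p ≠ P.vtx k) : p = P.vtx (k + 1) := by
  rcases P.simple_mod hjk hj hk with ⟨-, h⟩ | ⟨h, h'⟩
  · exact absurd h hp
  · exact h'.trans (P.vtx_eq_iff.2 h)

/-- A notch at the outgoing edge of a visible vertex. -/
lemma exists_notched_next (hccw : P.CCW) (h0 : (0 : Pt) ∉ P.boundary) (hw : P.wind 0 = 1)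
    {S : Finset Pt} (hS : ∀ s ∈ S, s ∉ P.boundary) (hSg : ∀ s ∈ S, ∀ i, det2 s (P.vtx i) ≠ 0)
    {k : ℕ} (hfree : P.FreeTo (P.vtx (k + 1)))
    (hf : 0 < det2 (P.vtx (k + 1)) (P.vtx (k + 2)))
    (h : (0 < det2 (P.vtx k) (P.vtx (k + 1)) ∧
        0 < det2 (P.vtx (k + 1) - P.vtx k) (P.vtx (k + 2) - P.vtx (k + 1))) ∨
      (det2 (P.vtx k) (P.vtx (k + 1)) < 0 ∧
        det2 (P.vtx (k + 2) - P.vtx (k + 1)) (P.vtx k - P.vtx (k + 1)) < 0)) :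
    ∃ P' : SimplePolygon, P'.CCW ∧ P'.numConvex ≤ P.numConvex + 1 ∧ P'.n ≤ P.n + 2 ∧
      (0 : Pt) ∉ P'.boundary ∧ P'.wind 0 = 0 ∧
      ∀ s ∈ S, s ∉ P'.boundary ∧ P'.wind s = P.wind s := by
  set u := P.vtx (k + 1) with hu
  set v := P.vtx (k + 2) with hv
  have huf : 0 < det2 u (v - u) := by rw [det2_sub_right, det2_self, sub_zero]; exact hf
  have e1 := eventually_notch (σ := 1) (u := u) (f := v - u) (d := P.vtx k - u)
    (K := P.far u ∪ S) ((isClosed_far u).union S.finite_toSet.isClosed)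
    (Set.disjoint_union_right.2
      ⟨hfree.disjoint_far, disjoint_segment_of_det2 fun s hs => hSg s hs _⟩)
    (by rwa [one_mul]) (by
      rw [one_mul, one_mul, det2_sub_left (P.vtx k) u u, det2_self, sub_zero]
      rcases h with h | h
      exacts [Or.inr h.1, Or.inl h.2])
  have e2 : ∀ᶠ ε in nhdsWithin (0 : ℝ) (Set.Ioi 0), 0 < P.shoelace +
      (det2 u (notchTip u (v - u) ε) + det2 (notchTip u (v - u) ε) (notchBase u (v - u) ε) +
        det2 (notchBase u (v - u) ε) v - det2 u v) := by
    refine eventually_pos_nhdsGT ?_ ?_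
    · have c1 := continuous_notchTip u (v - u)
      have c2 := continuous_notchBase u (v - u)
      exact continuous_const.add ((((continuous_det2_comp continuous_const c1).add
        (continuous_det2_comp c1 c2)).add (continuous_det2_comp c2 continuous_const)).sub
          continuous_const)
    · rw [notchTip_zero, notchBase_zero, det2_zero_left, det2_zero_right]
      have hsl : 0 < P.shoelace := hccw
      simpa using hsl
  have e3 : ∀ᶠ ε in nhdsWithin (0 : ℝ) (Set.Ioi 0),
      leftTurn (P.vtx k) u (notchTip u (v - u) ε) ≤ leftTurn (P.vtx k) u v := by
    rcases h with h | h
    · refine Filter.Eventually.of_forall fun ε => ?_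
      rw [leftTurn_eq_one h.2]
      exact leftTurn_le_one _ _ _
    · refine (eventually_pos_nhdsGT (g := fun ε => -det2 (u - P.vtx k) (notchTip u (v - u) ε - u))
        (continuous_det2_comp continuous_const
          ((continuous_notchTip u (v - u)).sub continuous_const)).neg ?_).mono fun ε hε => ?_
      · rw [notchTip_zero, zero_sub, det2_sub_left,
          show -u = (-1 : ℝ) • u by simp, det2_smul_right, det2_smul_right, det2_self]
        linarith [h.1]
      · rw [leftTurn_eq_zero (by linarith)]
        exact Nat.zero_le _
  obtain ⟨ε, ⟨⟨hTK, hTd⟩, hsh, hlt⟩, hε0, hε1⟩ :=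
    ((e1.and (e2.and e3)).and (Ioo_mem_nhdsGT (zero_lt_one (α := ℝ)))).exists
  set w := notchTip u (v - u) ε with hwdef
  set b := notchBase u (v - u) ε with hbdef
  rw [Set.disjoint_union_right] at hTK
  rw [add_sub_cancel, segment_symm] at hTd
  have hwne : det2 (v - u) (w - u) ≠ 0 := by
    rw [hwdef, det2_notchTip_sub]; exact (mul_pos (by linarith) huf).ne'
  have hhull : ∀ j, j % P.n ≠ (k + 1) % P.n → ∀ p ∈ convexHull ℝ {u, b, w}, p ∈ P.edge j →
      p = u := by
    intro j hj p hp hpj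
    rcases mem_far_or (k := k) hpj with h | h | h
    · exact absurd h (Set.disjoint_left.1 hTK.1 hp)
    · rw [P.edge_congr h] at hpj
      exact hTd p hp hpj
    · exact absurd h hj
  obtain ⟨hs1, hs2⟩ := segment_subset_hull u b w
  have hbuv : b ∈ segment ℝ u v := notchBase_mem_segment u v hε0.le hε1.le
  have hbv : segment ℝ b v ⊆ P.edge (k + 1) :=
    (convex_segment u v).segment_subset hbuv (right_mem_segment ℝ u v)
  have hins : P.Insertable (k + 1) w b :=
    { first := fun j hj p hp hpj => hhull j hj p (hs1 hp) hpj
      second := fun j hj p hp hpj => by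
        rw [hhull j hj p (hs2 hp) hpj] at hp
        exact notch_vertex_notMem hε0 hwne hp
      third := fun j hj p hp hpj =>
        edge_meets_eq_right hj hpj (hbv hp) (notch_base_side hε0 hwne hε1 hp).1
      first_second := fun p => notch_first_second hε0 hwne
      second_third := fun p => notch_second_third hε0 hwne hε1
      first_third := fun p => notch_first_third hε0 hwne hε1 }
  have hmain := hins.wind_of_triangle (u := u) (b := b) (w := w) (S := S)
    (fun p hp => by
      rcases mem_boundary_insert hins hp with h | h | h | h
      exacts [Or.inl h, Or.inr (Or.inl h), Or.inr (Or.inr h),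
        Or.inl (P.edge_subset_boundary _ (hbv h))])
    (fun p hp h1 h2 => by
      rw [wind_insert]
      have := ang_notch hbuv hp h1 h2
      change P.wind p + (ang p u w + ang p w b + ang p b v - ang p u v) / (2 * Real.pi) = _
      rw [this, sub_eq_add_neg])
    hS hTK.2 h0 hw (by rw [hbdef, det2_notchBase]; exact mul_pos hε0 huf)
    (by rw [hbdef, hwdef, det2_notchBase_notchTip]; exact mul_pos (pow_pos hε0 2) huf)
    (by rw [hwdef, det2_notchTip]; exact mul_pos (pow_pos hε0 2) huf)
  refine ⟨insert hins, ?_, ?_, le_rfl, hmain⟩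
  · unfold CCW; rw [shoelace_insert]; exact hsh
  · have h1 := numConvex_insert hins k rfl
    have h2 : leftTurn b v (P.vtx (k + 3)) = leftTurn u v (P.vtx (k + 3)) :=
      leftTurn_smul_left (t := 1 - ε) (by linarith) (by rw [hbdef, notchBase]; module)
    have h3 : leftTurn u w b = 0 := leftTurn_eq_zero (by
      have : det2 (w - u) (b - w) = - (ε * ((1 + 2 * ε) * det2 u (v - u))) := by
        rw [show b - w = ε • (v - u) - (w - u) by rw [hbdef, notchBase]; abel, det2_sub_right,
          det2_self, sub_zero, det2_smul_right, det2_swap, hwdef, det2_notchTip_sub]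
        ring
      rw [this]
      have := mul_pos hε0 (mul_pos (by linarith : 0 < 1 + 2 * ε) huf)
      linarith)
    have h4 := leftTurn_le_one w b v
    change _ + (leftTurn (P.vtx k) u v + leftTurn u v (P.vtx (k + 3))) =
      _ + (leftTurn (P.vtx k) u w + leftTurn u w b + leftTurn w b v +
        leftTurn b v (P.vtx (k + 3))) at h1
    omega

/-- A notch at the incoming edge of a visible vertex. -/
lemma exists_notched_prev (hccw : P.CCW) (h0 : (0 : Pt) ∉ P.boundary) (hw : P.wind 0 = 1)
    {S : Finset Pt} (hS : ∀ s ∈ S, s ∉ P.boundary) (hSg : ∀ s ∈ S, ∀ i, det2 s (P.vtx i) ≠ 0)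
    {k : ℕ} (hfree : P.FreeTo (P.vtx (k + 1)))
    (hf : 0 < det2 (P.vtx k) (P.vtx (k + 1)))
    (h : det2 (P.vtx (k + 1)) (P.vtx (k + 2)) < 0)
    (hd : det2 (P.vtx (k + 2) - P.vtx (k + 1)) (P.vtx k - P.vtx (k + 1)) < 0) :
    ∃ P' : SimplePolygon, P'.CCW ∧ P'.numConvex ≤ P.numConvex + 1 ∧ P'.n ≤ P.n + 2 ∧
      (0 : Pt) ∉ P'.boundary ∧ P'.wind 0 = 0 ∧
      ∀ s ∈ S, s ∉ P'.boundary ∧ P'.wind s = P.wind s := by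
  set u := P.vtx (k + 1) with hu
  set v := P.vtx k with hv
  have huf : det2 u (v - u) < 0 := by rw [det2_sub_right, det2_self, sub_zero, det2_swap]; linarith
  have e1 := eventually_notch (σ := -1) (u := u) (f := v - u) (d := P.vtx (k + 2) - u)
    (K := P.far u ∪ S) ((isClosed_far u).union S.finite_toSet.isClosed)
    (Set.disjoint_union_right.2
      ⟨hfree.disjoint_far, disjoint_segment_of_det2 fun s hs => hSg s hs _⟩)
    (by linarith) (Or.inl (by rw [det2_swap]; linarith))
  have e2 : ∀ᶠ ε in nhdsWithin (0 : ℝ) (Set.Ioi 0), 0 < P.shoelace +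
      (det2 v (notchBase u (v - u) ε) + det2 (notchBase u (v - u) ε) (notchTip u (v - u) ε) +
        det2 (notchTip u (v - u) ε) u - det2 v u) := by
    refine eventually_pos_nhdsGT ?_ ?_
    · have c1 := continuous_notchTip u (v - u)
      have c2 := continuous_notchBase u (v - u)
      exact continuous_const.add ((((continuous_det2_comp continuous_const c2).add
        (continuous_det2_comp c2 c1)).add (continuous_det2_comp c1 continuous_const)).sub
          continuous_const)
    · rw [notchTip_zero, notchBase_zero, det2_zero_left, det2_zero_right]
      have hsl : 0 < P.shoelace := hccw
      simpa using hsl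
  have e3 : ∀ᶠ ε in nhdsWithin (0 : ℝ) (Set.Ioi 0),
      leftTurn (notchTip u (v - u) ε) u (P.vtx (k + 2)) = 0 := by
    refine (eventually_pos_nhdsGT
      (g := fun ε => -det2 (u - notchTip u (v - u) ε) (P.vtx (k + 2) - u))
      (continuous_det2_comp (continuous_const.sub (continuous_notchTip u (v - u)))
        continuous_const).neg ?_).mono fun ε hε => ?_
    · rw [notchTip_zero, sub_zero, det2_sub_right, det2_self]
      linarith
    · exact leftTurn_eq_zero (by linarith)
  obtain ⟨ε, ⟨⟨hTK, hTd⟩, hsh, hlt⟩, hε0, hε1⟩ :=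
    ((e1.and (e2.and e3)).and (Ioo_mem_nhdsGT (zero_lt_one (α := ℝ)))).exists
  set w := notchTip u (v - u) ε with hwdef
  set b := notchBase u (v - u) ε with hbdef
  rw [Set.disjoint_union_right] at hTK
  rw [add_sub_cancel] at hTd
  have hdw : det2 (v - u) (w - u) < 0 := by
    rw [hwdef, det2_notchTip_sub]; exact mul_neg_of_pos_of_neg (by linarith) huf
  have hwne := hdw.ne
  have hhull : ∀ j, j % P.n ≠ k % P.n → ∀ p ∈ convexHull ℝ {u, b, w}, p ∈ P.edge j →
      p = u := by
    intro j hj p hp hpj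
    rcases mem_far_or (k := k) hpj with h | h | h
    · exact absurd h (Set.disjoint_left.1 hTK.1 hp)
    · exact absurd h hj
    · rw [P.edge_congr h] at hpj
      exact hTd p hp hpj
  obtain ⟨hs1, hs2⟩ := segment_subset_hull u b w
  have hbuv : b ∈ segment ℝ u v := notchBase_mem_segment u v hε0.le hε1.le
  have hvb : segment ℝ v b ⊆ P.edge k := by
    rw [segment_symm] at hbuv
    exact (convex_segment v u).segment_subset (left_mem_segment ℝ v u) hbuv
  have hins : P.Insertable k b w :=
    { first := fun j hj p hp hpj => edge_meets_eq_left hj hpj (hvb hp)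
        (notch_base_side hε0 hwne hε1 (segment_symm ℝ v b ▸ hp)).1
      second := fun j hj p hp hpj => by
        rw [segment_symm] at hp
        rw [hhull j hj p (hs2 hp) hpj] at hp
        exact notch_vertex_notMem hε0 hwne hp
      third := fun j hj p hp hpj => by
        rw [segment_symm] at hp
        exact hhull j hj p (hs1 hp) hpj
      first_second := fun p hp hp' => by
        rw [segment_symm] at hp hp'
        exact notch_second_third hε0 hwne hε1 hp' hp
      second_third := fun p hp hp' => by
        rw [segment_symm] at hp hp'
        exact notch_first_second hε0 hwne hp' hp
      first_third := fun p hp hp' => by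
        rw [segment_symm] at hp hp'
        exact notch_first_third hε0 hwne hε1 hp' hp }
  have hset : ({b, u, w} : Set Pt) = {u, b, w} := Set.insert_comm _ _ _
  have hmain := hins.wind_of_triangle (u := b) (b := u) (w := w) (S := S)
    (fun p hp => by
      rcases mem_boundary_insert hins hp with h | h | h | h
      exacts [Or.inl h, Or.inl (P.edge_subset_boundary _ (hvb h)), Or.inr (Or.inl h),
        Or.inr (Or.inr h)])
    (fun p hp h1 h2 => by
      rw [wind_insert]
      rw [segment_symm] at h1 h2
      have := ang_notch' hbuv (by rwa [segment_symm]) h2 h1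
      change P.wind p + (ang p v b + ang p b w + ang p w u - ang p v u) / (2 * Real.pi) = _
      rw [this, sub_eq_add_neg])
    hS (by rw [hset]; exact hTK.2) h0 hw
    (by rw [hbdef, det2_swap, det2_notchBase]; linarith [mul_neg_of_pos_of_neg hε0 huf])
    (by rw [hwdef, det2_swap, det2_notchTip]
        linarith [mul_neg_of_pos_of_neg (pow_pos hε0 2) huf])
    (by rw [hbdef, hwdef, det2_swap, det2_notchBase_notchTip]
        linarith [mul_neg_of_pos_of_neg (pow_pos hε0 2) huf])
  refine ⟨insert hins, ?_, ?_, le_rfl, hmain⟩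
  · unfold CCW; rw [shoelace_insert]; exact hsh
  · obtain ⟨l, hl⟩ := P.exists_mod_eq_succ k
    have h1 := numConvex_insert hins l hl.symm
    have h2 : leftTurn (P.vtx l) v b = leftTurn (P.vtx l) v u :=
      leftTurn_smul_right (t := 1 - ε) (by linarith) (by rw [hbdef, notchBase]; module)
    have h3 : leftTurn b w u = 0 := leftTurn_eq_zero (by
      have : det2 (w - b) (u - w) = ε * det2 (v - u) (w - u) := by
        rw [show u - w = -1 • (w - u) by simp,
          show w - b = (w - u) - ε • (v - u) by rw [hbdef, notchBase]; abel]
        simp only [det2, PiLp.sub_apply, PiLp.smul_apply, smul_eq_mul]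
        ring
      rw [this]
      exact (mul_neg_of_pos_of_neg hε0 hdw).le)
    have h4 := leftTurn_le_one v b w
    change _ + (leftTurn (P.vtx l) v u + leftTurn v u (P.vtx (k + 2))) =
      _ + (leftTurn (P.vtx l) v b + leftTurn v b w + leftTurn b w u +
        leftTurn w u (P.vtx (k + 2))) at h1
    omega

/-- The origin can be removed from a polygon in general position, without changing the side of
finitely many given points. -/
lemma exists_notched (hccw : P.CCW) (hg : P.Generic) (h0 : (0 : Pt) ∉ P.boundary)
    (hw : P.wind 0 = 1) {S : Finset Pt} (hS : ∀ s ∈ S, s ∉ P.boundary)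
    (hSg : ∀ s ∈ S, ∀ i, det2 s (P.vtx i) ≠ 0) :
    ∃ P' : SimplePolygon, P'.CCW ∧ P'.numConvex ≤ P.numConvex + 1 ∧ P'.n ≤ P.n + 2 ∧
      (0 : Pt) ∉ P'.boundary ∧ P'.wind 0 = 0 ∧
      ∀ s ∈ S, s ∉ P'.boundary ∧ P'.wind s = P.wind s := by
  obtain ⟨k, hfree, ⟨h1, h2 | ⟨h2, h3⟩⟩ | ⟨h1, h2⟩⟩ := exists_good_vtx hccw hg h0 hw
  · exact exists_notched_next hccw h0 hw hS hSg hfree h1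
      (Or.inr ⟨h2, hfree.det2_neg hccw hw (Or.inl ⟨h2, h1⟩)⟩)
  · exact exists_notched_next hccw h0 hw hS hSg hfree h1 (Or.inl ⟨h2, h3⟩)
  · exact exists_notched_prev hccw h0 hw hS hSg hfree h1 h2
      (hfree.det2_neg hccw hw (Or.inr ⟨h1, h2⟩))

end SimplePolygon

/-- A small displacement along a parabola. -/
def nudge (t : ℝ) : Pt := !₂[t, t ^ 2]

lemma continuous_nudge : Continuous nudge := by
  unfold nudge
  fun_prop

lemma nudge_zero : nudge 0 = 0 := by
  apply Pt.ext' <;> simp [nudge]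

lemma eventually_nudge {p : Pt → Prop} (h : ∀ᶠ x in nhds 0, p x) :
    ∀ᶠ t in nhdsWithin (0 : ℝ) (Set.Ioi 0), p (nudge t) := by
  have := continuous_nudge.tendsto 0
  rw [nudge_zero] at this
  exact (this.eventually h).filter_mono nhdsWithin_le_nhds

lemma eventually_add_det2_nudge_ne {w : Pt} (hw : w ≠ 0) (a : ℝ) :
    ∀ᶠ t in nhdsWithin (0 : ℝ) (Set.Ioi 0), a + det2 (nudge t) w ≠ 0 := by
  have e : ∀ t, det2 (nudge t) w = t * (w 1 - t * w 0) := by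
    intro t; simp [det2, nudge]; ring
  simp only [e]
  rcases eq_or_ne a 0 with rfl | ha
  · have h2 : ∀ᶠ t in nhdsWithin (0 : ℝ) (Set.Ioi 0), w 1 - t * w 0 ≠ 0 := by
      rcases eq_or_ne (w 1) 0 with h1 | h1
      · have h0 : w 0 ≠ 0 := fun h0 => hw (Pt.ext' (by simpa using h0) (by simpa using h1))
        filter_upwards [self_mem_nhdsWithin] with t ht
        rw [h1, zero_sub]
        exact neg_ne_zero.2 (mul_ne_zero (ne_of_gt ht) h0)
      · exact ((show Continuous fun t : ℝ => w 1 - t * w 0 by fun_prop).continuousAt.eventually_ne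
          (by simpa using h1)).filter_mono nhdsWithin_le_nhds
    filter_upwards [h2, self_mem_nhdsWithin] with t h2 ht
    rw [zero_add]
    exact mul_ne_zero (ne_of_gt ht) h2
  · exact ((show Continuous fun t : ℝ => a + t * (w 1 - t * w 0) by
      fun_prop).continuousAt.eventually_ne (by simpa using ha)).filter_mono nhdsWithin_le_nhds

namespace SimplePolygon

variable {P : SimplePolygon}

lemma eventually_wind_eq (hccw : P.CCW) {s : Pt} (hs : s ∉ P.boundary) :
    ∀ᶠ x in nhds s, x ∉ P.boundary ∧ P.wind x = P.wind s := by
  have hc : ContinuousAt P.wind s := continuousAt_windS (by rwa [← P.boundary_eq])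
  filter_upwards [P.isClosed_boundary.isOpen_compl.mem_nhds hs,
    hc.eventually (Metric.ball_mem_nhds _ one_pos)] with x hx hd
  refine ⟨hx, ?_⟩
  rw [Real.dist_eq] at hd
  rcases P.wind_of_ccw hccw hx with h1 | h1 <;> rcases P.wind_of_ccw hccw hs with h2 | h2 <;>
    rw [h1, h2] at hd ⊢ <;> norm_num at hd

lemma Generic.zero_notMem_boundary (hg : P.Generic) : (0 : Pt) ∉ P.boundary := by
  intro h
  obtain ⟨j, hj⟩ := P.mem_boundary.1 h
  exact zero_notMem_segment (hg j (j + 1) (P.succ_mod_ne j).symm) hj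

lemma eventually_generic (q : Pt) :
    ∀ᶠ t in nhdsWithin (0 : ℝ) (Set.Ioi 0), (P.translate (nudge t - q)).Generic := by
  have h : ∀ᶠ t in nhdsWithin (0 : ℝ) (Set.Ioi 0), ∀ i ∈ Finset.range P.n,
      ∀ j ∈ Finset.range P.n, i ≠ j →
        det2 (P.vtx i - q) (P.vtx j - q) + det2 (nudge t) (P.vtx j - P.vtx i) ≠ 0 := by
    rw [Filter.eventually_all_finset]
    intro i hi
    rw [Filter.eventually_all_finset]
    intro j hj
    rw [Filter.eventually_imp_distrib_left]
    intro hij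
    refine eventually_add_det2_nudge_ne (fun h => hij ?_) _
    exact P.inj i (Finset.mem_range.1 hi) j (Finset.mem_range.1 hj) (sub_eq_zero.1 h).symm
  filter_upwards [h] with t ht i j hij
  rw [translate_n] at hij
  have := ht (i % P.n) (Finset.mem_range.2 (Nat.mod_lt _ P.n_pos)) (j % P.n)
    (Finset.mem_range.2 (Nat.mod_lt _ P.n_pos)) hij
  rw [P.vtx_mod, P.vtx_mod] at this
  rw [translate_vtx, translate_vtx]
  convert this using 1
  simp only [det2, PiLp.sub_apply, PiLp.add_apply]
  ring

lemma eventually_det2_translate_ne {s q : Pt} (hs : s ≠ q) :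
    ∀ᶠ t in nhdsWithin (0 : ℝ) (Set.Ioi 0),
      ∀ i, det2 (s - q) ((P.translate (nudge t - q)).vtx i) ≠ 0 := by
  have h : ∀ᶠ t in nhdsWithin (0 : ℝ) (Set.Ioi 0), ∀ i ∈ Finset.range P.n,
      det2 (s - q) (P.vtx i - q) + det2 (nudge t) (q - s) ≠ 0 := by
    rw [Filter.eventually_all_finset]
    exact fun i _ => eventually_add_det2_nudge_ne (sub_ne_zero.2 hs.symm) _
  filter_upwards [h] with t ht i
  have := ht (i % P.n) (Finset.mem_range.2 (Nat.mod_lt _ P.n_pos))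
  rw [P.vtx_mod] at this
  rw [translate_vtx]
  convert this using 1
  simp only [det2, PiLp.sub_apply, PiLp.add_apply]
  ring

/-- A point can be removed from a polygon without changing the side of finitely many others. -/
lemma exists_remove_point (hccw : P.CCW) (q : Pt) {S : Finset Pt} (hq : q ∉ S)
    (hS : ∀ s ∈ S, s ∉ P.boundary) :
    ∃ P' : SimplePolygon, P'.CCW ∧ P'.numConvex ≤ P.numConvex + 1 ∧ P'.n ≤ P.n + 2 ∧
      q ∉ P'.boundary ∧ P'.wind q = 0 ∧
      ∀ s ∈ S, s ∉ P'.boundary ∧ P'.wind s = P.wind s := by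
  have h1 : ∀ᶠ t in nhdsWithin (0 : ℝ) (Set.Ioi 0), ∀ s ∈ S,
      (s - nudge t ∉ P.boundary ∧ P.wind (s - nudge t) = P.wind s) ∧
        ∀ i, det2 (s - q) ((P.translate (nudge t - q)).vtx i) ≠ 0 := by
    rw [Filter.eventually_all_finset]
    intro s hs
    refine Filter.Eventually.and ?_ (eventually_det2_translate_ne fun h => hq (h ▸ hs))
    refine eventually_nudge (p := fun x => s - x ∉ P.boundary ∧ P.wind (s - x) = P.wind s) ?_
    have : Filter.Tendsto (fun x : Pt => s - x) (nhds 0) (nhds s) := by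
      have := (show Continuous fun x : Pt => s - x by fun_prop).tendsto 0
      rwa [sub_zero] at this
    exact this.eventually (eventually_wind_eq hccw (hS s hs))
  obtain ⟨t, h1, hg⟩ := (h1.and (P.eventually_generic q)).exists
  set Q := P.translate (nudge t - q) with hQ
  have hQccw : Q.CCW := by unfold CCW; rw [shoelace_translate]; exact hccw
  have hQc : Q.numConvex = P.numConvex := P.numConvex_translate _
  have h0 := hg.zero_notMem_boundary
  have hQb : ∀ s ∈ S, s - q ∉ Q.boundary ∧ Q.wind (s - q) = P.wind s := by
    intro s hs
    rw [hQ, mem_boundary_translate, wind_translate, sub_sub_sub_cancel_right]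
    exact (h1 s hs).1
  obtain ⟨P', hc, hnc, hn, hb, hw, hPS⟩ : ∃ P' : SimplePolygon, P'.CCW ∧
      P'.numConvex ≤ P.numConvex + 1 ∧ P'.n ≤ P.n + 2 ∧
      (0 : Pt) ∉ P'.boundary ∧ P'.wind 0 = 0 ∧
      ∀ s ∈ S, s - q ∉ P'.boundary ∧ P'.wind (s - q) = P.wind s := by
    rcases Q.wind_of_ccw hQccw h0 with hw | hw
    · exact ⟨Q, hQccw, by omega, Nat.le_add_right _ _, h0, hw, hQb⟩
    · obtain ⟨P', hc, hnc, hn, hb, hw', hPS⟩ := exists_notched hQccw hg h0 hw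
        (S := S.image fun s => s - q)
        (by
          simp only [Finset.forall_mem_image]
          exact fun s hs => (hQb s hs).1)
        (by
          simp only [Finset.forall_mem_image]
          exact fun s hs => (h1 s hs).2)
      refine ⟨P', hc, by omega, hn, hb, hw', fun s hs => ?_⟩
      obtain ⟨h2, h3⟩ := hPS (s - q) (Finset.mem_image_of_mem _ hs)
      exact ⟨h2, h3.trans (hQb s hs).2⟩
  refine ⟨P'.translate q, ?_, ?_, hn, ?_, ?_, fun s hs => ?_⟩
  · unfold CCW; rw [shoelace_translate]; exact hc
  · rw [numConvex_translate]; exact hnc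
  · rw [mem_boundary_translate, sub_self]; exact hb
  · rw [wind_translate, sub_self]; exact hw
  · rw [mem_boundary_translate, wind_translate]; exact hPS s hs

end SimplePolygon

/-- Adding one point to a separable set keeps it separable, adding at most two
vertices (and at most one convex vertex) to the separating polygon. -/
theorem add_point_separable
    (B R : Finset Pt) (hdisj : Disjoint B R) (q : Pt) (hq : q ∉ B ∪ R)
    (P : SimplePolygon) (hccw : P.CCW) (hconv : P.numConvex ≤ B.card)
    (hR : ∀ r ∈ R, r ∈ P.interior) (hB : ∀ b ∈ B, b ∉ P.region) :
    ∃ P' : SimplePolygon, P'.CCW ∧ P'.numConvex ≤ B.card + 1 ∧ P'.n ≤ P.n + 2 ∧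
      (∀ r ∈ R, r ∈ P'.interior) ∧ (∀ b ∈ B, b ∉ P'.region) ∧ q ∉ P'.region := by
  have hR' := fun r hr => (P.mem_interior_iff_of_ccw hccw).1 (hR r hr)
  have hB' := fun b hb => P.notMem_region_iff.1 (hB b hb)
  obtain ⟨P', hc, hnc, hn, hqb, hqw, hS⟩ := SimplePolygon.exists_remove_point hccw q hq
    (fun s hs => (Finset.mem_union.1 hs).elim (fun h => (hB' s h).1) fun h => (hR' s h).1)
  refine ⟨P', hc, by omega, hn, fun r hr => ?_, fun b hb => ?_, P'.notMem_region_iff.2 ⟨hqb, hqw⟩⟩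
  · obtain ⟨h1, h2⟩ := hS r (Finset.mem_union_right _ hr)
    exact (P'.mem_interior_iff_of_ccw hc).2 ⟨h1, h2.trans (hR' r hr).2⟩
  · obtain ⟨h1, h2⟩ := hS b (Finset.mem_union_left _ hb)
    exact P'.notMem_region_iff.2 ⟨h1, h2.trans (hB' b hb).2⟩
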